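/- arXiv:1611.08752 — 4 statements merged into one kernel-verified Lean document; each statement's English description precedes it below -/
import Mathlib

section
/- There exists a universal constant C > 0 such that for every n ≥ 1 and every set system S_1, …, S_n ⊆ {1,…,n} of n sets over n elements, there exists a coloring x ∈ {-1,1}^n with |∑_{j ∈ S_i} x_j| ≤ C·√n for every i ∈ {1,…,n}. -/
namespace Spencer

open Finset

/-- Geometric sum over a symmetric integer interval. -/
lemma geom_sum_le (r : ℝ) (h0 : 0 ≤ r) (h1 : r ≤ 1 / 2) (M : ℕ) :
    ∑ k ∈ Icc (-(M : ℤ)) M, r ^ k.natAbs ≤ 1 + 4 * r - 4 * r ^ (M + 1) := by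
  induction M with
  | zero => simp
  | succ M ih =>
    have e : Icc (-((M + 1 : ℕ) : ℤ)) ((M + 1 : ℕ) : ℤ)
        = insert (-((M + 1 : ℕ) : ℤ)) (insert ((M + 1 : ℕ) : ℤ) (Icc (-(M : ℤ)) M)) := by
      ext k
      simp only [mem_insert, mem_Icc]
      push_cast
      omega
    rw [e, sum_insert, sum_insert]
    · have h2 : (-((M + 1 : ℕ) : ℤ)).natAbs = M + 1 := by omega
      have h3 : (((M + 1 : ℕ) : ℤ)).natAbs = M + 1 := by omega
      rw [h2, h3]
      have h4 : 0 ≤ r ^ (M + 1) := by positivity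
      have h5 : r ^ (M + 1 + 1) = r ^ (M + 1) * r := pow_succ _ _
      nlinarith
    · simp only [mem_Icc]; push_cast; omega
    · simp only [mem_insert, mem_Icc]; push_cast; omega

/-- Number of integer vectors of small `ℓ¹` norm. -/
lemma card_le_exp {N : ℕ} (G : Finset (Fin N → ℤ)) (R s : ℝ) (hs : 1 ≤ s)
    (hG : ∀ b ∈ G, ∑ i, ((b i).natAbs : ℝ) ≤ R) :
    (#G : ℝ) ≤ Real.exp (s * R + 4 * Real.exp (-s) * N) := by
  set r := Real.exp (-s) with hr
  have hr0 : 0 < r := Real.exp_pos _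
  have hr1 : r ≤ 1 / 2 := by
    have := Real.exp_neg_one_lt_half
    have h2 : r ≤ Real.exp (-1) := Real.exp_le_exp.2 (by linarith)
    linarith
  set M := ⌊R⌋₊
  have hbox : G ⊆ Fintype.piFinset (fun _ : Fin N => Icc (-(M : ℤ)) M) := by
    intro b hb
    rw [Fintype.mem_piFinset]
    intro i
    have h1 : ((b i).natAbs : ℝ) ≤ R :=
      le_trans (single_le_sum (f := fun i => ((b i).natAbs : ℝ))
        (fun _ _ => by positivity) (mem_univ i)) (hG b hb)
    have h2 : (b i).natAbs ≤ M := Nat.le_floor h1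
    rw [mem_Icc]; omega
  have key : ∀ b : Fin N → ℤ, ∏ i, r ^ (b i).natAbs
      = Real.exp (-s * ∑ i, ((b i).natAbs : ℝ)) := by
    intro b
    rw [mul_sum, Real.exp_sum]
    refine prod_congr rfl fun i _ => ?_
    rw [hr, ← Real.exp_nat_mul]; ring_nf
  have h1 : (#G : ℝ) ≤ ∑ b ∈ G, Real.exp (s * R) * ∏ i, r ^ (b i).natAbs := by
    rw [card_eq_sum_ones]; push_cast
    refine sum_le_sum fun b hb => ?_
    rw [key, ← Real.exp_add]
    apply Real.one_le_exp
    have := hG b hb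
    nlinarith
  have h2 : ∑ b ∈ G, Real.exp (s * R) * ∏ i, r ^ (b i).natAbs
      ≤ Real.exp (s * R) * (∑ k ∈ Icc (-(M : ℤ)) M, r ^ k.natAbs) ^ N := by
    rw [← mul_sum]
    refine mul_le_mul_of_nonneg_left ?_ (Real.exp_pos _).le
    have h3 := sum_prod_piFinset (ι := Fin N) (Icc (-(M : ℤ)) M) (fun _ k => r ^ k.natAbs)
    rw [prod_const, card_univ, Fintype.card_fin] at h3
    rw [← h3]
    exact sum_le_sum_of_subset_of_nonneg hbox (fun _ _ _ => by positivity)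
  have h4 : (∑ k ∈ Icc (-(M : ℤ)) M, r ^ k.natAbs) ≤ Real.exp (4 * r) := by
    have a := geom_sum_le r hr0.le hr1 M
    have b := Real.add_one_le_exp (4 * r)
    have c : 0 ≤ r ^ (M + 1) := by positivity
    linarith
  have h5 : (∑ k ∈ Icc (-(M : ℤ)) M, r ^ k.natAbs) ^ N ≤ Real.exp (4 * r * N) := by
    rw [mul_comm (4 * r), Real.exp_nat_mul]
    exact pow_le_pow_left₀ (sum_nonneg fun _ _ => by positivity) h4 N
  rw [Real.exp_add]
  exact h1.trans (h2.trans (mul_le_mul_of_nonneg_left h5 (Real.exp_pos _).le))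

variable {ι : Type*} [DecidableEq ι]

/-- Volume of a Hamming ball. -/
lemma ball_le (A : Finset ι) (F : Finset (Finset ι)) (T₀ : Finset ι) (hT₀ : T₀ ⊆ A)
    (hF : ∀ T ∈ F, T ⊆ A ∧ 16 * #(symmDiff T₀ T) ≤ #A) :
    (#F : ℝ) ≤ Real.exp ((1 / 8 + Real.exp (-2)) * #A) := by
  have h1 : (#F : ℝ) ≤ ∑ T ∈ F, Real.exp (#A / 8) * Real.exp (-2) ^ #(symmDiff T₀ T) := by
    rw [card_eq_sum_ones]; push_cast
    refine sum_le_sum fun T hT => ?_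
    rw [← Real.exp_nat_mul, ← Real.exp_add]
    apply Real.one_le_exp
    have : (16 * #(symmDiff T₀ T) : ℝ) ≤ #A := by exact_mod_cast (hF T hT).2
    linarith
  have h2 : ∑ T ∈ F, Real.exp (-2) ^ #(symmDiff T₀ T) ≤
      ∑ D ∈ A.powerset, Real.exp (-2) ^ #D := by
    rw [← sum_image (s := F) (g := fun T => symmDiff T₀ T) (f := fun D => Real.exp (-2) ^ #D)
      (fun x _ y _ h => symmDiff_right_injective T₀ h)]
    refine sum_le_sum_of_subset_of_nonneg ?_ (fun _ _ _ => by positivity)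
    intro D hD
    obtain ⟨T, hT, rfl⟩ := mem_image.1 hD
    rw [mem_powerset]
    intro x hx
    rcases mem_symmDiff.1 hx with h | h
    · exact hT₀ h.1
    · exact (hF T hT).1 h.1
  have h3 : ∑ D ∈ A.powerset, Real.exp (-2) ^ #D ≤ Real.exp (Real.exp (-2) * #A) := by
    have := sum_pow_mul_eq_add_pow (Real.exp (-2)) 1 A
    simp only [one_pow, mul_one] at this
    rw [this, mul_comm _ (#A : ℝ), Real.exp_nat_mul]
    exact pow_le_pow_left₀ (by positivity) (Real.add_one_le_exp _) _
  rw [← mul_sum] at h1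
  refine h1.trans ?_
  rw [show (1 / 8 + Real.exp (-2)) * (#A : ℝ) = #A / 8 + Real.exp (-2) * #A by ring, Real.exp_add]
  exact mul_le_mul_of_nonneg_left (h2.trans h3) (Real.exp_pos _).le

/-- The sign vector of a subset. -/
noncomputable def sg (T : Finset ι) (j : ι) : ℝ := if j ∈ T then 1 else -1

/-- The signed sum. -/
noncomputable def ds (A : Finset ι) (a : ι → ℝ) (T : Finset ι) : ℝ := ∑ j ∈ A, a j * sg T j

/-- Moment generating function. -/
lemma mgf_le (A : Finset ι) (a : ι → ℝ) (ha : ∀ j, |a j| ≤ 1) (l : ℝ) :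
    ∑ T ∈ A.powerset, Real.exp (l * ds A a T) ≤ 2 ^ #A * Real.exp (l ^ 2 / 2 * #A) := by
  have h1 : ∑ T ∈ A.powerset, Real.exp (l * ds A a T)
      = ∏ j ∈ A, (Real.exp (l * a j) + Real.exp (-(l * a j))) := by
    rw [prod_add]
    refine sum_congr rfl fun T hT => ?_
    have hT' := mem_powerset.1 hT
    rw [ds, mul_sum, Real.exp_sum, ← prod_sdiff hT', mul_comm]
    congr 1
    · refine prod_congr rfl fun j hj => ?_
      simp [sg, hj]
    · refine prod_congr rfl fun j hj => ?_
      simp [sg, (mem_sdiff.1 hj).2]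
  rw [h1, mul_comm _ (#A : ℝ), Real.exp_nat_mul, ← mul_pow]
  rw [← prod_const]
  refine prod_le_prod (fun j _ => by positivity) fun j _ => ?_
  have h2 := Real.cosh_le_exp_half_sq (l * a j)
  rw [Real.cosh_eq] at h2
  have h3 : Real.exp ((l * a j) ^ 2 / 2) ≤ Real.exp (l ^ 2 / 2) := by
    apply Real.exp_le_exp.2
    have h4 : a j ^ 2 ≤ 1 := (sq_le_one_iff_abs_le_one _).2 (ha j)
    have : l ^ 2 * a j ^ 2 ≤ l ^ 2 * 1 := mul_le_mul_of_nonneg_left h4 (sq_nonneg l)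
    rw [mul_pow]; linarith
  linarith

/-- Pointwise bound on the rounded value. -/
lemma round_le (y t : ℝ) (ht : 1 ≤ t) :
    ((round y).natAbs : ℝ) ≤ Real.exp (-t) * (Real.exp (2 * t * y) + Real.exp (-(2 * t * y))) := by
  have hc : ((round y).natAbs : ℝ) = |(round y : ℝ)| := by
    rw [Nat.cast_natAbs, Int.cast_abs]
  by_cases h0 : round y = 0
  · rw [h0]; simp; positivity
  have h1 : (1 : ℝ) ≤ |(round y : ℝ)| := by
    rw [← Int.cast_abs]; exact_mod_cast Int.one_le_abs h0
  have h2 := abs_sub_round y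
  have h3 : |(round y : ℝ)| ≤ |y| + 1 / 2 := by
    have := abs_sub_abs_le_abs_sub (round y : ℝ) y
    rw [abs_sub_comm] at this
    linarith
  have h4 : |(round y : ℝ)| ≤ Real.exp (t * (2 * |y| - 1)) := by
    have h5 := Real.add_one_le_exp (t * (2 * |y| - 1))
    have h6 : (2 * |y| - 1) ≤ t * (2 * |y| - 1) := by nlinarith
    linarith
  have h7 : Real.exp (t * (2 * |y| - 1)) = Real.exp (-t) * Real.exp (2 * t * |y|) := by
    rw [← Real.exp_add]; ring_nf
  rw [hc]
  refine h4.trans (h7.le.trans (mul_le_mul_of_nonneg_left ?_ (Real.exp_pos _).le))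
  rcases abs_cases y with ⟨h, _⟩ | ⟨h, _⟩ <;> rw [h]
  · linarith [Real.exp_pos (-(2 * t * y))]
  · rw [mul_neg]; linarith [Real.exp_pos (2 * t * y)]

/-- Average of the rounded value. -/
lemma avg_round_le (A : Finset ι) (a : ι → ℝ) (ha : ∀ j, |a j| ≤ 1) (Δ t : ℝ) (hΔ : 0 < Δ)
    (ht : 1 ≤ t) (hA : Δ ^ 2 = t * #A) :
    ∑ T ∈ A.powerset, ((round (ds A a T / (2 * Δ))).natAbs : ℝ)
      ≤ 2 ^ #A * (2 * Real.exp (-t / 2)) := by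
  have h1 : ∀ T ∈ A.powerset, ((round (ds A a T / (2 * Δ))).natAbs : ℝ) ≤
      Real.exp (-t) * (Real.exp (t / Δ * ds A a T) + Real.exp (-(t / Δ) * ds A a T)) := by
    intro T _
    have := round_le (ds A a T / (2 * Δ)) t ht
    have e : 2 * t * (ds A a T / (2 * Δ)) = t / Δ * ds A a T := by field_simp
    rw [e] at this
    rwa [neg_mul]
  refine (sum_le_sum h1).trans ?_
  rw [← mul_sum, sum_add_distrib]
  have h2 := mgf_le A a ha (t / Δ)
  have h3 := mgf_le A a ha (-(t / Δ))
  have e : (t / Δ) ^ 2 / 2 * #A = t / 2 := by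
    have : (#A : ℝ) = Δ ^ 2 / t := by rw [hA]; field_simp
    rw [this]; field_simp
  rw [neg_sq] at h3
  rw [e] at h2 h3
  have h4 : Real.exp (-t / 2) = Real.exp (-t) * Real.exp (t / 2) := by
    rw [← Real.exp_add]; ring_nf
  rw [h4]
  have := mul_le_mul_of_nonneg_left (add_le_add h2 h3) (Real.exp_pos (-t)).le
  linarith

/-- Partial coloring. -/
lemma partial_coloring {N : ℕ} (A : Finset ι) (a : Fin N → ι → ℝ) (ha : ∀ i j, |a i j| ≤ 1)
    (hk : 10 ≤ #A) (v Δ : ℝ) (hv : 1 ≤ v) (hN : (N : ℝ) = v ^ 2 * #A) (hΔ : 0 < Δ)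
    (hΔ2 : Δ ^ 2 = 16 * v * #A) :
    ∃ T T' : Finset ι, T ⊆ A ∧ T' ⊆ A ∧ #A < 16 * #(symmDiff T T') ∧
      ∀ i, |ds A (a i) T - ds A (a i) T'| ≤ 2 * Δ := by
  by_contra! hcon
  let b : Finset ι → Fin N → ℤ := fun T i => round (ds A (a i) T / (2 * Δ))
  have hsame : ∀ T T', b T = b T' → ∀ i, |ds A (a i) T - ds A (a i) T'| ≤ 2 * Δ := by
    intro T T' h i
    have h1 : round (ds A (a i) T / (2 * Δ)) = round (ds A (a i) T' / (2 * Δ)) := congrFun h i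
    have h2 := abs_sub_round (ds A (a i) T / (2 * Δ))
    have h3 := abs_sub_round (ds A (a i) T' / (2 * Δ))
    rw [h1] at h2
    have h4 : |ds A (a i) T / (2 * Δ) - ds A (a i) T' / (2 * Δ)| ≤ 1 := by
      rw [abs_le] at *
      constructor <;> linarith
    rw [← sub_div, abs_div, abs_of_pos (by positivity : 0 < 2 * Δ),
      div_le_one (by positivity)] at h4
    exact h4
  set k : ℝ := (#A : ℝ) with hkdef
  have hk' : (10 : ℝ) ≤ k := by rw [hkdef]; exact_mod_cast hk
  set R : ℝ := 4 * N * Real.exp (-(8 * v)) with hR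
  have hNpos : (0 : ℝ) < N := by rw [hN]; positivity
  have hRpos : 0 < R := by positivity
  let W : Finset ι → ℝ := fun T => ∑ i, ((b T i).natAbs : ℝ)
  have hW0 : ∀ T, 0 ≤ W T := fun T => sum_nonneg fun _ _ => by positivity
  have hWsum : ∑ T ∈ A.powerset, W T ≤ 2 ^ #A * R / 2 := by
    rw [sum_comm]
    have : ∀ i ∈ (univ : Finset (Fin N)), ∑ T ∈ A.powerset, ((b T i).natAbs : ℝ)
        ≤ 2 ^ #A * (2 * Real.exp (-(16 * v) / 2)) := fun i _ =>
      avg_round_le A (a i) (ha i) Δ (16 * v) hΔ (by linarith) hΔ2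
    refine (sum_le_sum this).trans ?_
    rw [sum_const, card_univ, Fintype.card_fin, nsmul_eq_mul, hR,
      show -(16 * v) / 2 = -(8 * v) by ring]
    apply le_of_eq; ring
  set good := A.powerset.filter (fun T => W T ≤ R) with hgood
  have hgoodcard : (2 : ℝ) ^ #A ≤ 2 * #good := by
    have h1 : ∑ T ∈ A.powerset.filter (fun T => ¬ W T ≤ R), R
        ≤ ∑ T ∈ A.powerset, W T :=
      (sum_le_sum (fun T hT => (not_le.1 (mem_filter.1 hT).2).le)).trans
        (sum_le_sum_of_subset_of_nonneg (filter_subset _ _) (fun T _ _ => hW0 T))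
    rw [sum_const, nsmul_eq_mul] at h1
    have h2 := card_filter_add_card_filter_not (s := A.powerset) (fun T => W T ≤ R)
    rw [card_powerset] at h2
    have h3 : (#good : ℝ) + #(A.powerset.filter (fun T => ¬ W T ≤ R)) = 2 ^ #A := by
      exact_mod_cast h2
    have h4 : (#(A.powerset.filter (fun T => ¬ W T ≤ R)) : ℝ) * R ≤ (2 ^ #A / 2) * R := by
      linarith
    have h5 := le_of_mul_le_mul_right h4 hRpos
    linarith
  have himg : (#(good.image b) : ℝ) ≤ Real.exp (k / 8) := by
    refine (card_le_exp (good.image b) R (4 * v) (by linarith) ?_).trans ?_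
    · intro c hc
      obtain ⟨T, hT, rfl⟩ := mem_image.1 hc
      exact (mem_filter.1 hT).2
    · apply Real.exp_le_exp.2
      have hv1 : v ≤ Real.exp (v - 1) := by
        have := Real.add_one_le_exp (v - 1); linarith
      have hE : Real.exp (-1) ≤ 0.37 := by linarith [Real.exp_neg_one_lt_d9]
      have hE4 : Real.exp (-4) ≤ 0.37 ^ 4 := by
        rw [show (-4 : ℝ) = ((4 : ℕ) : ℝ) * (-1) by norm_num, Real.exp_nat_mul]
        exact pow_le_pow_left₀ (Real.exp_pos _).le hE 4
      have hE8 : Real.exp (-8) ≤ 0.37 ^ 8 := by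
        rw [show (-8 : ℝ) = ((8 : ℕ) : ℝ) * (-1) by norm_num, Real.exp_nat_mul]
        exact pow_le_pow_left₀ (Real.exp_pos _).le hE 8
      have p3 : v ^ 3 * Real.exp (-(8 * v)) ≤ 0.37 ^ 8 := by
        have : v ^ 3 ≤ Real.exp (v - 1) ^ 3 := pow_le_pow_left₀ (by linarith) hv1 3
        rw [← Real.exp_nat_mul] at this
        refine (mul_le_mul_of_nonneg_right this (Real.exp_pos _).le).trans ?_
        rw [← Real.exp_add]
        refine (Real.exp_le_exp.2 ?_).trans hE8
        push_cast; linarith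
      have p2 : v ^ 2 * Real.exp (-(4 * v)) ≤ 0.37 ^ 4 := by
        have : v ^ 2 ≤ Real.exp (v - 1) ^ 2 := pow_le_pow_left₀ (by linarith) hv1 2
        rw [← Real.exp_nat_mul] at this
        refine (mul_le_mul_of_nonneg_right this (Real.exp_pos _).le).trans ?_
        rw [← Real.exp_add]
        refine (Real.exp_le_exp.2 ?_).trans hE4
        push_cast; linarith
      have e : 4 * v * R + 4 * Real.exp (-(4 * v)) * N
          = (16 * (v ^ 3 * Real.exp (-(8 * v))) + 4 * (v ^ 2 * Real.exp (-(4 * v)))) * k := by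
        rw [hR, hN]; ring
      rw [e, div_eq_inv_mul]
      apply mul_le_mul_of_nonneg_right _ (by linarith)
      norm_num at p2 p3 ⊢
      linarith
  have hfib : ∀ c ∈ good.image b,
      (#(good.filter (fun T => b T = c)) : ℝ) ≤ Real.exp ((1 / 8 + Real.exp (-2)) * k) := by
    intro c hc
    obtain ⟨T₀, hT₀, rfl⟩ := mem_image.1 hc
    have hT₀A : T₀ ⊆ A := mem_powerset.1 (mem_filter.1 hT₀).1
    apply ball_le A _ T₀ hT₀A
    intro T hT
    obtain ⟨hT1, hT2⟩ := mem_filter.1 hT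
    have hTA : T ⊆ A := mem_powerset.1 (mem_filter.1 hT1).1
    refine ⟨hTA, ?_⟩
    by_contra! hlt
    obtain ⟨i, hi⟩ := hcon T₀ T hT₀A hTA hlt
    exact absurd (hsame T₀ T hT2.symm i) (not_le.2 hi)
  have hcount : (#good : ℝ) ≤ Real.exp (k / 8) * Real.exp ((1 / 8 + Real.exp (-2)) * k) := by
    have h1 : #good = ∑ c ∈ good.image b, #(good.filter (fun T => b T = c)) :=
      card_eq_sum_card_image b good
    rw [h1]; push_cast
    refine (sum_le_sum hfib).trans ?_
    rw [sum_const, nsmul_eq_mul]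
    exact mul_le_mul_of_nonneg_right himg (Real.exp_pos _).le
  have hE2 : Real.exp (-2) ≤ 0.37 ^ 2 := by
    rw [show (-2 : ℝ) = ((2 : ℕ) : ℝ) * (-1) by norm_num, Real.exp_nat_mul]
    exact pow_le_pow_left₀ (Real.exp_pos _).le (by linarith [Real.exp_neg_one_lt_d9]) 2
  have h2k : (2 : ℝ) ^ #A = Real.exp (k * Real.log 2) := by
    rw [hkdef, Real.exp_nat_mul, Real.exp_log (by norm_num)]
  have hfin : Real.exp (k * Real.log 2) ≤
      Real.exp (1 + (k / 8 + (1 / 8 + Real.exp (-2)) * k)) := by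
    rw [← h2k, Real.exp_add, Real.exp_add]
    refine hgoodcard.trans (mul_le_mul Real.exp_one_gt_two.le hcount (by positivity)
      (Real.exp_pos _).le)
  have hfin' := Real.exp_le_exp.1 hfin
  have hl := Real.log_two_gt_d9
  nlinarith

/-- Iteration. -/
lemma full_coloring {N : ℕ} (a : Fin N → ι → ℝ) (ha : ∀ i j, |a i j| ≤ 1) :
    ∀ (m : ℕ) (A : Finset ι), #A = m → m ≤ N → ∀ g : ℝ, 0 ≤ g → g ^ 4 = m * N →
      ∃ x : ι → ℝ, (∀ j, x j = 1 ∨ x j = -1) ∧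
        ∀ i, |∑ j ∈ A, a i j * x j| ≤ 256 * g := by
  intro m
  induction m using Nat.strong_induction_on with
  | _ m ih =>
  intro A hA hmN g hg hg4
  by_cases hsmall : m < 10
  · refine ⟨fun _ => 1, fun _ => Or.inl rfl, fun i => ?_⟩
    have h1 : |∑ j ∈ A, a i j * 1| ≤ m := by
      refine (abs_sum_le_sum_abs _ _).trans ?_
      refine (sum_le_sum (g := fun _ => (1 : ℝ)) fun j _ => by simpa using ha i j).trans ?_
      simp [hA]
    rcases Nat.eq_zero_or_pos m with h0 | h0
    · rw [h0] at h1; push_cast at h1; linarith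
    · have h2 : (1 : ℝ) ≤ g := by
        by_contra! hlt
        have h3 : g ^ 4 < 1 := pow_lt_one₀ hg hlt (by norm_num)
        have h4 : (1 : ℝ) ≤ m * N := by
          exact_mod_cast Nat.mul_pos h0 (lt_of_lt_of_le h0 hmN)
        linarith
      have h5 : (m : ℝ) < 10 := by exact_mod_cast hsmall
      linarith
  push Not at hsmall
  have hm0 : (10 : ℝ) ≤ m := by exact_mod_cast hsmall
  have hmN' : (m : ℝ) ≤ N := by exact_mod_cast hmN
  have hgpos : 0 < g := by
    rcases hg.eq_or_lt with h | h
    · rw [← h] at hg4; nlinarith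
    · exact h
  obtain ⟨T, T', hT, hT', hcard, hd⟩ := partial_coloring A a ha (by omega)
    (g ^ 2 / m) (4 * g)
    (by
      rw [le_div_iff₀ (by linarith), one_mul]
      apply le_of_sq_le_sq _ (by positivity)
      nlinarith)
    (by rw [hA]; field_simp; linarith)
    (by positivity)
    (by rw [hA]; field_simp; ring)
  set B := symmDiff T T' with hB
  have hBA : B ⊆ A := by
    intro j hj
    rcases mem_symmDiff.1 hj with h | h
    · exact hT h.1
    · exact hT' h.1
  have hBd : ∀ i, |∑ j ∈ B, a i j * sg T j| ≤ 4 * g := by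
    intro i
    have h1 : ds A (a i) T - ds A (a i) T' = 2 * ∑ j ∈ B, a i j * sg T j := by
      rw [ds, ds, ← sum_sub_distrib, ← sum_sdiff hBA, mul_sum]
      rw [sum_eq_zero, zero_add]
      · refine sum_congr rfl fun j hj => ?_
        rcases mem_symmDiff.1 hj with h | h <;> simp [sg, h.1, h.2] <;> ring
      · intro j hj
        have h := (mem_sdiff.1 hj).2
        rw [hB, mem_symmDiff] at h
        by_cases h1 : j ∈ T <;> by_cases h2 : j ∈ T' <;> simp_all [sg]
    have h2 := hd i
    rw [h1, abs_mul, abs_two] at h2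
    linarith
  have hcs := card_sdiff_add_card_eq_card hBA
  set g' := Real.sqrt (Real.sqrt ((#(A \ B) : ℝ) * N)) with hg'
  have hg'4 : g' ^ 4 = (#(A \ B) : ℝ) * N := by
    rw [show g' ^ 4 = (g' ^ 2) ^ 2 by ring, hg', Real.sq_sqrt (by positivity),
      Real.sq_sqrt (by positivity)]
  obtain ⟨x, hx, hxd⟩ := ih #(A \ B) (by omega) (A \ B) rfl (by omega) g' (by positivity) hg'4
  have hgg : g' ≤ 63 / 64 * g := by
    apply le_of_pow_le_pow_left₀ (n := 4) (by norm_num) (by positivity)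
    have h1 : (#(A \ B) : ℝ) ≤ 15 / 16 * m := by
      have h2 : (m : ℝ) ≤ 16 * #B := by rw [← hA]; exact_mod_cast hcard.le
      have h3 : (#(A \ B) : ℝ) + #B = m := by rw [← hA]; exact_mod_cast hcs
      linarith
    rw [mul_pow, hg4, hg'4]
    have h4 : (#(A \ B) : ℝ) * N ≤ 15 / 16 * m * N :=
      mul_le_mul_of_nonneg_right h1 (by positivity)
    have h5 : (0 : ℝ) ≤ m * N := by positivity
    nlinarith
  refine ⟨fun j => if j ∈ B then sg T j else x j, fun j => ?_, fun i => ?_⟩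
  · dsimp only
    split_ifs
    · unfold sg; split_ifs <;> simp
    · exact hx j
  · rw [← sum_sdiff hBA]
    have e1 : ∑ j ∈ A \ B, a i j * (if j ∈ B then sg T j else x j) = ∑ j ∈ A \ B, a i j * x j :=
      sum_congr rfl fun j hj => by rw [if_neg (mem_sdiff.1 hj).2]
    have e2 : ∑ j ∈ B, a i j * (if j ∈ B then sg T j else x j) = ∑ j ∈ B, a i j * sg T j :=
      sum_congr rfl fun j hj => by rw [if_pos hj]
    rw [e1, e2]
    refine (abs_add_le _ _).trans ?_
    have := hxd i
    have := hBd i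
    linarith

end Spencer

/-- **Spencer's theorem, balanced case (Corollary 2).** There is a universal constant `C > 0`
such that any set system of `n` sets over `n` elements admits a coloring `x ∈ {-1,1}^n` with
discrepancy at most `C √n` on every set. -/
theorem stmt_1 :
    ∃ C : ℝ, 0 < C ∧
      ∀ (n : ℕ), 1 ≤ n → ∀ S : Fin n → Finset (Fin n),
        ∃ x : Fin n → ℝ,
          (∀ j, x j = 1 ∨ x j = -1) ∧
          ∀ i, |∑ j ∈ S i, x j| ≤ C * Real.sqrt n := by
  refine ⟨256, by norm_num, fun n _ S => ?_⟩
  obtain ⟨x, hx, hd⟩ := Spencer.full_coloring (fun i j => if j ∈ S i then (1 : ℝ) else 0)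
    (fun i j => by split_ifs <;> simp) n Finset.univ (by simp) le_rfl
    (Real.sqrt n) (Real.sqrt_nonneg _)
    (by
      rw [show Real.sqrt n ^ 4 = (Real.sqrt n ^ 2) ^ 2 by ring,
        Real.sq_sqrt (Nat.cast_nonneg n)]; ring)
  refine ⟨x, hx, fun i => ?_⟩
  have := hd i
  simpa using this
end

section
/- There exists a universal constant C > 0 such that for all integers m ≥ n ≥ 1 and every set system S_1, …, S_m ⊆ {1,…,n}, there exists a coloring x ∈ {-1,1}^n with |∑_{j ∈ S_i} x_j| ≤ C·√(n · log(2m/n)) for every i ∈ {1,…,m}. -/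
lemma sqrt_scale {c : ℝ} (hc : 0 ≤ c) (G : ℝ) : c * Real.sqrt G = Real.sqrt (c^2 * G) := by
  rw [Real.sqrt_mul (sq_nonneg c), Real.sqrt_sq hc]

/-- signs -/
def sgB (b : Bool) : ℝ := if b then 1 else -1

/-- product weights -/
noncomputable def qW (ε : ℝ) (s : ℤ) : ℝ :=
  if s = 0 then 1 - ε else ε * (1/2) ^ (s.natAbs + 1)

lemma qW_sum_Icc (ε : ℝ) (M : ℕ) :
    ∑ s ∈ Finset.Icc (-(M:ℤ)) M, qW ε s = 1 - ε * (1/2)^M := by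
  induction M with
  | zero => simp [qW]
  | succ M ih =>
    have h : Finset.Icc (-((M+1:ℕ):ℤ)) ((M+1:ℕ):ℤ)
        = insert (-((M+1:ℕ):ℤ)) (insert ((M+1:ℕ):ℤ) (Finset.Icc (-(M:ℤ)) M)) := by
      ext x
      simp only [Finset.mem_Icc, Finset.mem_insert]
      omega
    rw [h, Finset.sum_insert, Finset.sum_insert, ih]
    · have h1 : qW ε (-((M+1:ℕ):ℤ)) = ε * (1/2)^(M+2) := by
        unfold qW
        rw [if_neg (by omega), show (-((M+1:ℕ):ℤ)).natAbs = M + 1 by omega]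
      have h2 : qW ε (((M+1:ℕ):ℤ)) = ε * (1/2)^(M+2) := by
        unfold qW
        rw [if_neg (by omega), show (((M+1:ℕ):ℤ)).natAbs = M + 1 by omega]
      rw [h1, h2]
      ring
    · simp
    · simp only [Finset.mem_Icc, Finset.mem_insert]
      omega

lemma qW_pos {ε : ℝ} (h0 : 0 < ε) (h1 : ε < 1) (s : ℤ) : 0 < qW ε s := by
  unfold qW
  split_ifs
  · linarith
  · positivity

lemma qW_sum_le {ε : ℝ} (h0 : 0 < ε) (h1 : ε < 1) (T : Finset ℤ) :
    ∑ s ∈ T, qW ε s ≤ 1 := by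
  have hsub : T ⊆ Finset.Icc (-((T.sup Int.natAbs : ℕ):ℤ)) ((T.sup Int.natAbs : ℕ):ℤ) := by
    intro s hs
    have : s.natAbs ≤ T.sup Int.natAbs := Finset.le_sup (f := Int.natAbs) hs
    rw [Finset.mem_Icc]
    omega
  calc ∑ s ∈ T, qW ε s ≤ _ := Finset.sum_le_sum_of_subset_of_nonneg hsub
        (fun s _ _ => (qW_pos h0 h1 s).le)
    _ = _ := qW_sum_Icc ε _
    _ ≤ 1 := by
      have : 0 < ε * (1/2)^(T.sup Int.natAbs) := by positivity
      linarith

lemma mgf_exp {ι : Type} [Fintype ι] [DecidableEq ι] (a : ι → ℝ) (ha : ∀ j, |a j| ≤ 1) (θ : ℝ) :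
    ∑ x : ι → Bool, Real.exp (θ * ∑ j, a j * sgB (x j))
      ≤ 2 ^ (Fintype.card ι) * Real.exp (θ^2 * Fintype.card ι / 2) := by
  have h1 : ∀ x : ι → Bool, Real.exp (θ * ∑ j, a j * sgB (x j))
      = ∏ j, Real.exp (θ * (a j * sgB (x j))) := by
    intro x
    rw [Finset.mul_sum, Real.exp_sum]
  simp_rw [h1]
  have h2 := (Finset.prod_univ_sum (fun _ : ι => (Finset.univ : Finset Bool))
    (fun j b => Real.exp (θ * (a j * sgB b)))).symm
  rw [Fintype.piFinset_univ] at h2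
  rw [h2]
  calc _ ≤ ∏ j : ι, (2 * Real.exp (θ^2/2)) := by
        apply Finset.prod_le_prod
        · intro j _
          positivity
        · intro j _
          have hc := Real.cosh_le_exp_half_sq (θ * a j)
          rw [Real.cosh_eq] at hc
          have : Real.exp ((θ * a j)^2/2) ≤ Real.exp (θ^2/2) := by
            apply Real.exp_le_exp.mpr
            have h3 : (a j)^2 ≤ 1 := by
              rw [sq_le_one_iff_abs_le_one]; exact ha j
            have : (θ * a j)^2 = θ^2 * (a j)^2 := by ring
            nlinarith [sq_nonneg θ]
          simp only [Fintype.sum_bool, sgB]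
          simp only [if_true, mul_one, mul_neg, Bool.false_eq_true, if_false]
          linarith
    _ = _ := by
      rw [Finset.prod_const, mul_pow, ← Real.exp_nat_mul, Finset.card_univ]
      congr 2
      ring

lemma mgf_cosh {ι : Type} [Fintype ι] [DecidableEq ι] (a : ι → ℝ) (ha : ∀ j, |a j| ≤ 1) (θ : ℝ) :
    ∑ x : ι → Bool, Real.cosh (θ * ∑ j, a j * sgB (x j))
      ≤ 2 ^ (Fintype.card ι) * Real.exp (θ^2 * Fintype.card ι / 2) := by
  have h1 := mgf_exp a ha θ
  have h2 := mgf_exp a ha (-θ)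
  have h3 : ∑ x : ι → Bool, Real.cosh (θ * ∑ j, a j * sgB (x j))
    = (∑ x : ι → Bool, Real.exp (θ * ∑ j, a j * sgB (x j))
      + ∑ x : ι → Bool, Real.exp (-θ * ∑ j, a j * sgB (x j))) / 2 := by
    rw [← Finset.sum_add_distrib, Finset.sum_div]
    apply Finset.sum_congr rfl
    intro x _
    rw [Real.cosh_eq]
    ring_nf
  rw [neg_sq] at h2
  rw [h3]
  linarith

lemma hamming_sum {ι : Type} [Fintype ι] [DecidableEq ι] (x : ι → Bool) :
    ∑ y : ι → Bool, (1/4 : ℝ) ^ (hammingDist x y) = (5/4) ^ (Fintype.card ι) := by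
  have h1 : ∀ y : ι → Bool, (1/4 : ℝ) ^ (hammingDist x y)
      = ∏ j, (if x j ≠ y j then (1/4:ℝ) else 1) := by
    intro y
    rw [hammingDist, Finset.prod_ite]
    simp
  simp_rw [h1]
  have h2 := (Finset.prod_univ_sum (fun _ : ι => (Finset.univ : Finset Bool))
    (fun j b => (if x j ≠ b then (1/4:ℝ) else 1))).symm
  rw [Fintype.piFinset_univ] at h2
  rw [h2]
  have h3 : ∀ j : ι, ∑ b : Bool, (if x j ≠ b then (1/4:ℝ) else 1) = 5/4 := by
    intro j
    rw [Fintype.sum_bool]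
    cases x j <;> norm_num
  simp_rw [h3]
  rw [Finset.prod_const, Finset.card_univ]

/-- A big class contains two far points. -/
lemma far_points {ι : Type} [Fintype ι] [DecidableEq ι] (hk : 1 ≤ Fintype.card ι)
    (P : Finset (ι → Bool))
    (hP : 2 ^ (Fintype.card ι) * Real.exp (-(3/32 * Fintype.card ι)) ≤ (P.card : ℝ)) :
    ∃ x ∈ P, ∃ y ∈ P, Fintype.card ι < 4 * hammingDist x y := by
  set k := Fintype.card ι with hkdef
  have hPpos : (0:ℝ) < P.card := lt_of_lt_of_le (by positivity) hP
  have hne : P.Nonempty := by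
    rw [← Finset.card_pos]; exact_mod_cast hPpos
  obtain ⟨x, hx⟩ := hne
  refine ⟨x, hx, ?_⟩
  by_contra! hcon
  set t : ℝ := 1 / Real.sqrt 2 with ht
  have hs2 : Real.sqrt 2 ^ 2 = 2 := Real.sq_sqrt (by norm_num)
  have hs0 : 0 < Real.sqrt 2 := by positivity
  have ht0 : 0 < t := by positivity
  have ht2 : t ^ 2 = 1/2 := by rw [ht, div_pow, hs2]; norm_num
  have ht1 : t ≤ 1 := by nlinarith
  have ht7 : 0.7 < t := by nlinarith
  have h4 : ∀ d : ℕ, 4 * d ≤ k → t ^ k ≤ (1/4:ℝ)^d := by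
    intro d hd
    have : (1/4:ℝ)^d = t^(4*d) := by
      rw [pow_mul]; congr 1
      have : t^4 = (t^2)^2 := by ring
      rw [this, ht2]; norm_num
    rw [this]
    exact pow_le_pow_of_le_one ht0.le ht1 hd
  have h5 : (P.card : ℝ) * t^k ≤ (5/4)^k := by
    calc (P.card : ℝ) * t^k = ∑ y ∈ P, t^k := by simp
      _ ≤ ∑ y ∈ P, (1/4:ℝ)^(hammingDist x y) :=
          Finset.sum_le_sum (fun y hy => h4 _ (hcon y hy))
      _ ≤ ∑ y : ι → Bool, (1/4:ℝ)^(hammingDist x y) :=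
          Finset.sum_le_sum_of_subset_of_nonneg (Finset.subset_univ _)
            (fun _ _ _ => by positivity)
      _ = _ := hamming_sum x
  have h6 : Real.exp (-(3/32 * (k:ℝ))) = Real.exp (-(3/32)) ^ k := by
    rw [← Real.exp_nat_mul]; congr 1; ring
  have h7 : (2 * Real.exp (-(3/32)) * t)^k ≤ (5/4:ℝ)^k := by
    rw [mul_pow, mul_pow]
    rw [h6] at hP
    exact le_trans (mul_le_mul_of_nonneg_right hP (by positivity)) h5
  have h8 : (5/4:ℝ) < 2 * Real.exp (-(3/32)) * t := by
    have := Real.add_one_le_exp (-(3/32) : ℝ)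
    nlinarith
  have := pow_lt_pow_left₀ h8 (by norm_num) (show k ≠ 0 by omega)
  linarith

/-- Weighted pigeonhole via the Gibbs inequality. -/
lemma gibbs_pigeon {ι : Type} [Fintype ι] [DecidableEq ι] {m : ℕ} (b : (ι → Bool) → Fin m → ℤ)
    {ε : ℝ} (h0 : 0 < ε) (h1 : ε < 1) (D : ℝ)
    (hD : ∑ x : ι → Bool, ∑ i, -Real.log (qW ε (b x i)) ≤ 2 ^ (Fintype.card ι) * D) :
    ∃ v : Fin m → ℤ, 2 ^ (Fintype.card ι) * Real.exp (-D)
      ≤ ((Finset.univ.filter (fun x => b x = v)).card : ℝ) := by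
  by_contra! hcon
  set V := Finset.univ.image b with hV
  set T : Finset ℤ := Finset.univ.biUnion (fun i : Fin m => V.image (fun v => v i)) with hT
  have hVT : V ⊆ Fintype.piFinset (fun _ : Fin m => T) := by
    intro v hv
    rw [Fintype.mem_piFinset]
    intro i
    rw [hT, Finset.mem_biUnion]
    exact ⟨i, Finset.mem_univ _, Finset.mem_image_of_mem _ hv⟩
  have hpos : ∀ v : Fin m → ℤ, 0 < ∏ i, qW ε (v i) :=
    fun v => Finset.prod_pos (fun i _ => qW_pos h0 h1 _)
  have hsum : ∑ v ∈ V, ∏ i, qW ε (v i) ≤ 1 := by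
    calc _ ≤ ∑ v ∈ Fintype.piFinset (fun _ : Fin m => T), ∏ i, qW ε (v i) :=
          Finset.sum_le_sum_of_subset_of_nonneg hVT (fun v _ _ => (hpos v).le)
      _ = ∏ i : Fin m, ∑ s ∈ T, qW ε s := by
          rw [Finset.prod_univ_sum]
      _ ≤ 1 := Finset.prod_le_one
          (fun i _ => Finset.sum_nonneg (fun s _ => (qW_pos h0 h1 s).le))
          (fun i _ => qW_sum_le h0 h1 T)
  have hcardN : (Finset.univ : Finset (ι → Bool)).card = 2 ^ Fintype.card ι := by
    rw [Finset.card_univ]; simp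
  -- lower bound
  have hlow : 2 ^ (Fintype.card ι) * Real.exp (-D) ≤ ∑ x : ι → Bool, ∏ i, qW ε (b x i) := by
    have hx : ∀ x : ι → Bool, Real.exp (-D) * (1 + D - ∑ i, -Real.log (qW ε (b x i)))
        ≤ ∏ i, qW ε (b x i) := by
      intro x
      have e1 : ∏ i, qW ε (b x i) = Real.exp (-∑ i, -Real.log (qW ε (b x i))) := by
        rw [← Finset.sum_neg_distrib, Real.exp_sum]
        apply Finset.prod_congr rfl
        intro i _
        rw [neg_neg, Real.exp_log (qW_pos h0 h1 _)]
      rw [e1]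
      set c := ∑ i, -Real.log (qW ε (b x i))
      have e2 : Real.exp (-c) = Real.exp (-D) * Real.exp (D - c) := by
        rw [← Real.exp_add]; congr 1; ring
      rw [e2]
      apply mul_le_mul_of_nonneg_left _ (Real.exp_pos _).le
      have := Real.add_one_le_exp (D - c)
      linarith
    refine le_trans ?_ (Finset.sum_le_sum (fun x _ => hx x))
    rw [← Finset.mul_sum, Finset.sum_sub_distrib, Finset.sum_const, hcardN, nsmul_eq_mul, mul_comm]
    apply mul_le_mul_of_nonneg_left _ (Real.exp_pos _).le
    push_cast
    linarith
  have hup : ∑ x : ι → Bool, ∏ i, qW ε (b x i)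
      = ∑ v ∈ V, ((Finset.univ.filter (fun x => b x = v)).card : ℝ) * ∏ i, qW ε (v i) := by
    rw [← Finset.sum_fiberwise_of_maps_to (s := Finset.univ) (t := V) (g := b)
      (fun x _ => Finset.mem_image_of_mem _ (Finset.mem_univ _))]
    apply Finset.sum_congr rfl
    intro v _
    rw [← nsmul_eq_mul, ← Finset.sum_const]
    apply Finset.sum_congr rfl
    intro x hx
    rw [(Finset.mem_filter.mp hx).2]
  have hVne : V.Nonempty := Finset.univ_nonempty.image b
  have hlt : ∑ v ∈ V, ((Finset.univ.filter (fun x => b x = v)).card : ℝ) * ∏ i, qW ε (v i)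
      < ∑ v ∈ V, (2 ^ (Fintype.card ι) * Real.exp (-D)) * ∏ i, qW ε (v i) :=
    Finset.sum_lt_sum_of_nonempty hVne
      (fun v _ => mul_lt_mul_of_pos_right (hcon v) (hpos v))
  rw [← Finset.mul_sum] at hlt
  have : (2 ^ (Fintype.card ι) * Real.exp (-D)) * ∑ v ∈ V, ∏ i, qW ε (v i)
      ≤ (2 ^ (Fintype.card ι) * Real.exp (-D)) * 1 :=
    mul_le_mul_of_nonneg_left hsum (by positivity)
  linarith

lemma numeric_bound {R : ℝ} (hR : 2 ≤ R) {s : ℕ} (hs : 1 ≤ s) :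
    Real.log (16 * R) + (s + 1) * Real.log 2 ≤ (R ^ (12 * s)) / (32 * R) := by
  have hR1 : 1 ≤ R := by linarith
  have a1 : Real.log (16 * R) ≤ 16 * R := by
    have := Real.log_le_sub_one_of_pos (show 0 < 16 * R by linarith)
    linarith
  have a2 : 16 * R ≤ R ^ 5 := by
    have : (2:ℝ)^4 ≤ R^4 := pow_le_pow_left₀ (by norm_num) hR 4
    nlinarith
  have a3 : R^5 ≤ R^(5*s) := pow_le_pow_right₀ hR1 (by omega)
  have a4 : ((s:ℝ) + 1) * Real.log 2 ≤ R^(5*s) := by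
    have h1 : ((s:ℝ)+1) ≤ 2^s := by
      have := Nat.lt_two_pow_self (n := s)
      exact_mod_cast this
    have h2 : (2:ℝ)^s ≤ R^s := pow_le_pow_left₀ (by norm_num) hR s
    have h3 : R^s ≤ R^(5*s) := pow_le_pow_right₀ hR1 (by omega)
    have h4 : Real.log 2 ≤ 1 := by linarith [Real.log_two_lt_d9]
    have h5 : ((s:ℝ) + 1) * Real.log 2 ≤ ((s:ℝ)+1) * 1 :=
      mul_le_mul_of_nonneg_left h4 (by positivity)
    linarith
  have a5 : 32 * R ≤ R^6 := by
    have : (2:ℝ)^5 ≤ R^5 := pow_le_pow_left₀ (by norm_num) hR 5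
    nlinarith
  rw [le_div_iff₀ (by linarith)]
  calc _ ≤ (2 * R^(5*s)) * R^6 := by
        apply mul_le_mul _ a5 (by linarith) (by positivity)
        linarith
    _ ≤ (R * R^(5*s)) * R^6 := by gcongr
    _ = R^(5*s+7) := by ring
    _ ≤ R^(12*s) := pow_le_pow_right₀ hR1 (by omega)

/-- pointwise cost bound -/
lemma cost_bound {R lam k X : ℝ} (hR : 2 ≤ R) (hk : 0 < k) (hlam : 0 < lam)
    (hl : lam ^ 2 = 24 * k * Real.log R) :
    -Real.log (qW (1 / (16 * R)) (round (X / (2 * lam)))) ≤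
      2 * (1 / (16 * R)) + (1 / (16 * R)) * Real.exp (-(12 * Real.log R))
        * Real.cosh (lam / k * X) := by
  have hR0 : 0 < R := by linarith
  set ε := 1 / (16 * R) with hε
  have hε0 : 0 < ε := by positivity
  have hε1 : ε ≤ 1/32 := by
    rw [hε]; apply one_div_le_one_div_of_le <;> linarith
  set b := round (X / (2*lam)) with hb
  have hcosh := Real.cosh_pos (lam / k * X)
  have hlogR : 0 < Real.log R := Real.log_pos (by linarith)
  by_cases hb0 : b = 0
  · rw [hb0]
    have : -Real.log (qW ε 0) ≤ 2 * ε := by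
      have h1 : qW ε 0 = 1 - ε := by simp [qW]
      rw [h1, ← Real.log_inv]
      have h2 := Real.log_le_sub_one_of_pos (show 0 < (1-ε)⁻¹ by
        apply inv_pos.mpr; linarith)
      have h3 : (1-ε)⁻¹ ≤ 1 + 2*ε := by
        rw [inv_le_iff_one_le_mul₀ (by linarith)]
        nlinarith
      linarith
    have : 0 ≤ ε * Real.exp (-(12 * Real.log R)) * Real.cosh (lam / k * X) := by positivity
    linarith
  · set s := b.natAbs with hs
    have hs1 : 1 ≤ s := by omega
    have hq : -Real.log (qW ε b) = Real.log (16*R) + (s+1) * Real.log 2 := by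
      unfold qW
      rw [if_neg hb0, Real.log_mul hε0.ne' (by positivity), Real.log_pow, hε]
      simp only [one_div, Real.log_inv]
      push_cast
      ring
    rw [hq]
    refine le_trans (numeric_bound hR hs1) ?_
    -- lower bound on |X|
    have hsr : (s:ℝ) = |(b:ℝ)| := by
      rw [hs, Nat.cast_natAbs]; push_cast; rfl
    have hs1r : (1:ℝ) ≤ s := by exact_mod_cast hs1
    have hX : lam * s ≤ |X| := by
      have h1 := abs_sub_round (X / (2*lam))
      rw [← hb] at h1
      have h2 : |(b:ℝ)| ≤ |X/(2*lam)| + 1/2 := by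
        have := abs_sub_abs_le_abs_sub (b:ℝ) (X/(2*lam))
        rw [abs_sub_comm] at this
        linarith
      rw [abs_div, abs_of_pos (show 0 < 2*lam by linarith), ← hsr] at h2
      have h3 : |X| = |X|/(2*lam) * (2*lam) := by field_simp
      rw [h3]
      nlinarith
    have hc : Real.exp (24 * Real.log R * s) / 2 ≤ Real.cosh (lam/k * X) := by
      rw [← Real.cosh_abs, Real.cosh_eq]
      have : 24 * Real.log R * s ≤ |lam / k * X| := by
        rw [abs_mul, abs_of_pos (show 0 < lam/k by positivity)]
        calc 24 * Real.log R * s = lam^2/k * s := by rw [hl]; field_simp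
          _ = lam/k * (lam * s) := by ring
          _ ≤ _ := mul_le_mul_of_nonneg_left hX (by positivity)
      have h1 := Real.exp_le_exp.mpr this
      have h2 := Real.exp_pos (-|lam/k*X|)
      linarith
    have hpow : R^(12*s) = Real.exp (12 * Real.log R * s) := by
      rw [← Real.exp_log (show 0 < R^(12*s) by positivity), Real.log_pow]
      congr 1
      push_cast
      ring
    have hmain : R^(12*s) ≤ Real.exp (-(12 * Real.log R)) * Real.exp (24 * Real.log R * s) := by
      rw [hpow, ← Real.exp_add]
      apply Real.exp_le_exp.mpr
      nlinarith
    calc R^(12*s)/(32*R) = ε * (R^(12*s) / 2) := by rw [hε]; field_simp; norm_num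
      _ ≤ ε * ((Real.exp (-(12 * Real.log R)) * Real.exp (24 * Real.log R * s))/2) := by gcongr
      _ = ε * Real.exp (-(12 * Real.log R)) * (Real.exp (24 * Real.log R * s)/2) := by ring
      _ ≤ ε * Real.exp (-(12 * Real.log R)) * Real.cosh (lam/k * X) := by gcongr
      _ ≤ _ := by linarith

lemma partial_coloring {ι : Type} [Fintype ι] [DecidableEq ι] {m : ℕ}
    (hk : 1 ≤ Fintype.card ι) (hkm : Fintype.card ι ≤ m) (a : Fin m → ι → ℝ)
    (ha : ∀ i j, |a i j| ≤ 1) :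
    ∃ z : ι → ℝ, (∀ j, z j = 0 ∨ z j = 1 ∨ z j = -1) ∧
      Fintype.card ι < 4 * (Finset.univ.filter (fun j => z j ≠ 0)).card ∧
      ∀ i, |∑ j, a i j * z j| ≤
        Real.sqrt (24 * Fintype.card ι * Real.log (2 * m / Fintype.card ι)) := by
  set k := Fintype.card ι with hkdef
  have hk0 : (0:ℝ) < k := by exact_mod_cast hk
  have hkmr : (k:ℝ) ≤ m := by exact_mod_cast hkm
  set R : ℝ := 2 * m / k with hRdef
  have hR : 2 ≤ R := by rw [hRdef, le_div_iff₀ hk0]; linarith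
  have hlogR : 0 < Real.log R := Real.log_pos (by linarith)
  set lam := Real.sqrt (24 * k * Real.log R) with hlamdef
  have hl : lam^2 = 24 * k * Real.log R := Real.sq_sqrt (by positivity)
  have hlam : 0 < lam := Real.sqrt_pos.mpr (by positivity)
  set ε := 1 / (16 * R) with hε
  have hε0 : 0 < ε := by positivity
  have hε1 : ε < 1 := by
    rw [hε, div_lt_one] <;> linarith
  set b : (ι → Bool) → Fin m → ℤ :=
    fun x i => round ((∑ j, a i j * sgB (x j)) / (2*lam)) with hb
  have hD : ∑ x : ι → Bool, ∑ i, -Real.log (qW ε (b x i)) ≤ 2 ^ k * (3/32 * k) := by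
    rw [Finset.sum_comm]
    have hi : ∀ i : Fin m, ∑ x : ι → Bool, -Real.log (qW ε (b x i)) ≤ 2^k * (3 * ε) := by
      intro i
      refine le_trans (Finset.sum_le_sum (fun x _ => cost_bound (k := k) hR hk0 hlam hl)) ?_
      rw [Finset.sum_add_distrib, Finset.sum_const, Finset.card_univ, ← Finset.mul_sum]
      have h1 := mgf_cosh (a i) (ha i) (lam / k)
      have h2 : (lam/k)^2 * (Fintype.card ι) / 2 = 12 * Real.log R := by
        rw [← hkdef, div_pow, hl]; field_simp; norm_num
      rw [h2] at h1
      have h3 : ε * Real.exp (-(12 * Real.log R)) *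
          ∑ x : ι → Bool, Real.cosh (lam / k * ∑ j, a i j * sgB (x j)) ≤
          ε * Real.exp (-(12 * Real.log R)) * (2^k * Real.exp (12 * Real.log R)) :=
        mul_le_mul_of_nonneg_left h1 (by positivity)
      have h4 : ε * Real.exp (-(12 * Real.log R)) * (2^k * Real.exp (12 * Real.log R))
          = 2^k * ε := by
        have : Real.exp (-(12 * Real.log R)) * Real.exp (12 * Real.log R) = 1 := by
          rw [← Real.exp_add]; simp
        linear_combination (ε * 2^k) * this
      have h5 : (Fintype.card (ι → Bool)) • (2 * ε) = 2^k * (2*ε) := by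
        simp [hkdef]
      rw [← hε, h5]
      linarith
    refine le_trans (Finset.sum_le_sum (fun i _ => hi i)) ?_
    rw [Finset.sum_const, Finset.card_univ, Fintype.card_fin, nsmul_eq_mul]
    apply le_of_eq
    have hm0 : (0:ℝ) < m := by linarith
    rw [hε, hRdef]
    field_simp
    norm_num
  obtain ⟨v, hv⟩ := gibbs_pigeon b hε0 hε1 _ hD
  obtain ⟨x, hx, y, hy, hxy⟩ := far_points hk _ hv
  have hx := (Finset.mem_filter.mp hx).2
  have hy := (Finset.mem_filter.mp hy).2
  refine ⟨fun j => (sgB (x j) - sgB (y j))/2, ?_, ?_, ?_⟩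
  · intro j
    beta_reduce
    generalize x j = p
    generalize y j = q
    cases p <;> cases q <;> norm_num [sgB]
  · convert hxy using 2
    unfold hammingDist
    congr 1
    ext j
    simp only [Finset.mem_filter, Finset.mem_univ, true_and]
    generalize x j = p
    generalize y j = q
    cases p <;> cases q <;> norm_num [sgB]
  · intro i
    have e1 : b x i = b y i := by rw [hx, hy]
    set X := ∑ j, a i j * sgB (x j) with hX
    set Y := ∑ j, a i j * sgB (y j) with hY
    have e2 : ∑ j, a i j * ((sgB (x j) - sgB (y j))/2) = (X - Y)/2 := by
      rw [hX, hY, ← Finset.sum_sub_distrib, Finset.sum_div]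
      apply Finset.sum_congr rfl
      intro j _
      ring
    rw [e2]
    have r1 := abs_sub_round (X/(2*lam))
    have r2 := abs_sub_round (Y/(2*lam))
    have e3 : round (X/(2*lam)) = round (Y/(2*lam)) := e1
    rw [e3] at r1
    rw [abs_le] at r1 r2 ⊢
    have e4 : (X - Y)/2 = (X/(2*lam) - Y/(2*lam)) * lam := by field_simp
    rw [e4]
    constructor <;> nlinarith

/-- `g` potential -/
lemma potential_step {m k k' : ℝ} (hk : 0 < k) (hk' : 0 ≤ k') (hkm : k ≤ m)
    (h : k' ≤ 3/4 * k) :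
    k' * (2 + Real.log (m / k')) ≤ 7/8 * (k * (2 + Real.log (m/k))) := by
  have hL : 0 ≤ Real.log (m/k) := Real.log_nonneg (by rw [le_div_iff₀ hk]; linarith)
  have hm : 0 < m := by linarith
  rcases hk'.eq_or_lt with h0 | h0
  · rw [← h0]; simp; positivity
  · have e : Real.log (m/k') = Real.log (m/k) + Real.log (k/k') := by
      rw [← Real.log_mul (by positivity) (by positivity)]
      congr 1
      field_simp
    have h1 := Real.log_le_sub_one_of_pos (show 0 < k/k' by positivity)
    have h2 : k' * Real.log (k/k') ≤ k - k' := by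
      calc k' * Real.log (k/k') ≤ k' * (k/k' - 1) := mul_le_mul_of_nonneg_left h1 hk'
        _ = k - k' := by field_simp
    rw [e]
    nlinarith [mul_le_mul_of_nonneg_right h hL]

lemma full_coloring {m : ℕ} (k : ℕ) : ∀ (ι : Type) [Fintype ι] [DecidableEq ι],
    Fintype.card ι = k → k ≤ m → ∀ (a : Fin m → ι → ℝ), (∀ i j, |a i j| ≤ 1) →
    ∃ x : ι → ℝ, (∀ j, x j = 1 ∨ x j = -1) ∧
      ∀ i, |∑ j, a i j * x j| ≤ 100 * Real.sqrt (k * (2 + Real.log (m / k))) := by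
  induction k using Nat.strong_induction_on with
  | _ k ih =>
  intro ι _ _ hcard hkm a ha
  rcases Nat.eq_zero_or_pos k with h0 | hkpos
  · have : IsEmpty ι := Fintype.card_eq_zero_iff.mp (by omega)
    refine ⟨fun _ => 1, fun _ => Or.inl rfl, fun i => ?_⟩
    rw [Finset.univ_eq_empty, Finset.sum_empty, abs_zero]
    positivity
  · obtain ⟨z, hz1, hz2, hz3⟩ := partial_coloring (ι := ι) (by omega) (by omega) a ha
    rw [hcard] at hz2 hz3
    classical
    have hc := Fintype.card_subtype_compl (fun j => z j ≠ 0)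
    have hc' : Fintype.card {j // z j = 0} + (Finset.univ.filter (fun j => z j ≠ 0)).card = k := by
      rw [Fintype.card_subtype, ← hcard]
      exact Finset.card_filter_add_card_filter_not (s := Finset.univ) (fun j => z j = 0)
    set k' := Fintype.card {j // z j = 0} with hk'
    obtain ⟨x', hx1, hx2⟩ := ih k' (by omega) {j // z j = 0} rfl (by omega)
      (fun i j => a i j.1) (fun i j => ha i j.1)
    refine ⟨fun j => if h : z j = 0 then x' ⟨j, h⟩ else z j, ?_, ?_⟩
    · intro j
      by_cases h : z j = 0
      · simp only [h, dif_pos]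
        exact hx1 _
      · simp only [h, dif_neg, not_false_eq_true]
        rcases hz1 j with h' | h'
        · exact absurd h' h
        · exact h'
    · intro i
      have e : ∑ j, a i j * (if h : z j = 0 then x' ⟨j, h⟩ else z j)
          = ∑ j, a i j * z j + ∑ j : {j // z j = 0}, a i j.1 * x' j := by
        rw [← Fintype.sum_subtype_add_sum_subtype (fun j => z j = 0)
          (fun j => a i j * (if h : z j = 0 then x' ⟨j, h⟩ else z j)),
          ← Fintype.sum_subtype_add_sum_subtype (fun j => z j = 0) (fun j => a i j * z j)]
        have e1 : ∑ j : {j // z j = 0}, a i j.1 * z j.1 = 0 :=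
          Finset.sum_eq_zero (fun j _ => by rw [j.2, mul_zero])
        have e2 : ∑ j : {j // z j = 0}, a i j.1 * (if h : z j.1 = 0 then x' ⟨j.1, h⟩ else z j.1)
            = ∑ j : {j // z j = 0}, a i j.1 * x' j :=
          Finset.sum_congr rfl (fun j _ => by rw [dif_pos j.2])
        have e3 : ∑ j : {j // ¬ z j = 0}, a i j.1 * (if h : z j.1 = 0 then x' ⟨j.1, h⟩ else z j.1)
            = ∑ j : {j // ¬ z j = 0}, a i j.1 * z j.1 :=
          Finset.sum_congr rfl (fun j _ => by rw [dif_neg j.2])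
        rw [e1, e2, e3]
        ring
      rw [e]
      refine le_trans (abs_add_le _ _) ?_
      have b1 := hz3 i
      have b2 := hx2 i
      have hk0 : (0:ℝ) < k := by exact_mod_cast hkpos
      have hkmr : (k:ℝ) ≤ m := by exact_mod_cast hkm
      have hm0 : (0:ℝ) < m := by linarith
      set G := (k:ℝ) * (2 + Real.log (m/k)) with hG
      have hL : 0 ≤ Real.log ((m:ℝ)/k) := Real.log_nonneg (by rw [le_div_iff₀ hk0]; linarith)
      have hG0 : 0 ≤ G := by positivity
      have c1 : Real.sqrt (24 * k * Real.log (2 * m / k)) ≤ 5 * Real.sqrt G := by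
        have : (5:ℝ) * Real.sqrt G = Real.sqrt (25 * G) := by
          rw [sqrt_scale (by norm_num)]
          norm_num
        rw [this]
        apply Real.sqrt_le_sqrt
        have : Real.log (2 * m / k) = Real.log 2 + Real.log ((m:ℝ)/k) := by
          rw [mul_div_assoc, Real.log_mul (by norm_num) (by positivity)]
        rw [this, hG]
        have := Real.log_two_lt_d9
        nlinarith [mul_nonneg hk0.le hL]
      have c2 : Real.sqrt (k' * (2 + Real.log (m/k'))) ≤ 19/20 * Real.sqrt G := by
        have : (19/20:ℝ) * Real.sqrt G = Real.sqrt ((19/20)^2 * G) :=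
          sqrt_scale (by norm_num) G
        rw [this]
        apply Real.sqrt_le_sqrt
        have hkk : (k':ℝ) ≤ 3/4 * k := by
          have : 4 * k' ≤ 3 * k := by omega
          have : (4:ℝ) * k' ≤ 3 * k := by exact_mod_cast this
          linarith
        have := potential_step hk0 (Nat.cast_nonneg k') hkmr hkk
        rw [← hG] at this
        nlinarith
      linarith

/-- **Spencer's theorem for `m ≥ n` sets (Lemma 8).** There is a universal constant `C > 0`
such that any set system of `m ≥ n ≥ 1` sets over `n` elements admits a coloring
`x ∈ {-1,1}^n` with discrepancy at most `C √(n log(2m/n))` on every set. -/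
theorem stmt_2 :
    ∃ C : ℝ, 0 < C ∧
      ∀ (m n : ℕ), 1 ≤ n → n ≤ m → ∀ S : Fin m → Finset (Fin n),
        ∃ x : Fin n → ℝ,
          (∀ j, x j = 1 ∨ x j = -1) ∧
          ∀ i, |∑ j ∈ S i, x j| ≤ C * Real.sqrt ((n : ℝ) * Real.log (2 * (m : ℝ) / (n : ℝ))) := by
  refine ⟨200, by norm_num, ?_⟩
  intro m n hn hnm S
  obtain ⟨x, hx1, hx2⟩ := full_coloring (m := m) n (Fin n) (Fintype.card_fin n) hnm
    (fun i j => if j ∈ S i then 1 else 0) (by intro i j; split_ifs <;> simp)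
  refine ⟨x, hx1, fun i => ?_⟩
  have h := hx2 i
  have e : ∑ j, (if j ∈ S i then (1:ℝ) else 0) * x j = ∑ j ∈ S i, x j := by
    simp
  rw [e] at h
  refine le_trans h ?_
  have hn0 : (0:ℝ) < n := by exact_mod_cast hn
  have hnmr : (n:ℝ) ≤ m := by exact_mod_cast hnm
  have hm0 : (0:ℝ) < m := by linarith
  have hL : 0 ≤ Real.log ((m:ℝ)/n) := Real.log_nonneg (by rw [le_div_iff₀ hn0]; linarith)
  have e2 : Real.log (2 * (m:ℝ) / n) = Real.log 2 + Real.log ((m:ℝ)/n) := by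
    rw [mul_div_assoc, Real.log_mul (by norm_num) (by positivity)]
  have key : Real.sqrt ((n:ℝ) * (2 + Real.log (m / n)))
      ≤ 2 * Real.sqrt ((n:ℝ) * Real.log (2 * m / n)) := by
    rw [sqrt_scale (by norm_num)]
    apply Real.sqrt_le_sqrt
    rw [e2]
    have := Real.log_two_gt_d9
    nlinarith [mul_nonneg hn0.le hL]
  linarith
end

section
/- There exists a universal constant C > 0 such that the following holds. Let q divide m, let qm ≥ n, and let A_1, …, A_n ∈ ℝ^{m×m} be symmetric q-block diagonal matrices with ‖A_i‖_op ≤ 1 for all i. Then there exists a coloring x ∈ {-1,1}^n with ‖∑_{i=1}^n x_i A_i‖_op ≤ C·√(n · log(2qm/n)). -/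
/-- The `ℓ²→ ℓ²` operator norm of a real square matrix, i.e. its largest singular value. -/
noncomputable def matrixOpNorm {m : ℕ} (A : Matrix (Fin m) (Fin m) ℝ) : ℝ :=
  ‖Matrix.toEuclideanCLM (𝕜 := ℝ) (n := Fin m) A‖

/-- `A` is `q`-block diagonal: `A = diag(B_1, …, B_{m/q})` with `q × q` blocks, i.e. all
entries whose row and column indices lie in different consecutive blocks of size `q` vanish. -/
def IsBlockDiagonal {m : ℕ} (q : ℕ) (A : Matrix (Fin m) (Fin m) ℝ) : Prop :=
  ∀ a b : Fin m, (a : ℕ) / q ≠ (b : ℕ) / q → A a b = 0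

open Matrix Finset Filter Topology


/-- Squared operator norm bound for a real matrix. -/
def Bd {Q : Type*} [Fintype Q] (M : Matrix Q Q ℝ) (B : ℝ) : Prop :=
  ∀ v : Q → ℝ, (M *ᵥ v) ⬝ᵥ (M *ᵥ v) ≤ B * (v ⬝ᵥ v)

lemma good_dir {F α : Type*} [Fintype F] [Fintype α] (V : Submodule ℝ (EuclideanSpace ℝ F))
    (hV : 0 < Module.finrank ℝ V) (l : α → EuclideanSpace ℝ F) :
    ∃ y ∈ V, 0 < ‖y‖ ∧ (Module.finrank ℝ V : ℝ) * ∑ a, (inner ℝ y (l a)) ^ 2 ≤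
      (∑ a, ‖l a‖ ^ 2) * ‖y‖ ^ 2 := by
  classical
  set d := Module.finrank ℝ V
  let b := stdOrthonormalBasis ℝ V
  have hb : Orthonormal ℝ (fun i => (b i : EuclideanSpace ℝ F)) := by
    exact b.orthonormal.comp_linearIsometry V.subtypeₗᵢ
  have h1 : ∑ i, ∑ a, (inner ℝ (b i : EuclideanSpace ℝ F) (l a)) ^ 2 ≤ ∑ i : Fin d, (∑ a, ‖l a‖ ^ 2) / d := by
    rw [Finset.sum_comm]
    have : ∑ i : Fin d, (∑ a, ‖l a‖ ^ 2) / d = ∑ a, ‖l a‖ ^ 2 := by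
      simp
      field_simp
    rw [this]
    refine Finset.sum_le_sum fun a _ => ?_
    have := hb.sum_inner_products_le (s := Finset.univ) (x := l a)
    simpa using this
  have : Nonempty (Fin d) := ⟨⟨0, hV⟩⟩
  obtain ⟨i, -, hi⟩ := Finset.exists_le_of_sum_le Finset.univ_nonempty h1
  refine ⟨b i, (b i).2, ?_, ?_⟩
  · have := hb.1 i
    simp only at this
    rw [this]; norm_num
  · have := hb.1 i
    simp only at this
    rw [this]
    have hd : (0:ℝ) < d := by exact_mod_cast hV
    rw [le_div_iff₀ hd] at hi
    linarith

lemma exists_spec {Q : Type*} [Fintype Q] [DecidableEq Q] (S : Matrix Q Q ℝ) (hS : S.IsSymm) :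
    ∃ (U : Matrix Q Q ℝ) (s : Q → ℝ), Uᵀ * U = 1 ∧ U * Uᵀ = 1 ∧ Uᵀ * S * U = diagonal s := by
  have hH : S.IsHermitian := by
    rw [Matrix.IsHermitian, conjTranspose_eq_transpose_of_trivial]; exact hS
  let U : Matrix Q Q ℝ := hH.eigenvectorUnitary
  have h1 : Uᵀ * U = 1 := by
    have := (Matrix.mem_unitaryGroup_iff' (A := U)).1 hH.eigenvectorUnitary.2
    simpa [star_eq_conjTranspose, conjTranspose_eq_transpose_of_trivial] using this
  have h2 : U * Uᵀ = 1 := mul_eq_one_comm.1 h1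
  refine ⟨U, hH.eigenvalues, h1, h2, ?_⟩
  have h3 : S = U * diagonal hH.eigenvalues * Uᵀ := by
    have := hH.spectral_theorem
    rw [Unitary.conjStarAlgAut_apply] at this
    simpa [star_eq_conjTranspose, conjTranspose_eq_transpose_of_trivial] using this
  calc Uᵀ * S * U = Uᵀ * (U * diagonal hH.eigenvalues * Uᵀ) * U := by rw [← h3]
    _ = (Uᵀ * U) * diagonal hH.eigenvalues * (Uᵀ * U) := by simp only [mul_assoc]
    _ = _ := by rw [h1]; simp

lemma bd_conj {Q : Type*} [Fintype Q] [DecidableEq Q] {M U : Matrix Q Q ℝ} {B : ℝ}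
    (h1 : U * Uᵀ = 1) (h2 : Uᵀ * U = 1) (h : Bd M B) : Bd (Uᵀ * M * U) B := by
  intro v
  have key : ∀ w : Q → ℝ, (Uᵀ *ᵥ w) ⬝ᵥ (Uᵀ *ᵥ w) = w ⬝ᵥ w := by
    intro w
    rw [dotProduct_mulVec, vecMul_transpose, mulVec_mulVec, h1, one_mulVec]
  have key2 : ∀ w : Q → ℝ, (U *ᵥ w) ⬝ᵥ (U *ᵥ w) = w ⬝ᵥ w := by
    intro w
    rw [dotProduct_mulVec, ← mulVec_transpose, mulVec_mulVec, h2, one_mulVec]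
  have := h (U *ᵥ v)
  rw [key2] at this
  rw [← mulVec_mulVec, ← mulVec_mulVec, key]
  exact this

lemma bd_conj_iff {Q : Type*} [Fintype Q] [DecidableEq Q] {M U : Matrix Q Q ℝ} {B : ℝ}
    (h1 : U * Uᵀ = 1) (h2 : Uᵀ * U = 1) : Bd (Uᵀ * M * U) B ↔ Bd M B := by
  refine ⟨fun h => ?_, bd_conj h1 h2⟩
  have := bd_conj (U := Uᵀ) (by simpa using h2) (by simpa using h1) h
  have e : Uᵀᵀ * (Uᵀ * M * U) * Uᵀ = (U * Uᵀ) * M * (U * Uᵀ) := by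
    simp only [mul_assoc, transpose_transpose]
  rw [e, h1] at this
  simpa using this

lemma trace_conj_pow {Q : Type*} [Fintype Q] [DecidableEq Q] {M U : Matrix Q Q ℝ}
    (h1 : U * Uᵀ = 1) (h2 : Uᵀ * U = 1) (k : ℕ) : ((Uᵀ * M * U) ^ k).trace = (M ^ k).trace := by
  have : (Uᵀ * M * U) ^ k = Uᵀ * M ^ k * U := by
    induction k with
    | zero => simp [h2]
    | succ k ih =>
      rw [pow_succ, ih, pow_succ]
      calc Uᵀ * M ^ k * U * (Uᵀ * M * U) = Uᵀ * M ^ k * (U * Uᵀ) * (M * U) := by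
            simp only [mul_assoc]
        _ = _ := by rw [h1]; simp only [mul_assoc, mul_one]
  rw [this, trace_mul_comm, ← mul_assoc, h1, one_mul]

lemma bd_row {Q : Type*} [Fintype Q] [DecidableEq Q] {M : Matrix Q Q ℝ} (hM : M.IsSymm)
    (h : Bd M 1) (a : Q) : ∑ b, M a b ^ 2 ≤ 1 := by
  have := h (Pi.single a 1)
  simp [dotProduct, Matrix.mulVec_single, Pi.single_apply] at this
  calc ∑ b, M a b ^ 2 = ∑ b, M b a * M b a := by
        refine Finset.sum_congr rfl fun b _ => ?_
        rw [hM.apply a b]; ring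
    _ ≤ 1 := this

lemma bd_diag {Q : Type*} [Fintype Q] [DecidableEq Q] {s : Q → ℝ} {B : ℝ}
    (h : Bd (diagonal s) B) (a : Q) : s a ^ 2 ≤ B := by
  have := h (Pi.single a 1)
  simp [dotProduct, Matrix.mulVec_diagonal, Pi.single_apply] at this
  nlinarith

lemma bd_perturb {Q : Type*} [Fintype Q] [DecidableEq Q] {s : Q → ℝ} {B : ℝ} {D : Matrix Q Q ℝ}
    (hs : ∀ a, s a ^ 2 ≤ B) (hD : D.IsSymm) (hz : ∀ a b, s a ^ 2 = B → D a b = 0) :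
    ∀ᶠ e : ℝ in 𝓝 0, Bd (diagonal s + e • D) B := by
  set C := ∑ a, ∑ b, D a b ^ 2
  have hC : 0 ≤ C := by positivity
  have h1 : ∀ᶠ e : ℝ in 𝓝 0, ∀ a, s a ^ 2 < B → s a ^ 2 * (1 + |e|) + 2 * |e| * C ≤ B := by
    rw [Filter.eventually_all]
    intro a
    by_cases ha : s a ^ 2 < B
    · have hc : Continuous fun e : ℝ => s a ^ 2 * (1 + |e|) + 2 * |e| * C := by fun_prop
      have := hc.tendsto 0
      simp only [abs_zero, add_zero, mul_one, mul_zero, zero_mul] at this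
      filter_upwards [this.eventually_lt_const ha] with e he _ using he.le
    · exact Eventually.of_forall fun _ h => absurd h ha
  have h2 : ∀ᶠ e : ℝ in 𝓝 0, |e| ≤ 1 := by
    have hc : Continuous fun e : ℝ => |e| := by fun_prop
    have := hc.tendsto 0
    simp only [abs_zero] at this
    filter_upwards [this.eventually_lt_const one_pos] with e he using he.le
  filter_upwards [h1, h2] with e he1 he2 v
  -- truncated vector
  let w : Q → ℝ := fun b => if s b ^ 2 = B then 0 else v b
  have hz' : ∀ a b, s b ^ 2 = B → D a b = 0 := fun a b h => by
    rw [← hD.apply]; exact hz b a h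
  have hDv : ∀ a, (D *ᵥ v) a = (D *ᵥ w) a := by
    intro a
    simp only [mulVec, dotProduct]
    refine Finset.sum_congr rfl fun b _ => ?_
    by_cases hb : s b ^ 2 = B
    · simp [hz' a b hb]
    · simp [w, hb]
  have hη : ∑ a, (D *ᵥ w) a ^ 2 ≤ C * ∑ b, w b ^ 2 := by
    rw [Finset.sum_mul]
    refine Finset.sum_le_sum fun a _ => ?_
    exact Finset.sum_mul_sq_le_sq_mul_sq _ _ _
  have hpt : ∀ a, (((diagonal s + e • D) *ᵥ v) a) ^ 2 ≤
      (if s a ^ 2 = B then B * v a ^ 2 else s a ^ 2 * (1 + |e|) * w a ^ 2) + 2 * |e| * (D *ᵥ w) a ^ 2 := by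
    intro a
    have : ((diagonal s + e • D) *ᵥ v) a = s a * v a + e * (D *ᵥ w) a := by
      rw [add_mulVec, smul_mulVec, Pi.add_apply, mulVec_diagonal, Pi.smul_apply, hDv, smul_eq_mul]
    rw [this]
    by_cases ha : s a ^ 2 = B
    · have : (D *ᵥ w) a = 0 := by
        simp only [mulVec, dotProduct]
        exact Finset.sum_eq_zero fun b _ => by simp [hz a b ha]
      simp [this, ha, mul_pow]
    · simp only [ha, if_false, w]
      set η := (D *ᵥ w) a
      have e1 : e ^ 2 ≤ |e| := by
        rw [← sq_abs]; nlinarith [abs_nonneg e]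
      have e2 : 2 * (e * ((s a * v a) * η)) ≤ |e| * ((s a * v a) ^ 2 + η ^ 2) := by
        have h3 : e * ((s a * v a) * η) ≤ |e| * (|s a * v a| * |η|) := by
          rw [← abs_mul, ← abs_mul]; exact le_abs_self _
        have h4 : 2 * (|s a * v a| * |η|) ≤ (s a * v a) ^ 2 + η ^ 2 := by
          rw [← sq_abs (s a * v a), ← sq_abs η]
          nlinarith [sq_nonneg (|s a * v a| - |η|)]
        nlinarith [abs_nonneg e]
      have e3 : e ^ 2 * η ^ 2 ≤ |e| * η ^ 2 := mul_le_mul_of_nonneg_right e1 (sq_nonneg _)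
      nlinarith
  have hdot : ∀ u : Q → ℝ, u ⬝ᵥ u = ∑ a, u a ^ 2 := fun u => by
    simp [dotProduct, sq]
  rw [hdot, hdot, Finset.mul_sum]
  refine (Finset.sum_le_sum fun a _ => hpt a).trans ?_
  rw [Finset.sum_add_distrib, ← Finset.mul_sum]
  have h5 : 2 * |e| * ∑ a, (D *ᵥ w) a ^ 2 ≤ ∑ b, 2 * |e| * C * w b ^ 2 := by
    rw [← Finset.mul_sum, mul_assoc (2 * |e|)]
    exact mul_le_mul_of_nonneg_left hη (by positivity)
  refine (add_le_add le_rfl h5).trans ?_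
  rw [← Finset.sum_add_distrib]
  refine Finset.sum_le_sum fun a _ => ?_
  by_cases ha : s a ^ 2 = B
  · simp [ha, w]
  · simp only [ha, if_false, w]
    have := he1 a (lt_of_le_of_ne (hs a) ha)
    nlinarith [sq_nonneg (v a)]

/-- First order coefficient of `(S + e D)^k`. -/
def X1 {Q : Type*} [Fintype Q] [DecidableEq Q] (S D : Matrix Q Q ℝ) : ℕ → Matrix Q Q ℝ
  | 0 => 0
  | k + 1 => X1 S D k * S + S ^ k * D

/-- Second order coefficient of `(S + e D)^k`. -/
def X2 {Q : Type*} [Fintype Q] [DecidableEq Q] (S D : Matrix Q Q ℝ) : ℕ → Matrix Q Q ℝ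
  | 0 => 0
  | k + 1 => X2 S D k * S + X1 S D k * D

lemma expand {Q : Type*} [Fintype Q] [DecidableEq Q] (S D : Matrix Q Q ℝ) (k : ℕ) :
    ∃ R : ℝ → Matrix Q Q ℝ, Continuous R ∧ ∀ e : ℝ,
      (S + e • D) ^ k = S ^ k + e • X1 S D k + e ^ 2 • X2 S D k + e ^ 3 • R e := by
  induction k with
  | zero => exact ⟨fun _ => 0, continuous_const, fun e => by simp [X1, X2]⟩
  | succ k ih =>
    obtain ⟨R, hR, h⟩ := ih
    refine ⟨fun e => R e * S + X2 S D k * D + e • (R e * D), by fun_prop, fun e => ?_⟩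
    rw [pow_succ, h, X1, X2, pow_succ S k]
    simp only [mul_add, add_mul, smul_mul_assoc, mul_smul_comm, smul_add, smul_smul]
    module

lemma X1_bound {Q : Type*} [Fintype Q] [DecidableEq Q] (s : Q → ℝ) (D : Matrix Q Q ℝ) (k : ℕ)
    (a b : Q) : |X1 (diagonal s) D (k + 1) a b| ≤ (k + 1) * |D a b| * (max |s a| |s b|) ^ k := by
  induction k with
  | zero => simp [X1]
  | succ k ih =>
    rw [X1, Matrix.add_apply, mul_diagonal, diagonal_pow, diagonal_mul]
    refine (abs_add_le _ _).trans ?_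
    rw [abs_mul, abs_mul, Pi.pow_apply, abs_pow]
    set M := max |s a| |s b|
    have h1 : |s a| ≤ M := le_max_left _ _
    have h2 : |s b| ≤ M := le_max_right _ _
    have hM : 0 ≤ M := (abs_nonneg _).trans h1
    have h3 : |s a| ^ (k + 1) ≤ M ^ (k + 1) := pow_le_pow_left₀ (abs_nonneg _) h1 _
    calc _ ≤ ((k + 1) * |D a b| * M ^ k) * M + M ^ (k + 1) * |D a b| := by
          gcongr
      _ = _ := by push_cast; ring

lemma X2_bound {Q : Type*} [Fintype Q] [DecidableEq Q] (s : Q → ℝ) (D : Matrix Q Q ℝ)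
    (hD : D.IsSymm) (k : ℕ) (a : Q) : |X2 (diagonal s) D (k + 2) a a| ≤
      ∑ b, (k + 1) * (k + 2) / 2 * D a b ^ 2 * (max |s a| |s b|) ^ k := by
  have step : ∀ j : ℕ, |X2 (diagonal s) D (j + 2) a a| ≤ |X2 (diagonal s) D (j + 1) a a| * |s a| +
      ∑ b, (j + 1) * D a b ^ 2 * (max |s a| |s b|) ^ j := by
    intro j
    rw [X2, Matrix.add_apply, mul_diagonal, Matrix.mul_apply]
    refine (abs_add_le _ _).trans ?_
    rw [abs_mul]
    refine add_le_add le_rfl ((Finset.abs_sum_le_sum_abs _ _).trans ?_)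
    refine Finset.sum_le_sum fun b _ => ?_
    rw [abs_mul]
    have := X1_bound s D j a b
    have h2 : |D b a| = |D a b| := by rw [hD.apply]
    rw [h2]
    calc _ ≤ ((j + 1) * |D a b| * (max |s a| |s b|) ^ j) * |D a b| := by gcongr
      _ = (j + 1) * |D a b| ^ 2 * (max |s a| |s b|) ^ j := by ring
      _ = _ := by rw [sq_abs]
  induction k with
  | zero =>
    refine (step 0).trans ?_
    simp [X2, X1]
  | succ k ih =>
    refine (step (k + 1)).trans ?_
    calc _ ≤ (∑ b, (k + 1) * (k + 2) / 2 * D a b ^ 2 * (max |s a| |s b|) ^ k) * |s a| +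
        ∑ b, ((k + 1 : ℕ) + 1) * D a b ^ 2 * (max |s a| |s b|) ^ (k + 1) := by gcongr
      _ ≤ _ := by
        rw [Finset.sum_mul, ← Finset.sum_add_distrib]
        refine Finset.sum_le_sum fun b _ => ?_
        have h1 : |s a| ≤ max |s a| |s b| := le_max_left _ _
        set M := max |s a| |s b|
        have hM : 0 ≤ M := (abs_nonneg _).trans h1
        calc _ ≤ (k + 1) * (k + 2) / 2 * D a b ^ 2 * M ^ k * M +
            ((k + 1 : ℕ) + 1) * D a b ^ 2 * M ^ (k + 1) := by gcongr
          _ = _ := by push_cast; ring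

lemma X2_trace {Q : Type*} [Fintype Q] [DecidableEq Q] (s : Q → ℝ) (D : Matrix Q Q ℝ)
    (hD : D.IsSymm) (r : ℕ) : (X2 (diagonal s) D (2 * (r + 1))).trace ≤
      4 * (r + 1) ^ 2 * ∑ a, ∑ b, s a ^ (2 * r) * D a b ^ 2 := by
  have h1 : (X2 (diagonal s) D (2 * (r + 1))).trace ≤
      ∑ a, ∑ b, 2 * (r + 1 : ℝ) ^ 2 * D a b ^ 2 * (s a ^ (2 * r) + s b ^ (2 * r)) := by
    refine Finset.sum_le_sum fun a _ => ?_
    refine (le_abs_self _).trans ((X2_bound s D hD (2 * r) a).trans ?_)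
    refine Finset.sum_le_sum fun b _ => ?_
    have h2 : (max |s a| |s b|) ^ (2 * r) ≤ s a ^ (2 * r) + s b ^ (2 * r) := by
      have e : ∀ x : ℝ, |x| ^ (2 * r) = x ^ (2 * r) := fun x => by
        rw [pow_mul, pow_mul, sq_abs]
      have p : ∀ x : ℝ, 0 ≤ x ^ (2 * r) := fun x => by rw [pow_mul]; positivity
      rcases max_choice |s a| |s b| with h | h <;> rw [h, e]
      · linarith [p (s b)]
      · linarith [p (s a)]
    have h3 : ((2 * r : ℕ) + 1 : ℝ) * ((2 * r : ℕ) + 2) / 2 ≤ 2 * (r + 1) ^ 2 := by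
      push_cast
      have : (0:ℝ) ≤ r := by positivity
      nlinarith
    gcongr
  refine h1.trans (le_of_eq ?_)
  have h4 : ∑ a, ∑ b, D a b ^ 2 * s b ^ (2 * r) = ∑ a, ∑ b, s a ^ (2 * r) * D a b ^ 2 := by
    rw [Finset.sum_comm]
    refine Finset.sum_congr rfl fun a _ => Finset.sum_congr rfl fun b _ => ?_
    rw [hD.apply]; ring
  calc _ = 2 * (r + 1 : ℝ) ^ 2 * (∑ a, ∑ b, s a ^ (2 * r) * D a b ^ 2) +
        2 * (r + 1 : ℝ) ^ 2 * (∑ a, ∑ b, D a b ^ 2 * s b ^ (2 * r)) := by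
        simp only [Finset.mul_sum, ← Finset.sum_add_distrib]
        refine Finset.sum_congr rfl fun a _ => Finset.sum_congr rfl fun b _ => ?_
        ring
    _ = _ := by rw [h4]; ring

lemma second_diff {Q : Type*} [Fintype Q] [DecidableEq Q] (s : Q → ℝ) (D : Matrix Q Q ℝ)
    (hD : D.IsSymm) (r : ℕ) : ∃ ρ : ℝ → ℝ, Continuous ρ ∧ ∀ e : ℝ,
      ((diagonal s + e • D) ^ (2 * (r + 1))).trace + ((diagonal s + (-e) • D) ^ (2 * (r + 1))).trace
        - 2 * ((diagonal s) ^ (2 * (r + 1))).trace ≤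
      2 * e ^ 2 * (4 * (r + 1) ^ 2 * ∑ a, ∑ b, s a ^ (2 * r) * D a b ^ 2) + e ^ 3 * ρ e := by
  obtain ⟨R, hR, h⟩ := expand (diagonal s) D (2 * (r + 1))
  refine ⟨fun e => (R e).trace - (R (-e)).trace, ?_, fun e => ?_⟩
  · have : Continuous fun e => R (-e) := hR.comp continuous_neg
    exact (hR.matrix_trace).sub this.matrix_trace
  · rw [h e, h (-e)]
    simp only [trace_add, trace_smul, smul_eq_mul]
    have := X2_trace s D hD r
    have h2 : e ^ 2 * (X2 (diagonal s) D (2 * (r + 1))).trace ≤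
      e ^ 2 * (4 * (r + 1) ^ 2 * ∑ a, ∑ b, s a ^ (2 * r) * D a b ^ 2) := by gcongr
    nlinarith

lemma improve_base {F α β : Type*} [Fintype F] [Fintype α] [Fintype β]
    (l : α → F → ℝ) (c : β → F → ℝ) (hβ : 2 * Fintype.card β ≤ Fintype.card F)
    (hF : 0 < Fintype.card F) :
    ∃ y : F → ℝ, 0 < ∑ i, y i ^ 2 ∧ (∀ b, ∑ i, y i * c b i = 0) ∧
      Fintype.card F * ∑ a, (∑ i, y i * l a i) ^ 2 ≤ 2 * (∑ a, ∑ i, l a i ^ 2) * ∑ i, y i ^ 2 := by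
  let T : EuclideanSpace ℝ F →ₗ[ℝ] (β → ℝ) :=
    { toFun := fun y b => ∑ i, y i * c b i
      map_add' := fun x y => by
        ext b; simp [add_mul, Finset.sum_add_distrib]
      map_smul' := fun t y => by
        ext b; simp [mul_assoc, Finset.mul_sum] }
  have h1 := LinearMap.finrank_range_add_finrank_ker T
  have h2 : Module.finrank ℝ (LinearMap.range T) ≤ Fintype.card β := by
    have := Submodule.finrank_le (LinearMap.range T)
    simpa using this
  simp only [finrank_euclideanSpace] at h1
  have h3 : Fintype.card F ≤ 2 * Module.finrank ℝ (LinearMap.ker T) := by omega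
  obtain ⟨y, hy, hy0, hyl⟩ := good_dir (LinearMap.ker T) (by omega) (fun a => WithLp.toLp 2 (l a))
  have hn : ‖y‖ ^ 2 = ∑ i, y i ^ 2 := EuclideanSpace.real_norm_sq_eq y
  refine ⟨fun i => y i, by rw [← hn]; positivity, fun b => congrFun (LinearMap.mem_ker.1 hy) b, ?_⟩
  rw [hn] at hyl
  have hin : ∀ a, inner ℝ y (WithLp.toLp 2 (l a)) = ∑ i, y i * l a i := by
    intro a
    simp [PiLp.inner_apply, mul_comm]
  have hl : ∀ a, ‖(WithLp.toLp 2 (l a) : EuclideanSpace ℝ F)‖ ^ 2 = ∑ i, l a i ^ 2 := by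
    intro a; rw [EuclideanSpace.real_norm_sq_eq]
  simp only [hin, hl] at hyl
  have h4 : (Fintype.card F : ℝ) ≤ 2 * Module.finrank ℝ (LinearMap.ker T) := by exact_mod_cast h3
  calc _ ≤ (2 * Module.finrank ℝ (LinearMap.ker T)) * ∑ a, (∑ i, y i * l a i) ^ 2 := by
        gcongr
    _ ≤ _ := by linarith

lemma improve {ι α β : Type*} [Fintype ι] [Fintype α] [Fintype β] (P : ι → Prop) [DecidablePred P]
    (l : α → ι → ℝ) (c : β → ι → ℝ) (hβ : 2 * Fintype.card β ≤ Fintype.card {i // P i})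
    (hF : 0 < Fintype.card {i // P i}) :
    ∃ Y : ι → ℝ, (∀ i, ¬ P i → Y i = 0) ∧ 0 < ∑ i, Y i ^ 2 ∧ (∀ b, ∑ i, Y i * c b i = 0) ∧
      Fintype.card {i // P i} * ∑ a, (∑ i, Y i * l a i) ^ 2 ≤
        2 * (∑ a, ∑ i : {i // P i}, l a i ^ 2) * ∑ i, Y i ^ 2 := by
  obtain ⟨y, h1, h2, h3⟩ := improve_base (F := {i // P i}) (fun a i => l a i) (fun b i => c b i) hβ hF
  let Y : ι → ℝ := fun i => if h : P i then y ⟨i, h⟩ else 0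
  have hY : ∀ i : {i // P i}, Y i = y i := fun i => by simp [Y, i.2]
  have hY0 : ∀ i, ¬ P i → Y i = 0 := fun i h => by simp [Y, h]
  have key : ∀ g : ι → ℝ, (∀ i, ¬ P i → g i = 0) → ∑ i, g i = ∑ i : {i // P i}, g i := by
    intro g hg
    rw [← Fintype.sum_subtype_add_sum_subtype P g]
    have : ∑ i : {i // ¬ P i}, g i = 0 := Finset.sum_eq_zero fun i _ => hg i i.2
    rw [this, add_zero]
  have e1 : ∑ i, Y i ^ 2 = ∑ i, y i ^ 2 := by
    rw [key _ (fun i h => by simp [hY0 i h])]; simp only [hY]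
  have e2 : ∀ g : ι → ℝ, ∑ i, Y i * g i = ∑ i : {i // P i}, y i * g i := fun g => by
    rw [key _ (fun i h => by simp [hY0 i h])]; simp only [hY]
  refine ⟨Y, hY0, by rw [e1]; exact h1, fun b => by rw [e2]; exact h2 b, ?_⟩
  rw [e1]; simp only [e2]; exact h3

lemma trace_even_nonneg {Q : Type*} [Fintype Q] [DecidableEq Q] (S : Matrix Q Q ℝ) (hS : S.IsSymm)
    (k : ℕ) : 0 ≤ (S ^ (2 * k)).trace := by
  obtain ⟨U, s, h1, h2, h3⟩ := exists_spec S hS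
  rw [← trace_conj_pow h2 h1, h3, diagonal_pow, trace_diagonal]
  refine Finset.sum_nonneg fun a _ => ?_
  rw [Pi.pow_apply, pow_mul]; positivity

lemma young (u P : ℝ) (hu : 0 ≤ u) (hP : 0 ≤ P) (r : ℕ) : u ^ r * P ≤ u ^ (r + 1) + P ^ (r + 1) := by
  rcases le_total u P with h | h
  · have : u ^ r * P ≤ P ^ r * P := by gcongr
    have h2 : 0 ≤ u ^ (r + 1) := by positivity
    rw [pow_succ P]; linarith
  · have : u ^ r * P ≤ u ^ r * u := by gcongr
    have h2 : 0 ≤ P ^ (r + 1) := by positivity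
    rw [pow_succ u]; linarith

/-- From a point with more than `N/2` free coordinates there is a direction along which
the potential decreases to second order. -/
lemma direction {ι J Q : Type*} [Fintype ι] [Fintype J] [Fintype Q] [DecidableEq Q]
    (A : ι → J → Matrix Q Q ℝ) (hA : ∀ i j, (A i j).IsSymm) (hB : ∀ i j, Bd (A i j) 1)
    (P : ι → Prop) [DecidablePred P] (S : J → Matrix Q Q ℝ) (hS : ∀ j, (S j).IsSymm) (B : ℝ)
    (hSB : ∀ j, Bd (S j) B) (r : ℕ)
    (hcount : ∀ k : ℕ, k * B ^ (r + 1) ≤ ∑ j, (S j ^ (2 * (r + 1))).trace →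
      2 * (k * Fintype.card Q) ≤ Fintype.card {i // P i})
    (hF : 0 < Fintype.card {i // P i}) (M : ℝ) (hM : 0 < M) :
    ∃ Y : ι → ℝ, (∀ i, ¬ P i → Y i = 0) ∧ 0 < ∑ i, Y i ^ 2 ∧
      (∀ᶠ e : ℝ in 𝓝 0, ∀ j, Bd (S j + e • ∑ i, Y i • A i j) B) ∧
      ∃ ρ : ℝ → ℝ, Continuous ρ ∧ ∀ e : ℝ,
        ∑ j, ((S j + e • ∑ i, Y i • A i j) ^ (2 * (r + 1))).trace +
        ∑ j, ((S j + (-e) • ∑ i, Y i • A i j) ^ (2 * (r + 1))).trace -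
        2 * ∑ j, (S j ^ (2 * (r + 1))).trace ≤
        e ^ 2 * (16 * (r + 1) ^ 2 / M * (∑ j, (S j ^ (2 * (r + 1))).trace +
          (Fintype.card J * Fintype.card Q) * M ^ (r + 1)) * ∑ i, Y i ^ 2) + e ^ 3 * ρ e := by
  classical
  choose U s h1 h2 h3 using fun j => exists_spec (S j) (hS j)
  let A' : ι → J → Matrix Q Q ℝ := fun i j => (U j)ᵀ * A i j * U j
  have hA' : ∀ i j, (A' i j).IsSymm := fun i j => by
    simp only [A', Matrix.IsSymm, transpose_mul, transpose_transpose, (hA i j).eq, mul_assoc]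
  have hrow : ∀ i j a, ∑ b, A' i j a b ^ 2 ≤ 1 := fun i j a =>
    bd_row (hA' i j) (bd_conj (h2 j) (h1 j) (hB i j)) a
  have htr : ∀ j k, (S j ^ k).trace = ∑ a, s j a ^ k := fun j k => by
    rw [← trace_conj_pow (h2 j) (h1 j), h3, diagonal_pow, trace_diagonal]; rfl
  have hs : ∀ j a, s j a ^ 2 ≤ B := fun j a => by
    have := bd_conj (h2 j) (h1 j) (hSB j)
    rw [h3] at this
    exact bd_diag this a
  -- count of extreme eigenvalues
  have hk : 2 * Fintype.card ({t : J × Q // s t.1 t.2 ^ 2 = B} × Q) ≤ Fintype.card {i // P i} := by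
    rw [Fintype.card_prod]
    apply hcount
    simp only [htr]
    rw [← Fintype.sum_prod_type' (f := fun j a => s j a ^ (2 * (r + 1))),
      ← Fintype.sum_subtype_add_sum_subtype (fun t : J × Q => s t.1 t.2 ^ 2 = B)]
    have e1 : ∑ t : {t : J × Q // s t.1 t.2 ^ 2 = B}, s t.1.1 t.1.2 ^ (2 * (r + 1)) =
        Fintype.card {t : J × Q // s t.1 t.2 ^ 2 = B} * B ^ (r + 1) := by
      rw [Finset.sum_congr rfl (fun t _ => by rw [pow_mul, t.2])]
      simp
    rw [e1]
    refine le_add_of_nonneg_right (Finset.sum_nonneg fun t _ => ?_)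
    rw [pow_mul]; positivity
  obtain ⟨Y, hY0, hYp, hYc, hYl⟩ := improve P
    (fun (t : J × Q × Q) i => s t.1 t.2.1 ^ r * A' i t.1 t.2.1 t.2.2)
    (fun (t : {t : J × Q // s t.1 t.2 ^ 2 = B} × Q) i => A' i t.1.1.1 t.1.1.2 t.2) hk hF
  let D' : J → Matrix Q Q ℝ := fun j => ∑ i, Y i • A' i j
  have hD'e : ∀ j a b, D' j a b = ∑ i, Y i * A' i j a b := fun j a b => by
    simp [D', Matrix.sum_apply]
  have hD's : ∀ j, (D' j).IsSymm := fun j => by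
    ext a b
    rw [transpose_apply, hD'e, hD'e]
    exact Finset.sum_congr rfl fun i _ => by rw [(hA' i j).apply]
  have hconj : ∀ j (e : ℝ), (U j)ᵀ * (S j + e • ∑ i, Y i • A i j) * U j =
      diagonal (s j) + e • D' j := fun j e => by
    rw [mul_add, add_mul, h3, mul_smul_comm, smul_mul_assoc, Finset.mul_sum, Finset.sum_mul]
    simp only [D', A', mul_smul_comm, smul_mul_assoc]
  refine ⟨Y, hY0, hYp, ?_, ?_⟩
  · rw [Filter.eventually_all]
    intro j
    have := bd_perturb (hs j) (hD's j) (fun a b hab => by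
      rw [hD'e]; exact hYc (⟨(j, a), hab⟩, b))
    filter_upwards [this] with e he
    rw [← bd_conj_iff (h2 j) (h1 j), hconj]
    exact he
  · choose ρ hρ hρe using fun j => second_diff (s j) (D' j) (hD's j) r
    refine ⟨fun e => ∑ j, ρ j e, by fun_prop, fun e => ?_⟩
    have hsum : ∑ j, ((S j + e • ∑ i, Y i • A i j) ^ (2 * (r + 1))).trace +
        ∑ j, ((S j + (-e) • ∑ i, Y i • A i j) ^ (2 * (r + 1))).trace -
        2 * ∑ j, (S j ^ (2 * (r + 1))).trace ≤
        ∑ j, (2 * e ^ 2 * (4 * (r + 1) ^ 2 * ∑ a, ∑ b, s j a ^ (2 * r) * D' j a b ^ 2) +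
          e ^ 3 * ρ j e) := by
      rw [Finset.mul_sum, ← Finset.sum_add_distrib, ← Finset.sum_sub_distrib]
      refine Finset.sum_le_sum fun j _ => ?_
      refine le_trans (le_of_eq ?_) (hρe j e)
      rw [← hconj, ← hconj, ← h3, trace_conj_pow (h2 j) (h1 j), trace_conj_pow (h2 j) (h1 j),
        trace_conj_pow (h2 j) (h1 j)]
    refine hsum.trans ?_
    rw [Finset.sum_add_distrib, ← Finset.mul_sum, ← Finset.mul_sum, ← Finset.mul_sum]
    refine add_le_add ?_ le_rfl
    set f := Fintype.card {i // P i}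
    set τ := ∑ j, ∑ a, s j a ^ (2 * r)
    set y2 := ∑ i, Y i ^ 2
    have hf : (0:ℝ) < f := by exact_mod_cast hF
    -- left side of hYl
    have hq : ∑ t : J × Q × Q, (∑ i, Y i * (s t.1 t.2.1 ^ r * A' i t.1 t.2.1 t.2.2)) ^ 2 =
        ∑ j, ∑ a, ∑ b, s j a ^ (2 * r) * D' j a b ^ 2 := by
      simp only [Fintype.sum_prod_type, hD'e]
      refine Finset.sum_congr rfl fun j _ => Finset.sum_congr rfl fun a _ =>
        Finset.sum_congr rfl fun b _ => ?_
      have : ∑ i, Y i * (s j a ^ r * A' i j a b) = s j a ^ r * ∑ i, Y i * A' i j a b := by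
        rw [Finset.mul_sum]; exact Finset.sum_congr rfl fun i _ => by ring
      rw [this, mul_pow, ← pow_mul, mul_comm r]
    have hl : ∑ t : J × Q × Q, ∑ i : {i // P i}, (s t.1 t.2.1 ^ r * A' i t.1 t.2.1 t.2.2) ^ 2 ≤
        f * τ := by
      rw [Finset.sum_comm]
      have : ∀ i : {i // P i}, ∑ t : J × Q × Q, (s t.1 t.2.1 ^ r * A' i t.1 t.2.1 t.2.2) ^ 2 ≤ τ := by
        intro i
        simp only [Fintype.sum_prod_type]
        refine Finset.sum_le_sum fun j _ => Finset.sum_le_sum fun a _ => ?_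
        have e1 : ∑ b, (s j a ^ r * A' i j a b) ^ 2 = s j a ^ (2 * r) * ∑ b, A' i j a b ^ 2 := by
          rw [Finset.mul_sum]
          exact Finset.sum_congr rfl fun b _ => by rw [mul_pow, ← pow_mul, mul_comm r]
        rw [e1]
        have e2 : 0 ≤ s j a ^ (2 * r) := by rw [pow_mul]; positivity
        exact mul_le_of_le_one_right e2 (hrow i j a)
      refine (Finset.sum_le_sum fun i _ => this i).trans ?_
      simp [f]
    rw [hq] at hYl
    set q := ∑ j, ∑ a, ∑ b, s j a ^ (2 * r) * D' j a b ^ 2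
    have hq2 : q ≤ 2 * τ * y2 := by
      have : f * q ≤ f * (2 * τ * y2) := by
        refine hYl.trans ?_
        have := mul_le_mul_of_nonneg_right hl hYp.le
        nlinarith
      exact le_of_mul_le_mul_left this hf
    have hτ : τ * M ≤ ∑ j, (S j ^ (2 * (r + 1))).trace +
          (Fintype.card J * Fintype.card Q) * M ^ (r + 1) := by
      simp only [htr]
      have e1 : (Fintype.card J * Fintype.card Q) * M ^ (r + 1) = ∑ j : J, ∑ a : Q, M ^ (r + 1) := by
        simp [mul_assoc]
      rw [e1, Finset.sum_mul, ← Finset.sum_add_distrib]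
      refine Finset.sum_le_sum fun j _ => ?_
      rw [Finset.sum_mul, ← Finset.sum_add_distrib]
      refine Finset.sum_le_sum fun a _ => ?_
      rw [pow_mul, pow_mul]
      exact young _ _ (sq_nonneg _) hM.le r
    set Ψ := ∑ j, (S j ^ (2 * (r + 1))).trace + (Fintype.card J * Fintype.card Q) * M ^ (r + 1)
    have hτ2 : τ ≤ Ψ / M := by rwa [le_div_iff₀ hM]
    calc 2 * e ^ 2 * (4 * (r + 1) ^ 2 * q) ≤ 2 * e ^ 2 * (4 * (r + 1) ^ 2 * (2 * (Ψ / M) * y2)) := by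
          have : q ≤ 2 * (Ψ / M) * y2 := hq2.trans (by gcongr)
          gcongr
      _ = _ := by ring

lemma isClosed_bd {Q : Type*} [Fintype Q] (B : ℝ) : IsClosed {M : Matrix Q Q ℝ | Bd M B} := by
  have : {M : Matrix Q Q ℝ | Bd M B} = ⋂ v : Q → ℝ,
      {M : Matrix Q Q ℝ | (M *ᵥ v) ⬝ᵥ (M *ᵥ v) ≤ B * (v ⬝ᵥ v)} := by
    ext M; simp [Bd]
  rw [this]
  refine isClosed_iInter fun v => isClosed_le ?_ continuous_const
  have : Continuous fun M : Matrix Q Q ℝ => M *ᵥ v := continuous_id.matrix_mulVec continuous_const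
  exact this.dotProduct this

lemma partial_color {ι J Q : Type*} [Fintype ι] [Fintype J] [Fintype Q] [DecidableEq Q]
    (A : ι → J → Matrix Q Q ℝ) (hA : ∀ i j, (A i j).IsSymm) (hB : ∀ i j, Bd (A i j) 1)
    (x0 : ι → ℝ) (hx0 : ∀ i, |x0 i| ≤ 1) (N r : ℕ) (hN : 1 ≤ N)
    (hF : Nat.card {i // |x0 i| < 1} ≤ N)
    (hm : 0 < Fintype.card J * Fintype.card Q)
    (hp : 4 * ((Fintype.card Q : ℝ) * (Fintype.card J * Fintype.card Q)) ≤ N * Real.exp (r + 1)) :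
    ∃ x : ι → ℝ, (∀ i, |x i| ≤ 1) ∧ 2 * Nat.card {i // |x i| < 1} ≤ N ∧
      ∀ j, Bd (∑ i, (x i - x0 i) • A i j) ((r + 1) * N * Real.exp 37) := by
  classical
  have hN' : (1:ℝ) ≤ N := by exact_mod_cast hN
  set M : ℝ := (r + 1) * N with hMdef
  have hM : 0 < M := by positivity
  set B := M * Real.exp 37 with hBdef
  have hB0 : 0 < B := by positivity
  set m : ℝ := Fintype.card J * Fintype.card Q with hmdef
  have hm' : 0 < m := by rw [hmdef]; exact_mod_cast hm
  set W := m * M ^ (r + 1) with hW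
  have hW0 : 0 < W := by positivity
  let S : (ι → ℝ) → J → Matrix Q Q ℝ := fun x j => ∑ i, (x i - x0 i) • A i j
  have hSs : ∀ x j, (S x j).IsSymm := fun x j => by
    ext a b
    simp only [S, transpose_apply, Matrix.sum_apply, Matrix.smul_apply]
    exact Finset.sum_congr rfl fun i _ => by rw [(hA i j).apply]
  have hSc : ∀ j, Continuous fun x => S x j := fun j => by fun_prop
  let Φ : (ι → ℝ) → ℝ := fun x => ∑ j, (S x j ^ (2 * (r + 1))).trace
  have hΦ0 : ∀ x, 0 ≤ Φ x := fun x =>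
    Finset.sum_nonneg fun j _ => trace_even_nonneg _ (hSs x j) _
  have hΦc : Continuous Φ := by
    refine continuous_finsetSum _ fun j _ => ?_
    exact ((hSc j).pow _).matrix_trace
  set a : ℝ := 9 * (r + 1) / N with ha
  let R : (ι → ℝ) → ℝ := fun x => Real.log (Φ x + W) - a * ∑ i, (x i - x0 i) ^ 2
  have hRc : Continuous R := by
    refine Continuous.sub (Continuous.log (by fun_prop) fun x => ?_) (by fun_prop)
    have := hΦ0 x
    positivity
  let K : Set (ι → ℝ) := {x | (∀ i, |x i| ≤ 1) ∧ (∀ i, ¬ |x0 i| < 1 → x i = x0 i) ∧ ∀ j, Bd (S x j) B}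
  have hKcl : IsClosed K := by
    have : K = (⋂ i, {x | |x i| ≤ 1}) ∩ (⋂ i, {x | ¬ |x0 i| < 1 → x i = x0 i}) ∩
        ⋂ j, {x | Bd (S x j) B} := by
      ext x; simp [K, and_assoc]
    rw [this]
    refine IsClosed.inter (IsClosed.inter (isClosed_iInter fun i => ?_) (isClosed_iInter fun i => ?_))
      (isClosed_iInter fun j => ?_)
    · exact isClosed_le (by fun_prop) continuous_const
    · by_cases h : |x0 i| < 1
      · simp [h]
      · simp only [h, not_false_eq_true, forall_const]
        exact isClosed_eq (by fun_prop) continuous_const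
    · exact (isClosed_bd B).preimage (hSc j)
  have hKc : IsCompact K := by
    refine (isCompact_univ_pi (fun _ : ι => isCompact_Icc (a := (-1:ℝ)) (b := 1))).of_isClosed_subset
      hKcl ?_
    intro x hx i _
    exact abs_le.1 (hx.1 i)
  have hS0 : ∀ j, S x0 j = 0 := fun j => by simp [S]
  have hx0K : x0 ∈ K := by
    refine ⟨hx0, fun _ _ => rfl, fun j v => ?_⟩
    rw [hS0]
    simp only [zero_mulVec, dotProduct_zero]
    have : 0 ≤ v ⬝ᵥ v := by
      simp only [dotProduct]; exact Finset.sum_nonneg fun i _ => mul_self_nonneg _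
    positivity
  obtain ⟨x, hxK, hxmin⟩ := hKc.exists_isMinOn ⟨x0, hx0K⟩ hRc.continuousOn
  have hmin : ∀ z ∈ K, R x ≤ R z := fun z hz => hxmin hz
  refine ⟨x, hxK.1, ?_, hxK.2.2⟩
  by_contra hcon
  push Not at hcon
  rw [Nat.card_eq_fintype_card] at hcon hF
  -- bound on the displacement
  have hd : ∑ i, (x i - x0 i) ^ 2 ≤ 4 * N := by
    have h1 : ∑ i, (x i - x0 i) ^ 2 ≤ ∑ i, if |x0 i| < 1 then (4:ℝ) else 0 := by
      refine Finset.sum_le_sum fun i _ => ?_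
      split_ifs with h
      · have h1 := abs_le.1 (hxK.1 i)
        have h2 := abs_le.1 (hx0 i)
        nlinarith
      · simp [hxK.2.1 i h]
    refine h1.trans ?_
    rw [← Finset.sum_filter, Finset.sum_const, ← Fintype.card_subtype, nsmul_eq_mul]
    have : (Fintype.card {i // |x0 i| < 1} : ℝ) ≤ N := by exact_mod_cast hF
    linarith
  have hR0 : R x0 = Real.log W := by
    simp [R, Φ, hS0]
  set Ψ := Φ x + W with hΨ
  have hΨ0 : 0 < Ψ := by have := hΦ0 x; positivity
  have hΨle : Ψ ≤ W * Real.exp (36 * (r + 1)) := by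
    have h1 := hmin x0 hx0K
    rw [hR0] at h1
    have h2 : Real.log Ψ ≤ Real.log W + 36 * (r + 1) := by
      have h3 : a * ∑ i, (x i - x0 i) ^ 2 ≤ a * (4 * N) := by gcongr
      have h4 : a * (4 * N) = 36 * (r + 1) := by rw [ha]; field_simp; ring
      simp only [R] at h1
      linarith
    calc Ψ = Real.exp (Real.log Ψ) := (Real.exp_log hΨ0).symm
      _ ≤ Real.exp (Real.log W + 36 * (r + 1)) := Real.exp_le_exp.2 h2
      _ = _ := by rw [Real.exp_add, Real.exp_log hW0]
  have hcount : ∀ k : ℕ, k * B ^ (r + 1) ≤ ∑ j, (S x j ^ (2 * (r + 1))).trace →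
      2 * (k * Fintype.card Q) ≤ Fintype.card {i // |x i| < 1} := by
    intro k hk
    have h1 : k * B ^ (r + 1) ≤ W * Real.exp (36 * (r + 1)) := by
      refine hk.trans (le_trans ?_ hΨle)
      rw [hΨ]; simp only [Φ]; linarith
    have h2 : B ^ (r + 1) = M ^ (r + 1) * (Real.exp (36 * (r + 1)) * Real.exp (r + 1)) := by
      rw [hBdef, mul_pow, ← Real.exp_add, ← Real.exp_nat_mul]
      congr 2; push_cast; ring
    have h3 : k * Real.exp (r + 1) ≤ m := by
      have h4 : (k * Real.exp (r + 1)) * (M ^ (r + 1) * Real.exp (36 * (r + 1))) ≤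
          m * (M ^ (r + 1) * Real.exp (36 * (r + 1))) := by
        rw [h2, hW] at h1
        linarith
      exact le_of_mul_le_mul_right h4 (by positivity)
    have h5 : (4 * (k * Fintype.card Q) : ℝ) * Real.exp (r + 1) ≤ N * Real.exp (r + 1) := by
      calc (4 * (k * Fintype.card Q) : ℝ) * Real.exp (r + 1)
          = 4 * (Fintype.card Q * (k * Real.exp (r + 1))) := by ring
        _ ≤ 4 * (Fintype.card Q * m) := by gcongr
        _ ≤ _ := hp
    have h6 : (4 * (k * Fintype.card Q) : ℝ) ≤ N := le_of_mul_le_mul_right h5 (Real.exp_pos _)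
    have h7 : 4 * (k * Fintype.card Q) ≤ N := by exact_mod_cast h6
    omega
  obtain ⟨Y, hY0, hYp, hfeas, ρ, hρc, hρ⟩ := direction A hA hB (fun i => |x i| < 1) (S x) (hSs x) B
    hxK.2.2 r hcount (by omega) M hM
  have hSY : ∀ (e : ℝ) j, S (x + e • Y) j = S x j + e • ∑ i, Y i • A i j := fun e j => by
    simp only [S, Finset.smul_sum, ← Finset.sum_add_distrib, smul_smul, ← add_smul]
    refine Finset.sum_congr rfl fun i _ => ?_
    congr 1
    simp only [Pi.add_apply, Pi.smul_apply, smul_eq_mul]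
    ring
  have hbox : ∀ᶠ e : ℝ in 𝓝 0, ∀ i, |(x + e • Y) i| ≤ 1 := by
    rw [Filter.eventually_all]
    intro i
    by_cases h : |x i| < 1
    · have hc : Continuous fun e : ℝ => |(x + e • Y) i| := by
        simp only [Pi.add_apply, Pi.smul_apply]; fun_prop
      have := hc.tendsto 0
      simp only [zero_smul, add_zero] at this
      filter_upwards [this.eventually_lt_const h] with e he using he.le
    · refine Eventually.of_forall fun e => ?_
      simp only [Pi.add_apply, Pi.smul_apply, hY0 i h, smul_zero, add_zero]
      exact hxK.1 i
  have hin : ∀ᶠ e : ℝ in 𝓝 0, x + e • Y ∈ K := by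
    filter_upwards [hbox, hfeas] with e h1 h2
    refine ⟨h1, fun i hi => ?_, fun j => ?_⟩
    · have h3 := hxK.2.1 i hi
      have h4 : ¬ |x i| < 1 := by rw [h3]; exact hi
      simp only [Pi.add_apply, Pi.smul_apply, hY0 i h4, smul_zero, add_zero]
      exact h3
    · rw [hSY]; exact h2 j
  have hin' : ∀ᶠ e : ℝ in 𝓝 0, x + (-e) • Y ∈ K := by
    have : Tendsto (fun e : ℝ => -e) (𝓝 0) (𝓝 0) := by simpa using (continuous_neg.tendsto (0:ℝ))
    exact this.eventually hin
  set y2 := ∑ i, Y i ^ 2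
  have hsmall : ∀ᶠ e : ℝ in 𝓝 0, e * ρ e / Ψ < 2 * ((r + 1) / N) * y2 := by
    have hc : Continuous fun e : ℝ => e * ρ e / Ψ := by fun_prop
    have := hc.tendsto 0
    simp only [zero_mul, zero_div] at this
    exact this.eventually_lt_const (by positivity)
  have hall := (hin.and (hin'.and hsmall)).filter_mono (nhdsWithin_le_nhds (s := Set.Ioi 0))
  obtain ⟨e, ⟨k1, k2, k3⟩, he⟩ := (hall.and self_mem_nhdsWithin).exists
  have he0 : 0 < e := he
  have r1 := hmin _ k1
  have r2 := hmin _ k2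
  have hlog : ∀ z, Real.log (Φ z + W) ≤ Real.log Ψ + (Φ z - Φ x) / Ψ := by
    intro z
    have hz : 0 < Φ z + W := by have := hΦ0 z; positivity
    have := Real.log_le_sub_one_of_pos (div_pos hz hΨ0)
    rw [Real.log_div hz.ne' hΨ0.ne'] at this
    have h4 : (Φ z + W) / Ψ - 1 = (Φ z - Φ x) / Ψ := by
      rw [hΨ] at hΨ0 ⊢; field_simp; ring
    linarith
  have l1 := hlog (x + e • Y)
  have l2 := hlog (x + (-e) • Y)
  have q1 : ∑ i, ((x + e • Y) i - x0 i) ^ 2 + ∑ i, ((x + (-e) • Y) i - x0 i) ^ 2 =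
      2 * ∑ i, (x i - x0 i) ^ 2 + 2 * e ^ 2 * y2 := by
    simp only [y2, Finset.mul_sum, ← Finset.sum_add_distrib]
    refine Finset.sum_congr rfl fun i _ => ?_
    simp only [Pi.add_apply, Pi.smul_apply, smul_eq_mul]
    ring
  have q2 := hρ e
  have q3 : Φ (x + e • Y) + Φ (x + (-e) • Y) - 2 * Φ x ≤
      e ^ 2 * (16 * (r + 1) ^ 2 / M * Ψ * y2) + e ^ 3 * ρ e := by
    simp only [Φ, hSY]
    exact q2
  have q4 : (Φ (x + e • Y) - Φ x) / Ψ + (Φ (x + (-e) • Y) - Φ x) / Ψ ≤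
      e ^ 2 * (16 * ((r + 1) / N) * y2) + e ^ 2 * (e * ρ e / Ψ) := by
    rw [← add_div, div_le_iff₀ hΨ0]
    refine le_trans (by linarith) (q3.trans (le_of_eq ?_))
    rw [hMdef]
    field_simp
  have q5 : e ^ 2 * (e * ρ e / Ψ) < e ^ 2 * (2 * ((r + 1) / N) * y2) := by gcongr
  have q6 : a * (2 * e ^ 2 * y2) = e ^ 2 * (18 * ((r + 1) / N) * y2) := by rw [ha]; ring
  simp only [R] at r1 r2
  have q7 : a * ∑ i, ((x + e • Y) i - x0 i) ^ 2 + a * ∑ i, ((x + (-e) • Y) i - x0 i) ^ 2 =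
      2 * (a * ∑ i, (x i - x0 i) ^ 2) + a * (2 * e ^ 2 * y2) := by
    rw [← mul_add, q1]; ring
  linarith

/-- The `j`-th diagonal block. -/
def blk {c q : ℕ} (A : Matrix (Fin (c * q)) (Fin (c * q)) ℝ) (j : Fin c) :
    Matrix (Fin q) (Fin q) ℝ :=
  fun a b => A (finProdFinEquiv (j, a)) (finProdFinEquiv (j, b))

lemma sum_blk {c q : ℕ} (g : Fin (c * q) → ℝ) :
    ∑ t, g t = ∑ j : Fin c, ∑ a : Fin q, g (finProdFinEquiv (j, a)) := by
  rw [← Equiv.sum_comp finProdFinEquiv g, Fintype.sum_prod_type]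

lemma opNorm_to_bd {c q : ℕ} (A : Matrix (Fin (c * q)) (Fin (c * q)) ℝ) (h : matrixOpNorm A ≤ 1)
    (j : Fin c) : Bd (blk A j) 1 := by
  intro v
  let w : Fin (c * q) → ℝ := fun t =>
    if (finProdFinEquiv.symm t).1 = j then v (finProdFinEquiv.symm t).2 else 0
  have hw : ∀ j' a, w (finProdFinEquiv (j', a)) = if j' = j then v a else 0 := fun j' a => by
    simp only [w, Equiv.symm_apply_apply]
  have h1 := (Matrix.toEuclideanCLM (𝕜 := ℝ) (n := Fin (c * q)) A).le_of_opNorm_le h (WithLp.toLp 2 w)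
  rw [one_mul] at h1
  have h2 := pow_le_pow_left₀ (norm_nonneg _) h1 2
  rw [EuclideanSpace.real_norm_sq_eq, EuclideanSpace.real_norm_sq_eq, sum_blk, sum_blk] at h2
  have e1 : ∑ j', ∑ a, w (finProdFinEquiv (j', a)) ^ 2 = v ⬝ᵥ v := by
    rw [Finset.sum_eq_single j]
    · simp [hw, dotProduct, sq]
    · intro j' _ hj'; simp [hw, hj']
    · simp
  have e2 : ∀ a, (A *ᵥ w) (finProdFinEquiv (j, a)) = (blk A j *ᵥ v) a := by
    intro a
    simp only [mulVec, dotProduct]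
    rw [sum_blk, Finset.sum_eq_single j]
    · simp [hw, blk]
    · intro j' _ hj'; simp [hw, hj']
    · simp
  simp only [Matrix.toEuclideanCLM_toLp] at h2
  rw [e1] at h2
  rw [one_mul]
  refine le_trans ?_ h2
  refine le_trans ?_ (Finset.single_le_sum (f := fun j' => ∑ a, (A *ᵥ w) (finProdFinEquiv (j', a)) ^ 2)
    (fun j' _ => by positivity) (Finset.mem_univ j))
  simp only [e2, dotProduct, sq]
  exact le_rfl

lemma bd_to_opNorm {c q : ℕ} (A : Matrix (Fin (c * q)) (Fin (c * q)) ℝ) (hA : IsBlockDiagonal q A)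
    (B : ℝ) (hB : 0 ≤ B) (h : ∀ j, Bd (blk A j) B) : matrixOpNorm A ≤ Real.sqrt B := by
  refine ContinuousLinearMap.opNorm_le_bound _ (Real.sqrt_nonneg _) fun v => ?_
  refine (pow_le_pow_iff_left₀ (norm_nonneg _) (by positivity) two_ne_zero).1 ?_
  rw [mul_pow, Real.sq_sqrt hB, EuclideanSpace.real_norm_sq_eq, EuclideanSpace.real_norm_sq_eq,
    sum_blk, sum_blk, Finset.mul_sum]
  refine Finset.sum_le_sum fun j _ => ?_
  have e2 : ∀ a, (Matrix.toEuclideanCLM (𝕜 := ℝ) (n := Fin (c * q)) A v) (finProdFinEquiv (j, a)) =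
      (blk A j *ᵥ fun b => v (finProdFinEquiv (j, b))) a := by
    intro a
    have : (Matrix.toEuclideanCLM (𝕜 := ℝ) (n := Fin (c * q)) A v) (finProdFinEquiv (j, a)) =
      (A *ᵥ v.ofLp) (finProdFinEquiv (j, a)) := by
      rw [← Matrix.ofLp_toEuclideanCLM]
    rw [this]
    simp only [mulVec, dotProduct]
    rw [sum_blk, Finset.sum_eq_single j]
    · rfl
    · intro j' _ hj'
      refine Finset.sum_eq_zero fun b _ => ?_
      rw [hA, zero_mul]
      have hq : 0 < q := by have := a.2; omega
      simp only [finProdFinEquiv_apply_val]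
      rw [Nat.add_mul_div_left _ _ hq, Nat.add_mul_div_left _ _ hq, Nat.div_eq_of_lt a.2,
        Nat.div_eq_of_lt b.2]
      simp only [zero_add]
      exact fun h => hj' (Fin.ext h.symm)
    · simp
  have := h j (fun b => v (finProdFinEquiv (j, b)))
  simp only [dotProduct, ← sq] at this
  simp only [e2]
  exact this

lemma opNorm_add {m : ℕ} (A B : Matrix (Fin m) (Fin m) ℝ) :
    matrixOpNorm (A + B) ≤ matrixOpNorm A + matrixOpNorm B := by
  unfold matrixOpNorm
  rw [map_add]
  exact norm_add_le _ _

lemma full_color {c q n : ℕ} (hm : 0 < c * q) (A : Fin n → Matrix (Fin (c * q)) (Fin (c * q)) ℝ)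
    (hA : ∀ i, (A i).IsSymm) (hbd : ∀ i, IsBlockDiagonal q (A i)) (hn : ∀ i, matrixOpNorm (A i) ≤ 1)
    (t : ℕ) : ∀ r : ℕ, 4 * ((q : ℝ) * (c * q)) ≤ 2 ^ t * Real.exp (r + 1) → ∀ x0 : Fin n → ℝ,
      (∀ i, |x0 i| ≤ 1) → Nat.card {i // |x0 i| < 1} ≤ 2 ^ t →
      ∃ x : Fin n → ℝ, (∀ i, x i = 1 ∨ x i = -1) ∧
        matrixOpNorm (∑ i, (x i - x0 i) • A i) ≤
          5 * Real.sqrt (Real.exp 37) * Real.sqrt (2 ^ t * (r + 5)) := by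
  have step : ∀ t r : ℕ, 4 * ((q : ℝ) * (c * q)) ≤ 2 ^ t * Real.exp (r + 1) → ∀ x0 : Fin n → ℝ,
      (∀ i, |x0 i| ≤ 1) → Nat.card {i // |x0 i| < 1} ≤ 2 ^ t →
      ∃ x : Fin n → ℝ, (∀ i, |x i| ≤ 1) ∧ 2 * Nat.card {i // |x i| < 1} ≤ 2 ^ t ∧
        matrixOpNorm (∑ i, (x i - x0 i) • A i) ≤
          Real.sqrt (Real.exp 37) * Real.sqrt (2 ^ t * (r + 5)) := by
    intro t r hr x0 hx0 hc
    obtain ⟨x, h1, h2, h3⟩ := partial_color (fun i j => blk (A i) j)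
      (fun i j => by ext a b; exact (hA i).apply _ _)
      (fun i j => opNorm_to_bd _ (hn i) j) x0 hx0 (2 ^ t) r Nat.one_le_two_pow hc
      (by simpa using hm) (by simpa using hr)
    refine ⟨x, h1, h2, ?_⟩
    have := bd_to_opNorm (∑ i, (x i - x0 i) • A i) (fun a b hab => by
      rw [Matrix.sum_apply]
      exact Finset.sum_eq_zero fun i _ => by rw [Matrix.smul_apply, hbd i a b hab, smul_zero])
      ((r + 1) * (2 ^ t : ℕ) * Real.exp 37) (by positivity) (fun j => by
        have e : blk (∑ i, (x i - x0 i) • A i) j = ∑ i, (x i - x0 i) • blk (A i) j := by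
          ext a b
          simp [blk, Matrix.sum_apply]
        rw [e]; exact h3 j)
    refine this.trans ?_
    rw [← Real.sqrt_mul (Real.exp_pos _).le]
    refine Real.sqrt_le_sqrt ?_
    push_cast
    have : (0:ℝ) ≤ Real.exp 37 * 2 ^ t := by positivity
    nlinarith
  have all_signs : ∀ x : Fin n → ℝ, (∀ i, |x i| ≤ 1) → Nat.card {i // |x i| < 1} = 0 →
      ∀ i, x i = 1 ∨ x i = -1 := by
    intro x hx hc i
    rw [Nat.card_eq_fintype_card, Fintype.card_eq_zero_iff] at hc
    have : ¬ |x i| < 1 := fun h => hc.elim ⟨i, h⟩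
    exact (abs_eq zero_le_one).1 (le_antisymm (hx i) (not_lt.1 this))
  induction t with
  | zero =>
    intro r hr x0 hx0 hc
    obtain ⟨x, h1, h2, h3⟩ := step 0 r hr x0 hx0 hc
    refine ⟨x, all_signs x h1 (by omega), h3.trans ?_⟩
    have : 0 ≤ Real.sqrt (Real.exp 37) * Real.sqrt (2 ^ 0 * (r + 5)) := by positivity
    linarith
  | succ t ih =>
    intro r hr x0 hx0 hc
    obtain ⟨x, h1, h2, h3⟩ := step (t + 1) r hr x0 hx0 hc
    obtain ⟨z, k1, k2⟩ := ih (r + 1) (by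
      refine hr.trans ?_
      rw [pow_succ, mul_assoc]
      push_cast
      rw [Real.exp_add (r + 1 : ℝ) 1]
      have := Real.add_one_le_exp (1:ℝ)
      have h4 : 0 < Real.exp (r + 1 : ℝ) := Real.exp_pos _
      refine mul_le_mul_of_nonneg_left ?_ (by positivity)
      nlinarith) x h1 (by rw [pow_succ] at h2; omega)
    refine ⟨z, k1, ?_⟩
    have e : ∑ i, (z i - x0 i) • A i = ∑ i, (x i - x0 i) • A i + ∑ i, (z i - x i) • A i := by
      rw [← Finset.sum_add_distrib]
      refine Finset.sum_congr rfl fun i _ => ?_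
      rw [← add_smul]; congr 1; ring
    rw [e]
    refine (opNorm_add _ _).trans ((add_le_add h3 k2).trans ?_)
    have h5 : Real.sqrt (2 ^ t * ((r + 1 : ℕ) + 5)) ≤ 4 / 5 * Real.sqrt (2 ^ (t + 1) * (r + 5)) := by
      have : (4 / 5 : ℝ) = Real.sqrt ((4 / 5) ^ 2) := by rw [Real.sqrt_sq (by norm_num)]
      rw [this, ← Real.sqrt_mul (by norm_num)]
      refine Real.sqrt_le_sqrt ?_
      push_cast
      rw [pow_succ (2:ℝ) t]
      have h6 : (0:ℝ) < 2 ^ t := by positivity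
      have h7 : (0:ℝ) ≤ 2 ^ t * r := by positivity
      nlinarith
    have h8 : 0 ≤ Real.sqrt (Real.exp 37) := Real.sqrt_nonneg _
    nlinarith [mul_le_mul_of_nonneg_left h5 h8]

/-- **Matrix balancing (Theorem 3).** There is a universal constant `C > 0` such that for any
symmetric `q`-block diagonal matrices `A_1, …, A_n ∈ ℝ^{m×m}` with `‖A_i‖_op ≤ 1` (where
`q ∣ m` and `qm ≥ n`) there is a coloring `x ∈ {-1,1}^n` with
`‖∑ i, x_i A_i‖_op ≤ C √(n log(2qm/n))`. -/
theorem stmt_3 :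
    ∃ C : ℝ, 0 < C ∧
      ∀ (q m n : ℕ), q ∣ m → n ≤ q * m →
        ∀ A : Fin n → Matrix (Fin m) (Fin m) ℝ,
          (∀ i, (A i).IsSymm) →
          (∀ i, IsBlockDiagonal q (A i)) →
          (∀ i, matrixOpNorm (A i) ≤ 1) →
          ∃ x : Fin n → ℝ,
            (∀ i, x i = 1 ∨ x i = -1) ∧
            matrixOpNorm (∑ i, x i • A i) ≤
              C * Real.sqrt ((n : ℝ) * Real.log (2 * (q : ℝ) * (m : ℝ) / (n : ℝ))) := by
  refine ⟨5 * Real.sqrt (Real.exp 37) * Real.sqrt 24, by positivity, ?_⟩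
  rintro q m n ⟨c, hc⟩ hnm A hA hbd hop
  rw [mul_comm q c] at hc
  subst hc
  rcases Nat.eq_zero_or_pos n with rfl | hn
  · refine ⟨fun _ => 1, fun _ => Or.inl rfl, ?_⟩
    simp [matrixOpNorm]
  have hcq : 0 < c * q := Nat.pos_of_ne_zero fun h => by rw [h] at hnm; omega
  have hn' : (0:ℝ) < n := by exact_mod_cast hn
  set K : ℝ := (q : ℝ) * (c * q) with hK
  have hnK : (n : ℝ) ≤ K := by rw [hK]; exact_mod_cast hnm
  have hK0 : 0 < K := hn'.trans_le hnK
  set ℓ := Real.log (2 * K / n) with hℓ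
  have hℓ2 : Real.log 2 ≤ ℓ := by
    refine Real.log_le_log (by norm_num) ?_
    rw [le_div_iff₀ hn']; linarith
  have hl2 := Real.log_two_gt_d9
  have hl2' := Real.log_two_lt_d9
  have hlog4 : Real.log (4 * K / n) = Real.log 2 + ℓ := by
    rw [hℓ, ← Real.log_mul (by norm_num) (by positivity)]; congr 1; ring
  set r := ⌊Real.log (4 * K / n)⌋₊ with hr
  have hr1 : (r : ℝ) ≤ Real.log (4 * K / n) := Nat.floor_le (by rw [hlog4]; linarith)
  have hr2 : Real.log (4 * K / n) < r + 1 := Nat.lt_floor_add_one _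
  set t := Nat.clog 2 n with ht
  have ht1 : n ≤ 2 ^ t := Nat.le_pow_clog (by norm_num) n
  have ht1' : (n : ℝ) ≤ 2 ^ t := by exact_mod_cast ht1
  have ht2 : (2:ℝ) ^ t ≤ 2 * n := by
    have : 2 ^ t ≤ 2 * n := by
      rcases Nat.lt_or_ge 1 n with h | h
      · have h3 := Nat.pow_pred_clog_lt_self (b := 2) (by norm_num) h
        have h4 : 0 < t := Nat.clog_pos (by norm_num) h
        obtain ⟨u, hu⟩ : ∃ u, t = u + 1 := ⟨t - 1, by omega⟩
        rw [← ht, hu] at h3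
        rw [hu, pow_succ]
        simp at h3
        omega
      · have : n = 1 := by omega
        have : t = 0 := by rw [ht, this]; simp
        rw [this]; omega
    exact_mod_cast this
  have hexp : 4 * K ≤ 2 ^ t * Real.exp (r + 1) := by
    have h1 : 4 * K / n ≤ Real.exp (r + 1) := by
      rw [← Real.log_le_iff_le_exp (by positivity)]; exact hr2.le
    rw [div_le_iff₀ hn'] at h1
    have : n * Real.exp (r + 1) ≤ 2 ^ t * Real.exp (r + 1 : ℝ) := by gcongr
    linarith
  obtain ⟨x, h1, h2⟩ := full_color hcq A hA hbd hop t r hexp (fun _ => 0) (by simp) (by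
    simpa using ht1)
  refine ⟨x, h1, ?_⟩
  simp only [sub_zero] at h2
  refine h2.trans ?_
  have e1 : Real.log (2 * (q : ℝ) * ((c * q : ℕ) : ℝ) / n) = ℓ := by
    rw [hℓ, hK]; push_cast; congr 2; ring
  rw [e1, mul_assoc (5 * Real.sqrt (Real.exp 37)), ← Real.sqrt_mul (by norm_num)]
  have : (2:ℝ) ^ t * (r + 5) ≤ 24 * (n * ℓ) := by
    have h3 : (r : ℝ) + 5 ≤ 12 * ℓ := by linarith
    calc (2:ℝ) ^ t * (r + 5) ≤ (2 * n) * (12 * ℓ) := by gcongr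
      _ = _ := by ring
  gcongr
end

section
/- There exists a universal constant C > 0 such that the following holds. Let q divide m, let qm ≥ n, let A_1, …, A_n ∈ ℝ^{m×m} be symmetric q-block diagonal matrices with ‖A_i‖_op ≤ 1 for all i, and let x⁰ ∈ [-1,1]^n. Then there exists x ∈ [-1,1]^n such that ‖∑_{i=1}^n (x_i - x⁰_i)·A_i‖_op ≤ C·√(n · log(2qm/n)) and at least n/2 of the coordinates of x lie in {-1,1}. -/
section
open Matrix

/-- Second order noncommutative expansion. -/
lemma expand_pow {ι : Type*} [Fintype ι] [DecidableEq ι] (X B : Matrix ι ι ℝ) (N : ℕ) :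
    ∃ R : ℝ → Matrix ι ι ℝ, Continuous R ∧ ∀ d : ℝ,
      (X + d • B) ^ N = X ^ N + d • (∑ a ∈ Finset.range N, X ^ a * B * X ^ (N - 1 - a))
        + d ^ 2 • (∑ l ∈ Finset.range N,
            (∑ a ∈ Finset.range l, X ^ a * B * X ^ (l - 1 - a)) * B * X ^ (N - 1 - l))
        + d ^ 3 • R d := by
  induction N with
  | zero => exact ⟨fun _ => 0, continuous_const, fun d => by simp⟩
  | succ N ih =>
    obtain ⟨R, hR, h⟩ := ih
    have key : ∀ F : ℕ → Matrix ι ι ℝ,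
        ∑ a ∈ Finset.range (N + 1), F a * B * X ^ (N + 1 - 1 - a)
          = (∑ a ∈ Finset.range N, F a * B * X ^ (N - 1 - a)) * X + F N * B := by
      intro F
      rw [Finset.sum_range_succ, Finset.sum_mul]
      congr 1
      · refine Finset.sum_congr rfl fun a ha => ?_
        have : N + 1 - 1 - a = (N - 1 - a) + 1 := by
          have := Finset.mem_range.1 ha; omega
        rw [this, pow_succ, ← mul_assoc]
      · simp
    refine ⟨fun d => R d * (X + d • B) + (∑ l ∈ Finset.range N,
            (∑ a ∈ Finset.range l, X ^ a * B * X ^ (l - 1 - a)) * B * X ^ (N - 1 - l)) * B,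
      by fun_prop, fun d => ?_⟩
    rw [pow_succ (X + d • B) N, h d, key (fun a => X ^ a), key (fun l => ∑ a ∈ Finset.range l, X ^ a * B * X ^ (l - 1 - a)), pow_succ X N]
    beta_reduce
    generalize (∑ a ∈ Finset.range N, X ^ a * B * X ^ (N - 1 - a)) = P
    generalize (∑ l ∈ Finset.range N,
            (∑ a ∈ Finset.range l, X ^ a * B * X ^ (l - 1 - a)) * B * X ^ (N - 1 - l)) = T
    simp only [add_mul, mul_add, smul_mul_assoc, mul_smul_comm, smul_add, smul_smul]
    module

lemma pow_mix (a b : ℝ) (ha : 0 ≤ a) (hb : 0 ≤ b) (k l : ℕ) :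
    a ^ k * b ^ l + b ^ k * a ^ l ≤ a ^ (k + l) + b ^ (k + l) := by
  have : 0 ≤ (a ^ k - b ^ k) * (a ^ l - b ^ l) := by
    rcases le_total a b with h | h
    · exact mul_nonneg_of_nonpos_of_nonpos (sub_nonpos.2 (pow_le_pow_left₀ ha h k))
        (sub_nonpos.2 (pow_le_pow_left₀ ha h l))
    · exact mul_nonneg (sub_nonneg.2 (pow_le_pow_left₀ hb h k))
        (sub_nonneg.2 (pow_le_pow_left₀ hb h l))
  rw [pow_add, pow_add]; nlinarith

lemma trace_mix {ι : Type*} [Fintype ι] [DecidableEq ι] (lam : ι → ℝ) (B : Matrix ι ι ℝ)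
    (hB : B.IsSymm) (a b c s : ℕ) (h : a + b + c = 2 * s) :
    trace (diagonal lam ^ a * B * diagonal lam ^ b * B * diagonal lam ^ c)
      ≤ ∑ i, ∑ j, lam i ^ (2 * s) * B i j ^ 2 := by
  have e : trace (diagonal lam ^ a * B * diagonal lam ^ b * B * diagonal lam ^ c)
      = ∑ i, ∑ j, lam i ^ (a + c) * lam j ^ b * B i j ^ 2 := by
    simp only [trace, diag, diagonal_pow]
    refine Finset.sum_congr rfl fun i _ => ?_
    rw [mul_diagonal, Matrix.mul_apply, Finset.sum_mul]
    refine Finset.sum_congr rfl fun j _ => ?_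
    rw [mul_diagonal, diagonal_mul, hB.apply i j, pow_add, Pi.pow_apply, Pi.pow_apply,
      Pi.pow_apply]
    ring
  rw [e]
  have h1 : ∑ i, ∑ j, lam i ^ (a + c) * lam j ^ b * B i j ^ 2
      ≤ ∑ i, ∑ j, |lam i| ^ (a + c) * |lam j| ^ b * B i j ^ 2 := by
    refine Finset.sum_le_sum fun i _ => Finset.sum_le_sum fun j _ =>
      mul_le_mul_of_nonneg_right ?_ (sq_nonneg _)
    calc _ ≤ |lam i ^ (a + c) * lam j ^ b| := le_abs_self _
      _ = _ := by rw [abs_mul, abs_pow, abs_pow]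
  have h2 : ∑ i, ∑ j, |lam i| ^ (a + c) * |lam j| ^ b * B i j ^ 2
      = ∑ i, ∑ j, |lam j| ^ (a + c) * |lam i| ^ b * B i j ^ 2 := by
    rw [Finset.sum_comm]
    refine Finset.sum_congr rfl fun i _ => Finset.sum_congr rfl fun j _ => ?_
    rw [hB.apply i j]
  have h3 : ∑ i, ∑ j, lam i ^ (2 * s) * B i j ^ 2 = ∑ i, ∑ j, lam j ^ (2 * s) * B i j ^ 2 := by
    rw [Finset.sum_comm]
    refine Finset.sum_congr rfl fun i _ => Finset.sum_congr rfl fun j _ => ?_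
    rw [hB.apply i j]
  have h4 : (∑ i, ∑ j, |lam i| ^ (a + c) * |lam j| ^ b * B i j ^ 2)
      + (∑ i, ∑ j, |lam j| ^ (a + c) * |lam i| ^ b * B i j ^ 2)
      ≤ (∑ i, ∑ j, lam i ^ (2 * s) * B i j ^ 2) + ∑ i, ∑ j, lam j ^ (2 * s) * B i j ^ 2 := by
    simp only [← Finset.sum_add_distrib, ← add_mul]
    refine Finset.sum_le_sum fun i _ => Finset.sum_le_sum fun j _ =>
      mul_le_mul_of_nonneg_right ?_ (sq_nonneg _)
    have := pow_mix |lam i| |lam j| (abs_nonneg _) (abs_nonneg _) (a + c) b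
    have e2 : a + c + b = 2 * s := by omega
    rw [e2, (even_two_mul s).pow_abs, (even_two_mul s).pow_abs] at this
    exact this
  linarith

/-- choosing a good direction in a subspace -/
lemma select_dir {n : ℕ} {κ τ : Type*} [Fintype κ] [Fintype τ] (c : κ → Fin n → ℝ)
    (l : τ → Fin n → ℝ) (d : ℕ) (hd : 0 < d) (hcard : Fintype.card κ + d ≤ n) :
    ∃ y : Fin n → ℝ, ∑ i, y i ^ 2 = 1 ∧ (∀ k, ∑ i, c k i * y i = 0) ∧
      (d : ℝ) * ∑ t, (∑ i, l t i * y i) ^ 2 ≤ ∑ t, ∑ i, l t i ^ 2 := by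
  let v : (Fin n → ℝ) → EuclideanSpace ℝ (Fin n) := fun f => WithLp.toLp 2 f
  have hv : ∀ f (y : EuclideanSpace ℝ (Fin n)), inner ℝ (v f) y = ∑ i, f i * y i := by
    intro f y; simp [v, PiLp.inner_apply, mul_comm]
  let T : EuclideanSpace ℝ (Fin n) →ₗ[ℝ] (κ → ℝ) := LinearMap.pi fun k => (innerₛₗ ℝ (v (c k)))
  let W := LinearMap.ker T
  have hW : d ≤ Module.finrank ℝ W := by
    have h1 := LinearMap.finrank_range_add_finrank_ker T
    have h2 : Module.finrank ℝ (LinearMap.range T) ≤ Fintype.card κ := by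
      simpa using Submodule.finrank_le (LinearMap.range T)
    have h3 : Module.finrank ℝ (EuclideanSpace ℝ (Fin n)) = n := by simp
    change d ≤ Module.finrank ℝ (LinearMap.ker T)
    omega
  let b := stdOrthonormalBasis ℝ W
  have hb : Orthonormal ℝ (fun i => (b i : EuclideanSpace ℝ (Fin n))) := by
    have := b.orthonormal.comp_linearIsometry W.subtypeₗᵢ
    exact this
  have hbess : ∀ t, ∑ i, (∑ j, l t j * (b i : EuclideanSpace ℝ (Fin n)) j) ^ 2 ≤ ∑ j, l t j ^ 2 := by
    intro t
    have := hb.sum_inner_products_le (x := v (l t)) (s := Finset.univ)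
    have e : ‖v (l t)‖ ^ 2 = ∑ j, l t j ^ 2 := by
      rw [EuclideanSpace.norm_sq_eq]; simp [v]
    rw [e] at this
    refine le_trans (le_of_eq ?_) this
    refine Finset.sum_congr rfl fun i _ => ?_
    rw [real_inner_comm, hv]; simp
  have htot : ∑ i, ∑ t, (∑ j, l t j * (b i : EuclideanSpace ℝ (Fin n)) j) ^ 2 ≤ ∑ t, ∑ j, l t j ^ 2 := by
    rw [Finset.sum_comm]; exact Finset.sum_le_sum fun t _ => hbess t
  have hpos : 0 < Module.finrank ℝ W := by omega
  have : ∃ i, (d : ℝ) * ∑ t, (∑ j, l t j * (b i : EuclideanSpace ℝ (Fin n)) j) ^ 2 ≤ ∑ t, ∑ j, l t j ^ 2 := by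
    by_contra! hcon
    have hne : (Finset.univ : Finset (Fin (Module.finrank ℝ W))).Nonempty :=
      ⟨⟨0, hpos⟩, Finset.mem_univ _⟩
    have h1 := Finset.sum_lt_sum_of_nonempty hne (fun i _ => hcon i)
    rw [← Finset.mul_sum, Finset.sum_const, Finset.card_univ, Fintype.card_fin, nsmul_eq_mul] at h1
    have hnn : 0 ≤ ∑ t, ∑ j, l t j ^ 2 := by positivity
    have hdW : (d : ℝ) ≤ Module.finrank ℝ W := by exact_mod_cast hW
    have hd0 : (0 : ℝ) < d := by exact_mod_cast hd
    have := mul_le_mul_of_nonneg_left htot hd0.le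
    nlinarith
  obtain ⟨i, hi⟩ := this
  refine ⟨fun j => (b i : EuclideanSpace ℝ (Fin n)) j, ?_, ?_, hi⟩
  · have := hb.1 i
    have e : ‖(b i : EuclideanSpace ℝ (Fin n))‖ ^ 2 = ∑ j, (b i : EuclideanSpace ℝ (Fin n)) j ^ 2 := by
      rw [EuclideanSpace.norm_sq_eq]; simp
    rw [← e, this]; norm_num
  · intro k
    have := (b i).2
    have h2 : T (b i : EuclideanSpace ℝ (Fin n)) = 0 := this
    have h3 := congrFun h2 k
    rw [← hv]; simpa [T] using h3

/-- block structure with respect to a labelling -/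
def IsBlk {ι β : Type*} (blk : ι → β) (A : Matrix ι ι ℝ) : Prop :=
  ∀ a b, blk a ≠ blk b → A a b = 0

lemma IsBlk.mul {ι β : Type*} [Fintype ι] {blk : ι → β} {A B : Matrix ι ι ℝ}
    (hA : IsBlk blk A) (hB : IsBlk blk B) : IsBlk blk (A * B) := by
  intro a b hab
  rw [Matrix.mul_apply]
  refine Finset.sum_eq_zero fun c _ => ?_
  by_cases h : blk a = blk c
  · rw [hB c b (fun h' => hab (h.trans h')), mul_zero]
  · rw [hA a c h, zero_mul]

lemma IsBlk.transpose {ι β : Type*} {blk : ι → β} {A : Matrix ι ι ℝ}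
    (hA : IsBlk blk A) : IsBlk blk Aᵀ := fun a b hab => hA b a (Ne.symm hab)

lemma spectral_simple {ι : Type*} [Fintype ι] [DecidableEq ι] (X : Matrix ι ι ℝ)
    (hX : X.IsSymm) : ∃ (U : Matrix ι ι ℝ) (lam : ι → ℝ), Uᵀ * U = 1 ∧ U * Uᵀ = 1 ∧
      X = U * diagonal lam * Uᵀ := by
  have hH : X.IsHermitian := by
    rw [IsHermitian, conjTranspose_eq_transpose_of_trivial]; exact hX
  refine ⟨hH.eigenvectorUnitary, hH.eigenvalues, ?_, ?_, ?_⟩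
  · have := Unitary.coe_star_mul_self hH.eigenvectorUnitary
    rwa [star_eq_conjTranspose, conjTranspose_eq_transpose_of_trivial] at this
  · have := Unitary.mul_star_self_of_mem hH.eigenvectorUnitary.2
    rwa [star_eq_conjTranspose, conjTranspose_eq_transpose_of_trivial] at this
  · have := hH.spectral_theorem
    rw [Unitary.conjStarAlgAut_apply, star_eq_conjTranspose, conjTranspose_eq_transpose_of_trivial] at this
    exact this

lemma spectral_blk {ι β : Type*} [Fintype ι] [DecidableEq ι] [Fintype β] [DecidableEq β]
    (blk : ι → β) (X : Matrix ι ι ℝ)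
    (hX : X.IsSymm) (hb : IsBlk blk X) : ∃ (U : Matrix ι ι ℝ) (lam : ι → ℝ), Uᵀ * U = 1 ∧
      U * Uᵀ = 1 ∧ X = U * diagonal lam * Uᵀ ∧ IsBlk blk U := by
  let e : (Σ b, {a // blk a = b}) ≃ ι := Equiv.sigmaFiberEquiv blk
  have hblk : ∀ s, blk (e s) = s.1 := fun s => s.2.2
  let Y : ∀ b, Matrix {a // blk a = b} {a // blk a = b} ℝ := fun b => X.submatrix (·.1) (·.1)
  have hY : X.submatrix e e = blockDiagonal' Y := by
    ext ⟨b, i⟩ ⟨c, j⟩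
    by_cases h : b = c
    · subst h
      rw [blockDiagonal'_apply_eq]; rfl
    · rw [blockDiagonal'_apply_ne _ _ _ h]
      apply hb
      rw [hblk, hblk]; exact h
  have hs : ∀ b, ∃ (U : Matrix {a // blk a = b} {a // blk a = b} ℝ) (lam : {a // blk a = b} → ℝ),
      Uᵀ * U = 1 ∧ U * Uᵀ = 1 ∧ Y b = U * diagonal lam * Uᵀ := fun b =>
    spectral_simple _ (hX.submatrix _)
  choose U lam h1 h2 h3 using hs
  have key : ∀ Z : Matrix (Σ b, {a // blk a = b}) (Σ b, {a // blk a = b}) ℝ,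
    (Z.submatrix e.symm e.symm).submatrix e e = Z := by intro Z; ext; simp
  refine ⟨(blockDiagonal' U).submatrix e.symm e.symm, fun a => lam (e.symm a).1 (e.symm a).2,
    ?_, ?_, ?_, ?_⟩
  · rw [transpose_submatrix, submatrix_mul_equiv, blockDiagonal'_transpose, ← blockDiagonal'_mul]
    simp_rw [h1]
    have := blockDiagonal'_one (α := ℝ) (m' := fun b => {a // blk a = b})
    change (blockDiagonal' (1 : ∀ b, Matrix {a // blk a = b} {a // blk a = b} ℝ)).submatrix _ _ = 1
    rw [this, submatrix_one_equiv]
  · rw [transpose_submatrix, submatrix_mul_equiv, blockDiagonal'_transpose, ← blockDiagonal'_mul]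
    simp_rw [h2]
    have := blockDiagonal'_one (α := ℝ) (m' := fun b => {a // blk a = b})
    change (blockDiagonal' (1 : ∀ b, Matrix {a // blk a = b} {a // blk a = b} ℝ)).submatrix _ _ = 1
    rw [this, submatrix_one_equiv]
  · have hd : diagonal (fun a => lam (e.symm a).1 (e.symm a).2)
        = (blockDiagonal' (fun b => diagonal (lam b))).submatrix e.symm e.symm := by
      rw [blockDiagonal'_diagonal, submatrix_diagonal_equiv]; rfl
    rw [hd, transpose_submatrix, submatrix_mul_equiv, submatrix_mul_equiv,
      blockDiagonal'_transpose, ← blockDiagonal'_mul, ← blockDiagonal'_mul]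
    simp_rw [← h3]
    rw [← hY]; ext; simp
  · intro a b hab
    rw [submatrix_apply]
    obtain ⟨s, rfl⟩ := e.surjective a
    obtain ⟨t, rfl⟩ := e.surjective b
    rw [hblk, hblk] at hab
    rw [e.symm_apply_apply, e.symm_apply_apply]
    exact blockDiagonal'_apply_ne _ _ _ hab

lemma trace_expand {ι : Type*} [Fintype ι] [DecidableEq ι] (lam : ι → ℝ) (B : Matrix ι ι ℝ)
    (hB : B.IsSymm) (s : ℕ) (h1 : ∑ j, lam j ^ (2 * s + 1) * B j j = 0) (sl : ℝ) (hsl : 0 < sl) :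
    ∃ ε > 0, ∀ d : ℝ, 0 < d → d < ε →
      trace ((diagonal lam + d • B) ^ (2 * (s + 1))) ≤ ∑ j, lam j ^ (2 * (s + 1))
        + d ^ 2 * ((2 * (s + 1)) ^ 2 * (∑ i, ∑ j, lam i ^ (2 * s) * B i j ^ 2) + sl) := by
  obtain ⟨R, hR, hexp⟩ := expand_pow (diagonal lam) B (2 * (s + 1))
  set Q := ∑ i, ∑ j, lam i ^ (2 * s) * B i j ^ 2 with hQ
  have hQ0 : 0 ≤ Q := by
    refine Finset.sum_nonneg fun i _ => Finset.sum_nonneg fun j _ => mul_nonneg ?_ (sq_nonneg _)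
    exact (even_two_mul s).pow_nonneg _
  have t0 : trace (diagonal lam ^ (2 * (s + 1))) = ∑ j, lam j ^ (2 * (s + 1)) := by
    rw [diagonal_pow, trace_diagonal]; rfl
  have t1 : trace (∑ a ∈ Finset.range (2 * (s + 1)),
      diagonal lam ^ a * B * diagonal lam ^ (2 * (s + 1) - 1 - a)) = 0 := by
    rw [trace_sum]
    refine Finset.sum_eq_zero fun a ha => ?_
    have ha' := Finset.mem_range.1 ha
    rw [trace_mul_comm, ← mul_assoc, ← pow_add]
    have : 2 * (s + 1) - 1 - a + a = 2 * s + 1 := by omega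
    rw [this, ← h1, diagonal_pow]
    simp only [trace, diag, diagonal_mul, Pi.pow_apply]
  have t2 : trace (∑ l ∈ Finset.range (2 * (s + 1)),
      (∑ a ∈ Finset.range l, diagonal lam ^ a * B * diagonal lam ^ (l - 1 - a)) * B *
        diagonal lam ^ (2 * (s + 1) - 1 - l)) ≤ (2 * (s + 1)) ^ 2 * Q := by
    simp only [trace_sum, Finset.sum_mul]
    calc _ ≤ ∑ l ∈ Finset.range (2 * (s + 1)), ∑ a ∈ Finset.range l, Q := by
          refine Finset.sum_le_sum fun l hl => Finset.sum_le_sum fun a ha => ?_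
          have hl' := Finset.mem_range.1 hl
          have ha' := Finset.mem_range.1 ha
          exact trace_mix lam B hB _ _ _ s (by omega)
      _ ≤ ∑ l ∈ Finset.range (2 * (s + 1)), (2 * (s + 1)) * Q := by
          refine Finset.sum_le_sum fun l hl => ?_
          have hl' := (Finset.mem_range.1 hl).le
          rw [Finset.sum_const, Finset.card_range, nsmul_eq_mul]
          refine mul_le_mul_of_nonneg_right ?_ hQ0
          exact_mod_cast hl'
      _ = _ := by
          rw [Finset.sum_const, Finset.card_range, nsmul_eq_mul]; push_cast; ring
  have hcont : Continuous fun d : ℝ => d * trace (R d) := by fun_prop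
  have hev : ∀ᶠ d in nhds (0 : ℝ), d * trace (R d) < sl :=
    (hcont.tendsto 0).eventually_lt_const (by simpa using hsl)
  obtain ⟨ε, hε, hball⟩ := Metric.eventually_nhds_iff.1 hev
  refine ⟨ε, hε, fun d hd hdε => ?_⟩
  have h3 := hball (y := d) (by simpa [abs_of_pos hd] using hdε)
  rw [hexp d, trace_add, trace_add, trace_add, trace_smul, trace_smul, trace_smul, t0, t1]
  simp only [smul_eq_mul, mul_zero, add_zero]
  have hd2 : 0 < d ^ 2 := by positivity
  have e3 : d ^ 3 * trace (R d) = d ^ 2 * (d * trace (R d)) := by ring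
  rw [e3]
  nlinarith [mul_le_mul_of_nonneg_left t2 hd2.le, mul_le_mul_of_nonneg_left h3.le hd2.le]

lemma direction_s4 {ι β : Type*} [Fintype ι] [DecidableEq ι] [DecidableEq β]
    (blk : ι → β) (q n : ℕ) (hn : 16 ≤ n)
    (hq : ∀ b, (Finset.univ.filter fun a => blk a = b).card ≤ q)
    (A : Fin n → Matrix ι ι ℝ) (hb : ∀ k, IsBlk blk (A k))
    (hrow : ∀ k i, ∑ j, A k i j ^ 2 ≤ 1) (lam : ι → ℝ) (x : Fin n → ℝ) (s : ℕ)
    (act : Finset (Fin n)) (hact : n < 2 * act.card) (K : Finset ι) (hK : 8 * (q * K.card) ≤ n) :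
    ∃ y : Fin n → ℝ, (∀ i ∉ act, y i = 0) ∧ ∑ i, y i ^ 2 = 1 ∧ ∑ i, x i * y i = 0 ∧
      (∀ r, ∀ j ∈ K, (∑ k, y k • A k) r j = 0) ∧
      ∑ j, lam j ^ (2 * s + 1) * (∑ k, y k • A k) j j = 0 ∧
      ∑ i, ∑ j, lam i ^ (2 * s) * (∑ k, y k • A k) i j ^ 2 ≤ 4 * ∑ i, lam i ^ (2 * s) := by
  have happ : ∀ (y : Fin n → ℝ) r j, (∑ k, y k • A k) r j = ∑ k, A k r j * y k := by
    intro y r j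
    rw [Matrix.sum_apply]
    exact Finset.sum_congr rfl fun k _ => by simp [mul_comm]
  let P := K.sigma fun j => Finset.univ.filter fun r => blk r = blk j
  have hP : P.card ≤ q * K.card := by
    rw [Finset.card_sigma, mul_comm]
    exact Finset.sum_le_card_nsmul _ _ _ (fun j _ => hq _)
  let c : ({i // i ∈ actᶜ} ⊕ (Bool ⊕ {t // t ∈ P})) → Fin n → ℝ :=
    Sum.elim (fun i k => if k = i.1 then 1 else 0) (Sum.elim
      (fun b k => if b then x k else ∑ j, lam j ^ (2 * s + 1) * A k j j)
      (fun t k => A k t.1.2 t.1.1))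
  have hc1 : actᶜ.card + act.card = n := by
    rw [Finset.card_compl_add_card, Fintype.card_fin]
  have hcard : Fintype.card ({i // i ∈ actᶜ} ⊕ (Bool ⊕ {t // t ∈ P})) = actᶜ.card + (2 + P.card) := by
    rw [Fintype.card_sum, Fintype.card_sum, Fintype.card_bool, Fintype.card_coe, Fintype.card_coe]
  obtain ⟨y, hy1, hy2, hy3⟩ := select_dir c (fun (t : ι × ι) k => lam t.1 ^ s * A k t.1 t.2)
    (n - (actᶜ.card + (2 + P.card))) (by omega) (by rw [hcard]; omega)
  set d := n - (actᶜ.card + (2 + P.card)) with hd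
  have hd4 : n ≤ 4 * d := by omega
  refine ⟨y, ?_, hy1, ?_, ?_, ?_, ?_⟩
  · intro i hi
    have := hy2 (Sum.inl ⟨i, by simpa using hi⟩)
    simpa [c] using this
  · have := hy2 (Sum.inr (Sum.inl true))
    simpa [c] using this
  · intro r j hj
    rw [happ]
    by_cases h : blk r = blk j
    · exact hy2 (Sum.inr (Sum.inr ⟨⟨j, r⟩, by simp [P, hj, h]⟩))
    · exact Finset.sum_eq_zero fun k _ => by rw [hb k r j h, zero_mul]
  · have := hy2 (Sum.inr (Sum.inl false))
    simp only [c, Sum.elim_inr, Sum.elim_inl, Finset.sum_mul] at this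
    rw [← this]
    simp only [happ, Bool.false_eq_true, if_false, Finset.sum_mul, Finset.mul_sum]
    rw [Finset.sum_comm]
    exact Finset.sum_congr rfl fun _ _ => Finset.sum_congr rfl fun _ _ => by ring
  · have e1 : ∑ t : ι × ι, (∑ k, lam t.1 ^ s * A k t.1 t.2 * y k) ^ 2
        = ∑ i, ∑ j, lam i ^ (2 * s) * (∑ k, y k • A k) i j ^ 2 := by
      rw [Fintype.sum_prod_type]
      refine Finset.sum_congr rfl fun i _ => Finset.sum_congr rfl fun j _ => ?_
      rw [happ]
      simp only [mul_assoc]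
      rw [← Finset.mul_sum]; ring
    have e2 : ∑ t : ι × ι, ∑ k, (lam t.1 ^ s * A k t.1 t.2) ^ 2 ≤ n * ∑ i, lam i ^ (2 * s) := by
      rw [Fintype.sum_prod_type, Finset.mul_sum]
      refine Finset.sum_le_sum fun i _ => ?_
      rw [Finset.sum_comm]
      calc _ ≤ ∑ k : Fin n, lam i ^ (2 * s) := by
            refine Finset.sum_le_sum fun k _ => ?_
            simp only [mul_pow]
            rw [← Finset.mul_sum, ← pow_mul, mul_comm s 2]
            exact mul_le_of_le_one_right ((even_two_mul s).pow_nonneg _) (hrow k i)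
        _ = _ := by simp
    rw [e1] at hy3
    have hdpos : (0 : ℝ) < d := by
      have : 0 < d := by omega
      exact_mod_cast this
    have hS : 0 ≤ ∑ i, lam i ^ (2 * s) :=
      Finset.sum_nonneg fun i _ => (even_two_mul s).pow_nonneg _
    have hd4' : (n : ℝ) ≤ 4 * d := by exact_mod_cast hd4
    have := hy3.trans (e2.trans (mul_le_mul_of_nonneg_right hd4' hS))
    refine le_of_mul_le_mul_left ?_ hdpos
    linarith

lemma quad_step {ι : Type*} [Fintype ι] [DecidableEq ι] (lam : ι → ℝ) (B : Matrix ι ι ℝ)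
    (hB : B.IsSymm) (K : Finset ι) (hBK : ∀ r, ∀ j ∈ K, B r j = 0) (M : ℝ) (hM : 0 < M)
    (hK : ∀ j ∉ K, |lam j| ≤ M) (hall : ∀ j, |lam j| ≤ 2 * M) :
    ∃ ε > 0, ∀ d : ℝ, 0 < d → d < ε → ∀ u : ι → ℝ,
      |u ⬝ᵥ (diagonal lam + d • B) *ᵥ u| ≤ 2 * M * (u ⬝ᵥ u) := by
  set b := ∑ i, ∑ j, |B i j| with hb
  have hb0 : 0 ≤ b := by positivity
  refine ⟨M / (b + 1), by positivity, fun d hd hdε u => ?_⟩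
  have hdb : d * b ≤ M := by
    rw [lt_div_iff₀ (by positivity)] at hdε
    nlinarith
  set S := ∑ j ∈ Kᶜ, u j ^ 2 with hS
  have hS0 : 0 ≤ S := by positivity
  have hBu : |u ⬝ᵥ B *ᵥ u| ≤ b * S := by
    have e : u ⬝ᵥ B *ᵥ u = ∑ i, ∑ j, B i j * (u i * u j) := by
      simp only [dotProduct, mulVec, Finset.mul_sum]
      exact Finset.sum_congr rfl fun _ _ => Finset.sum_congr rfl fun _ _ => by ring
    rw [e, hb, Finset.sum_mul]
    refine (Finset.abs_sum_le_sum_abs _ _).trans (Finset.sum_le_sum fun i _ => ?_)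
    rw [Finset.sum_mul]
    refine (Finset.abs_sum_le_sum_abs _ _).trans (Finset.sum_le_sum fun j _ => ?_)
    rw [abs_mul]
    by_cases hi : i ∈ K
    · rw [← hB.apply i j, hBK j i hi]; simp
    by_cases hj : j ∈ K
    · rw [hBK i j hj]; simp
    refine mul_le_mul_of_nonneg_left ?_ (abs_nonneg _)
    have h1 : u i ^ 2 ≤ S := Finset.single_le_sum (f := fun j => u j ^ 2)
      (fun j _ => sq_nonneg _) (by simpa using hi)
    have h2 : u j ^ 2 ≤ S := Finset.single_le_sum (f := fun j => u j ^ 2)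
      (fun j _ => sq_nonneg _) (by simpa using hj)
    rw [abs_le]
    constructor <;> nlinarith [sq_nonneg (u i - u j), sq_nonneg (u i + u j)]
  have hD : |u ⬝ᵥ diagonal lam *ᵥ u| ≤ 2 * M * (∑ j ∈ K, u j ^ 2) + M * S := by
    have e : u ⬝ᵥ diagonal lam *ᵥ u = (∑ j ∈ K, lam j * u j ^ 2) + ∑ j ∈ Kᶜ, lam j * u j ^ 2 := by
      rw [Finset.sum_add_sum_compl]
      simp only [dotProduct, mulVec_diagonal]
      exact Finset.sum_congr rfl fun _ _ => by ring
    rw [e, Finset.mul_sum, hS, Finset.mul_sum]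
    refine (abs_add_le _ _).trans (add_le_add ?_ ?_)
    · refine (Finset.abs_sum_le_sum_abs _ _).trans (Finset.sum_le_sum fun j hj => ?_)
      rw [abs_mul, abs_of_nonneg (sq_nonneg (u j))]
      exact mul_le_mul_of_nonneg_right (hall j) (sq_nonneg _)
    · refine (Finset.abs_sum_le_sum_abs _ _).trans (Finset.sum_le_sum fun j hj => ?_)
      rw [abs_mul, abs_of_nonneg (sq_nonneg (u j))]
      exact mul_le_mul_of_nonneg_right (hK j (by simpa using hj)) (sq_nonneg _)
  have hu : u ⬝ᵥ u = (∑ j ∈ K, u j ^ 2) + S := by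
    rw [hS, Finset.sum_add_sum_compl]
    simp only [dotProduct, sq]
  rw [add_mulVec, smul_mulVec, dotProduct_add, dotProduct_smul, smul_eq_mul, hu]
  refine (abs_add_le _ _).trans ?_
  rw [abs_mul, abs_of_pos hd]
  nlinarith [mul_le_mul_of_nonneg_left hBu hd.le, mul_le_mul_of_nonneg_right hdb hS0]

lemma young_pow (a R : ℝ) (ha : 0 ≤ a) (hR : 0 ≤ R) (s : ℕ) :
    (s + 1) * a ^ s * R ≤ s * a ^ (s + 1) + R ^ (s + 1) := by
  induction s with
  | zero => simp
  | succ s ih =>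
    have h1 := mul_le_mul_of_nonneg_right ih ha
    have h2 := pow_mix a R ha hR (s + 1) 1
    push_cast
    simp only [pow_succ, pow_one, pow_zero] at *
    nlinarith

lemma dot_orth {ι : Type*} [Fintype ι] [DecidableEq ι] (U : Matrix ι ι ℝ) (hU : Uᵀ * U = 1)
    (u v : ι → ℝ) : (U *ᵥ u) ⬝ᵥ (U *ᵥ v) = u ⬝ᵥ v := by
  rw [dotProduct_mulVec, ← mulVec_transpose, mulVec_mulVec, hU, one_mulVec]

lemma conj_pow' {ι : Type*} [Fintype ι] [DecidableEq ι] (U Z : Matrix ι ι ℝ) (hU : Uᵀ * U = 1)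
    (hU' : U * Uᵀ = 1) (N : ℕ) : (U * Z * Uᵀ) ^ N = U * Z ^ N * Uᵀ := by
  induction N with
  | zero => simp [hU']
  | succ N ih =>
    rw [pow_succ, ih, pow_succ]
    calc U * Z ^ N * Uᵀ * (U * Z * Uᵀ) = U * Z ^ N * (Uᵀ * U) * Z * Uᵀ := by
          simp only [mul_assoc]
      _ = _ := by rw [hU]; simp only [mul_assoc, one_mul]

lemma quad_conj {ι : Type*} [Fintype ι] [DecidableEq ι] (U Z : Matrix ι ι ℝ) (u : ι → ℝ) :
    u ⬝ᵥ (U * Z * Uᵀ) *ᵥ u = (Uᵀ *ᵥ u) ⬝ᵥ Z *ᵥ (Uᵀ *ᵥ u) := by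
  rw [← mulVec_mulVec, ← mulVec_mulVec, dotProduct_mulVec, ← mulVec_transpose]

lemma step_general {ι β : Type*} [Fintype ι] [Nonempty ι] [DecidableEq ι] [Fintype β]
    [DecidableEq β]
    (blk : ι → β) (q n : ℕ) (hn : 16 ≤ n)
    (hq : ∀ b, (Finset.univ.filter fun a => blk a = b).card ≤ q)
    (A : Fin n → Matrix ι ι ℝ) (hA : ∀ k, (A k).IsSymm) (hb : ∀ k, IsBlk blk (A k))
    (hcon : ∀ k u, (A k *ᵥ u) ⬝ᵥ (A k *ᵥ u) ≤ u ⬝ᵥ u) (X : Matrix ι ι ℝ) (hX : X.IsSymm)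
    (hXb : IsBlk blk X) (x : Fin n → ℝ) (s : ℕ)
    (act : Finset (Fin n)) (hact : n < 2 * act.card) (R M : ℝ) (hR : 0 < R) (hM : 0 < M)
    (hg : trace (X ^ (2 * (s + 1))) ≤ Fintype.card ι * R ^ (s + 1))
    (hquad : ∀ u : ι → ℝ, |u ⬝ᵥ X *ᵥ u| ≤ 2 * M * (u ⬝ᵥ u))
    (hKM : 8 * q * (Fintype.card ι * R ^ (s + 1)) ≤ n * M ^ (2 * (s + 1))) :
    ∃ y : Fin n → ℝ, (∀ i ∉ act, y i = 0) ∧ ∑ i, y i ^ 2 = 1 ∧ ∑ i, x i * y i = 0 ∧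
      ∃ ε > 0, ∀ d : ℝ, 0 < d → d < ε →
        trace ((X + d • ∑ k, y k • A k) ^ (2 * (s + 1))) ≤ Fintype.card ι * R ^ (s + 1)
          + d ^ 2 * (17 * (s + 1) ^ 2 * (Fintype.card ι * R ^ s)) ∧
        ∀ u : ι → ℝ, |u ⬝ᵥ (X + d • ∑ k, y k • A k) *ᵥ u| ≤ 2 * M * (u ⬝ᵥ u) := by
  obtain ⟨U, lam, hU, hU', hXU, hUb⟩ := spectral_blk blk X hX hXb
  have hUt : Uᵀᵀ * Uᵀ = 1 := by rw [transpose_transpose, hU']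
  have hlam : ∀ j, |lam j| ≤ 2 * M := by
    intro j
    have h := hquad (U *ᵥ Pi.single j 1)
    rw [dot_orth U hU, hXU, quad_conj, mulVec_mulVec, hU, one_mulVec] at h
    simpa [mulVec_diagonal] using h
  have htr : trace (X ^ (2 * (s + 1))) = ∑ j, lam j ^ (2 * (s + 1)) := by
    rw [hXU, conj_pow' U _ hU hU', trace_mul_comm, ← mul_assoc, hU, one_mul, diagonal_pow,
      trace_diagonal]; rfl
  set m : ℝ := (Fintype.card ι : ℝ) with hm
  have hm0 : 0 < m := by rw [hm]; exact_mod_cast Fintype.card_pos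
  let K : Finset ι := Finset.univ.filter fun j => M < |lam j|
  have hKc : 8 * (q * K.card) ≤ n := by
    have h1 : (K.card : ℝ) * M ^ (2 * (s + 1)) ≤ m * R ^ (s + 1) := by
      rw [htr] at hg
      refine le_trans ?_ hg
      rw [← nsmul_eq_mul]
      refine (Finset.card_nsmul_le_sum K (fun j => lam j ^ (2 * (s + 1))) _ ?_).trans ?_
      · intro j hj
        have := (Finset.mem_filter.1 hj).2
        rw [← (even_two_mul (s + 1)).pow_abs (lam j)]
        exact pow_le_pow_left₀ hM.le this.le _
      · exact Finset.sum_le_sum_of_subset_of_nonneg (Finset.subset_univ _)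
          (fun j _ _ => (even_two_mul _).pow_nonneg _)
    have h2 : 0 < M ^ (2 * (s + 1)) := by positivity
    have h3 : (8 * (q * K.card) : ℝ) * M ^ (2 * (s + 1)) ≤ n * M ^ (2 * (s + 1)) := by
      refine le_trans ?_ hKM
      have : (0 : ℝ) ≤ 8 * q := by positivity
      nlinarith [mul_le_mul_of_nonneg_left h1 this]
    exact_mod_cast le_of_mul_le_mul_right h3 h2
  let A' : Fin n → Matrix ι ι ℝ := fun k => Uᵀ * A k * U
  have hA' : ∀ k, (A' k).IsSymm := by
    intro k
    simp only [A', IsSymm, transpose_mul, transpose_transpose, (hA k).eq, mul_assoc]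
  have hb' : ∀ k, IsBlk blk (A' k) := fun k => (hUb.transpose.mul (hb k)).mul hUb
  have hrow : ∀ k i, ∑ j, A' k i j ^ 2 ≤ 1 := by
    intro k i
    have h1 : (A' k *ᵥ Pi.single i 1) ⬝ᵥ (A' k *ᵥ Pi.single i 1) ≤ 1 := by
      simp only [A']
      rw [← mulVec_mulVec, ← mulVec_mulVec, dot_orth _ hUt]
      refine (hcon k _).trans ?_
      rw [dot_orth _ hU]; simp
    refine le_trans (le_of_eq ?_) h1
    simp only [dotProduct, mulVec_single_one, col_apply]
    exact Finset.sum_congr rfl fun j _ => by rw [(hA' k).apply, sq]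
  obtain ⟨y, hy1, hy2, hy3, hy4, hy5, hy6⟩ :=
    direction_s4 blk q n hn hq A' hb' hrow lam x s act hact K hKc
  set B' := ∑ k, y k • A' k with hB'
  have hBs : B'.IsSymm := by
    rw [IsSymm, hB', transpose_sum]
    exact Finset.sum_congr rfl fun k _ => by rw [transpose_smul, (hA' k).eq]
  have hBB : ∑ k, y k • A k = U * B' * Uᵀ := by
    rw [hB', Finset.mul_sum, Finset.sum_mul]
    refine Finset.sum_congr rfl fun k _ => ?_
    simp only [A', mul_smul_comm, smul_mul_assoc]
    congr 1
    calc A k = (U * Uᵀ) * A k * (U * Uᵀ) := by rw [hU', one_mul, mul_one]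
      _ = _ := by simp only [mul_assoc]
  have hsum : ∀ d : ℝ, X + d • ∑ k, y k • A k = U * (diagonal lam + d • B') * Uᵀ := by
    intro d
    rw [hBB, hXU, mul_add, add_mul, mul_smul_comm, smul_mul_assoc]
  obtain ⟨ε1, hε1, h1⟩ := trace_expand lam B' hBs s hy5 ((s + 1) ^ 2 * (m * R ^ s)) (by positivity)
  obtain ⟨ε2, hε2, h2⟩ := quad_step lam B' hBs K hy4 M hM
    (fun j hj => by simpa [K] using hj) hlam
  have hmean : ∑ i, lam i ^ (2 * s) ≤ m * R ^ s := by
    have h3 : ∀ i, (s + 1) * R * lam i ^ (2 * s) ≤ s * lam i ^ (2 * (s + 1)) + R ^ (s + 1) := by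
      intro i
      have := young_pow (lam i ^ 2) R (sq_nonneg _) hR.le s
      rw [← pow_mul, ← pow_mul] at this
      linarith
    have h4 := Finset.sum_le_sum fun i (_ : i ∈ Finset.univ) => h3 i
    rw [← Finset.mul_sum, Finset.sum_add_distrib, ← Finset.mul_sum, Finset.sum_const,
      Finset.card_univ, nsmul_eq_mul, ← hm, ← htr] at h4
    have h5 : (0 : ℝ) < (s + 1) * R := by positivity
    refine le_of_mul_le_mul_left ?_ h5
    have hs0 : (0 : ℝ) ≤ s := by positivity
    have := mul_le_mul_of_nonneg_left hg hs0
    calc _ ≤ _ := h4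
      _ ≤ s * (m * R ^ (s + 1)) + m * R ^ (s + 1) := by linarith
      _ = _ := by ring
  refine ⟨y, hy1, hy2, hy3, min ε1 ε2, lt_min hε1 hε2, fun d hd hdε => ⟨?_, ?_⟩⟩
  · have h3 := h1 d hd (hdε.trans_le (min_le_left _ _))
    rw [hsum, conj_pow' U _ hU hU', trace_mul_comm, ← mul_assoc, hU, one_mul]
    rw [← htr] at h3
    refine h3.trans (add_le_add hg (mul_le_mul_of_nonneg_left ?_ (sq_nonneg d)))
    have h4 := hy6.trans (mul_le_mul_of_nonneg_left hmean (by norm_num))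
    have h5 : (0 : ℝ) ≤ (2 * (s + 1)) ^ 2 := by positivity
    have := mul_le_mul_of_nonneg_left h4 h5
    linarith
  · intro u
    rw [hsum, quad_conj]
    refine (h2 d hd (hdε.trans_le (min_le_right _ _)) _).trans ?_
    rw [dot_orth _ hUt]

lemma bern_pow (R t : ℝ) (hR : 0 ≤ R) (ht : 0 ≤ t) (s : ℕ) :
    R ^ (s + 1) + (s + 1) * R ^ s * t ≤ (R + t) ^ (s + 1) := by
  induction s with
  | zero => simp
  | succ s ih =>
    have h1 := mul_le_mul_of_nonneg_right ih (add_nonneg hR ht)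
    have h2 : 0 ≤ (s + 1) * R ^ s * t * t := by positivity
    rw [pow_succ (R + t)]
    refine le_trans ?_ h1
    push_cast
    have : (R ^ (s + 1) + (s + 1) * R ^ s * t) * (R + t)
      = R ^ (s + 1 + 1) + (s + 1 + 1) * R ^ (s + 1) * t + (s + 1) * R ^ s * t * t := by ring
    rw [this]; linarith

theorem core {ι β : Type*} [Fintype ι] [Nonempty ι] [DecidableEq ι] [Fintype β]
    [DecidableEq β]
    (blk : ι → β) (q n : ℕ) (hn : 16 ≤ n)
    (hq : ∀ b, (Finset.univ.filter fun a => blk a = b).card ≤ q)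
    (A : Fin n → Matrix ι ι ℝ) (hA : ∀ k, (A k).IsSymm) (hb : ∀ k, IsBlk blk (A k))
    (hcon : ∀ k u, (A k *ᵥ u) ⬝ᵥ (A k *ᵥ u) ≤ u ⬝ᵥ u) (s : ℕ)
    (hs : (8 : ℝ) * q * Fintype.card ι ≤ n * 16 ^ (s + 1)) (M : ℝ) (hM : 0 < M)
    (hM2 : M ^ 2 = 544 * (s + 1) * n)
    (x0 : Fin n → ℝ) (hx0 : ∀ i, x0 i ∈ Set.Icc (-1 : ℝ) 1) :
    ∃ x : Fin n → ℝ, (∀ i, x i ∈ Set.Icc (-1 : ℝ) 1) ∧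
      (∀ u : ι → ℝ, |u ⬝ᵥ (∑ i, (x i - x0 i) • A i) *ᵥ u| ≤ 2 * M * (u ⬝ᵥ u)) ∧
      (n : ℝ) / 2 ≤ ({i : Fin n | x i = 1 ∨ x i = -1}.ncard : ℝ) := by
  let F : (Fin n → ℝ) → Matrix ι ι ℝ := fun x => ∑ i, (x i - x0 i) • A i
  have hF : Continuous F := by fun_prop
  let R : (Fin n → ℝ) → ℝ := fun x => 17 * (s + 1) * (∑ i, x i ^ 2 + n)
  have hRc : Continuous R := by fun_prop
  have hn0 : (0 : ℝ) < n := by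
    have : 0 < n := by omega
    exact_mod_cast this
  have hR0 : ∀ x, 0 < R x := by
    intro x
    have : 0 ≤ ∑ i, x i ^ 2 := by positivity
    have : 0 < ∑ i, x i ^ 2 + n := by linarith
    positivity
  let S : Set (Fin n → ℝ) := {x | (∀ i, x i ∈ Set.Icc (-1 : ℝ) 1) ∧
    trace (F x ^ (2 * (s + 1))) ≤ Fintype.card ι * R x ^ (s + 1) ∧
    ∀ u : ι → ℝ, |u ⬝ᵥ F x *ᵥ u| ≤ 2 * M * (u ⬝ᵥ u)}
  have hSc : IsCompact S := by
    have hcube : IsCompact (Set.pi Set.univ fun _ : Fin n => Set.Icc (-1 : ℝ) 1) :=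
      isCompact_univ_pi fun _ => isCompact_Icc
    have hcl : IsClosed {x : Fin n → ℝ |
        trace (F x ^ (2 * (s + 1))) ≤ Fintype.card ι * R x ^ (s + 1) ∧
        ∀ u : ι → ℝ, |u ⬝ᵥ F x *ᵥ u| ≤ 2 * M * (u ⬝ᵥ u)} := by
      have hc1 : IsClosed {x : Fin n → ℝ |
          trace (F x ^ (2 * (s + 1))) ≤ Fintype.card ι * R x ^ (s + 1)} :=
        isClosed_le (by fun_prop) (by fun_prop)
      have hc2 : ∀ u : ι → ℝ, IsClosed {x : Fin n → ℝ | |u ⬝ᵥ F x *ᵥ u| ≤ 2 * M * (u ⬝ᵥ u)} := by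
        intro u
        refine isClosed_le ?_ continuous_const
        have : Continuous fun x => F x *ᵥ u := hF.matrix_mulVec continuous_const
        have := (continuous_const (y := u)).dotProduct this
        exact this.abs
      have heq := hc1.inter (isClosed_iInter hc2)
      convert heq using 1
      ext x
      simp
    have : S = (Set.pi Set.univ fun _ : Fin n => Set.Icc (-1 : ℝ) 1) ∩ {x : Fin n → ℝ |
        trace (F x ^ (2 * (s + 1))) ≤ Fintype.card ι * R x ^ (s + 1) ∧
        ∀ u : ι → ℝ, |u ⬝ᵥ F x *ᵥ u| ≤ 2 * M * (u ⬝ᵥ u)} := by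
      ext x; simp only [S, Set.mem_inter_iff, Set.mem_ofPred_eq, Set.mem_univ_pi]
    rw [this]
    exact hcube.inter_right hcl
  have hx0S : x0 ∈ S := by
    have h0 : F x0 = 0 := by simp [F]
    refine ⟨hx0, ?_, fun u => ?_⟩
    · rw [h0, zero_pow (by omega), trace_zero]
      have := hR0 x0
      positivity
    · rw [h0, zero_mulVec, dotProduct_zero, abs_zero]
      have : 0 ≤ u ⬝ᵥ u := Finset.sum_nonneg fun i _ => mul_self_nonneg _
      positivity
  obtain ⟨x, hxS, hmax⟩ := hSc.exists_isMaxOn ⟨x0, hx0S⟩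
    (f := fun x => ∑ i, x i ^ 2) (by fun_prop)
  refine ⟨x, hxS.1, hxS.2.2, ?_⟩
  by_contra hcard
  push Not at hcard
  let act : Finset (Fin n) := Finset.univ.filter fun i => ¬ (x i = 1 ∨ x i = -1)
  have hact : n < 2 * act.card := by
    have h1 : {i : Fin n | x i = 1 ∨ x i = -1}.ncard
        = (Finset.univ.filter fun i => x i = 1 ∨ x i = -1).card := by
      rw [← Set.ncard_coe_finset]; congr 1; ext; simp
    have h2 := Finset.card_filter_add_card_filter_not (s := (Finset.univ : Finset (Fin n)))
      (fun i => x i = 1 ∨ x i = -1)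
    rw [Finset.card_univ, Fintype.card_fin] at h2
    rw [h1] at hcard
    have h3 : 2 * (Finset.univ.filter fun i => x i = 1 ∨ x i = -1).card < n := by
      have : (2 : ℝ) * (Finset.univ.filter fun i => x i = 1 ∨ x i = -1).card < n := by linarith
      exact_mod_cast this
    change n < 2 * (Finset.univ.filter fun i => ¬ (x i = 1 ∨ x i = -1)).card
    omega
  have hFs : (F x).IsSymm := by
    simp only [IsSymm, F, transpose_sum, transpose_smul, (hA _).eq]
  have hFb : IsBlk blk (F x) := by
    intro a b hab
    simp only [F, Matrix.sum_apply, Matrix.smul_apply, hb _ a b hab, smul_zero,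
      Finset.sum_const_zero]
  have hsq : ∑ i, x i ^ 2 ≤ n := by
    calc ∑ i, x i ^ 2 ≤ ∑ i : Fin n, (1 : ℝ) := Finset.sum_le_sum fun i _ => by
          have := hxS.1 i
          nlinarith [this.1, this.2]
      _ = n := by simp
  have hRle : R x ≤ 34 * (s + 1) * n := by
    have : (0 : ℝ) ≤ 17 * (s + 1) := by positivity
    have := mul_le_mul_of_nonneg_left (add_le_add_left hsq (n : ℝ)) this
    simp only [R]
    linarith
  have hKM : 8 * q * (Fintype.card ι * R x ^ (s + 1)) ≤ n * M ^ (2 * (s + 1)) := by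
    have e : M ^ (2 * (s + 1)) = 16 ^ (s + 1) * (34 * (s + 1) * n : ℝ) ^ (s + 1) := by
      rw [pow_mul, hM2, ← mul_pow]; ring
    rw [e]
    calc 8 * q * (Fintype.card ι * R x ^ (s + 1)) = (8 * q * Fintype.card ι) * R x ^ (s + 1) := by
          ring
      _ ≤ (n * 16 ^ (s + 1)) * (34 * (s + 1) * n : ℝ) ^ (s + 1) := by
          have := (hR0 x).le
          gcongr
      _ = _ := by ring
  obtain ⟨y, hy1, hy2, hy3, ε, hε, hstep⟩ := step_general blk q n hn hq A hA hb hcon (F x) hFs hFb x s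
    act hact (R x) M (hR0 x) hM hxS.2.1 hxS.2.2 hKM
  have hcubeev : ∀ᶠ d in nhds (0 : ℝ), ∀ i ∈ act, x i + d * y i ∈ Set.Icc (-1 : ℝ) 1 := by
    rw [Filter.eventually_all_finset]
    intro i hi
    have hi' := (Finset.mem_filter.1 hi).2
    push Not at hi'
    have h1 : x i ∈ Set.Ioo (-1 : ℝ) 1 :=
      ⟨lt_of_le_of_ne (hxS.1 i).1 (Ne.symm hi'.2), lt_of_le_of_ne (hxS.1 i).2 hi'.1⟩
    have hc : Continuous fun d : ℝ => x i + d * y i := by fun_prop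
    have := (hc.tendsto 0).eventually (p := fun z => z ∈ Set.Ioo (-1 : ℝ) 1)
      (isOpen_Ioo.mem_nhds (by simpa using h1))
    exact this.mono fun d hd => Set.Ioo_subset_Icc_self hd
  obtain ⟨ε', hε', hball⟩ := Metric.eventually_nhds_iff.1 hcubeev
  obtain ⟨d, hd0, hdlt⟩ := exists_between (lt_min hε hε')
  have hdε := hdlt.trans_le (min_le_left _ _)
  have hdε' := hdlt.trans_le (min_le_right _ _)
  obtain ⟨ht, hqd⟩ := hstep d hd0 hdε
  have hFx : F (fun i => x i + d * y i) = F x + d • ∑ k, y k • A k := by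
    simp only [F, Finset.smul_sum, ← Finset.sum_add_distrib, smul_smul, ← add_smul]
    exact Finset.sum_congr rfl fun i _ => by congr 1; ring
  have hsum : ∑ i, (x i + d * y i) ^ 2 = ∑ i, x i ^ 2 + d ^ 2 := by
    have : ∀ i, (x i + d * y i) ^ 2 = x i ^ 2 + 2 * d * (x i * y i) + d ^ 2 * y i ^ 2 :=
      fun i => by ring
    simp only [this, Finset.sum_add_distrib, ← Finset.mul_sum, hy2, hy3]
    ring
  have hmem : (fun i => x i + d * y i) ∈ S := by
    refine ⟨fun i => ?_, ?_, ?_⟩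
    · by_cases hi : i ∈ act
      · exact hball (y := d) (by simpa [abs_of_pos hd0] using hdε') i hi
      · simpa [hy1 i hi] using hxS.1 i
    · rw [hFx]
      refine ht.trans ?_
      have hR' : R (fun i => x i + d * y i) = R x + 17 * (s + 1) * d ^ 2 := by
        simp only [R, hsum]; ring
      rw [hR']
      have := bern_pow (R x) (17 * (s + 1) * d ^ 2) (hR0 x).le (by positivity) s
      have hm : (0 : ℝ) ≤ Fintype.card ι := by positivity
      have := mul_le_mul_of_nonneg_left this hm
      refine le_trans (le_of_eq ?_) this
      ring
    · rw [hFx]; exact hqd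
  have := hmax hmem
  simp only [Set.mem_ofPred_eq] at this
  rw [hsum] at this
  nlinarith [sq_pos_of_pos hd0]

lemma norm_sq_toEuclidean {m : ℕ} (A : Matrix (Fin m) (Fin m) ℝ) (u : Fin m → ℝ) :
    ‖Matrix.toEuclideanCLM (𝕜 := ℝ) (n := Fin m) A (WithLp.toLp 2 u)‖ ^ 2
      = (A *ᵥ u) ⬝ᵥ (A *ᵥ u) := by
  rw [EuclideanSpace.norm_sq_eq]
  simp only [Matrix.toEuclideanCLM_toLp, dotProduct, Real.norm_eq_abs, sq, abs_mul_abs_self]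

lemma norm_sq_toLp {m : ℕ} (u : Fin m → ℝ) :
    ‖(WithLp.toLp 2 u : EuclideanSpace ℝ (Fin m))‖ ^ 2 = u ⬝ᵥ u := by
  rw [EuclideanSpace.norm_sq_eq]
  simp only [dotProduct, Real.norm_eq_abs, sq, abs_mul_abs_self]

lemma contraction_of_norm {m : ℕ} (A : Matrix (Fin m) (Fin m) ℝ) (h : matrixOpNorm A ≤ 1)
    (u : Fin m → ℝ) : (A *ᵥ u) ⬝ᵥ (A *ᵥ u) ≤ u ⬝ᵥ u := by
  rw [← norm_sq_toEuclidean, ← norm_sq_toLp]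
  refine pow_le_pow_left₀ (norm_nonneg _) ?_ 2
  have := (Matrix.toEuclideanCLM (𝕜 := ℝ) (n := Fin m) A).le_of_opNorm_le h (WithLp.toLp 2 u)
  simpa using this

lemma norm_le_of_quad {m : ℕ} (X : Matrix (Fin m) (Fin m) ℝ) (hX : X.IsSymm) (c : ℝ) (hc : 0 ≤ c)
    (h : ∀ u : Fin m → ℝ, |u ⬝ᵥ X *ᵥ u| ≤ c * (u ⬝ᵥ u)) : matrixOpNorm X ≤ c := by
  obtain ⟨U, lam, hU, hU', hXU⟩ := spectral_simple X hX
  have hUt : Uᵀᵀ * Uᵀ = 1 := by rw [transpose_transpose, hU']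
  have hlam : ∀ j, |lam j| ≤ c := by
    intro j
    have h := h (U *ᵥ Pi.single j 1)
    rw [dot_orth U hU, hXU, quad_conj, mulVec_mulVec, hU, one_mulVec] at h
    simpa [mulVec_diagonal] using h
  refine ContinuousLinearMap.opNorm_le_bound _ hc fun v => ?_
  obtain ⟨u, rfl⟩ : ∃ u, v = WithLp.toLp 2 u := ⟨v.ofLp, rfl⟩
  refine (pow_le_pow_iff_left₀ (by positivity) (by positivity) two_ne_zero).1 ?_
  rw [norm_sq_toEuclidean, mul_pow, norm_sq_toLp, hXU, ← mulVec_mulVec, ← mulVec_mulVec,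
    dot_orth U hU, ← dot_orth Uᵀ hUt u u]
  simp only [dotProduct, mulVec_diagonal, Finset.mul_sum]
  refine Finset.sum_le_sum fun j _ => ?_
  have h1 : lam j ^ 2 ≤ c ^ 2 := by
    rw [← sq_abs]; exact pow_le_pow_left₀ (abs_nonneg _) (hlam j) 2
  have := mul_le_mul_of_nonneg_right h1 (mul_self_nonneg ((Uᵀ *ᵥ u) j))
  linarith

lemma opnorm_comb_le {m n : ℕ} (A : Fin n → Matrix (Fin m) (Fin m) ℝ)
    (h : ∀ i, matrixOpNorm (A i) ≤ 1) (z : Fin n → ℝ) (hz : ∀ i, |z i| ≤ 2) :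
    matrixOpNorm (∑ i, z i • A i) ≤ 2 * n := by
  unfold matrixOpNorm
  rw [map_sum]
  refine (norm_sum_le _ _).trans ?_
  calc _ ≤ ∑ i : Fin n, (2 : ℝ) := by
        refine Finset.sum_le_sum fun i _ => ?_
        rw [map_smul, norm_smul, Real.norm_eq_abs]
        have h1 : ‖Matrix.toEuclideanCLM (𝕜 := ℝ) (n := Fin m) (A i)‖ ≤ 1 := h i
        have := mul_le_mul (hz i) h1 (norm_nonneg _) (by norm_num)
        linarith
    _ = _ := by simp [mul_comm]

end

/-- **Partial coloring for matrix balancing (Theorem 10).** There is a universal constant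
`C > 0` such that for any symmetric `q`-block diagonal matrices `A_1, …, A_n ∈ ℝ^{m×m}` with
`‖A_i‖_op ≤ 1` (where `q ∣ m`, `qm ≥ n`) and any starting point `x⁰ ∈ [-1,1]^n`, there exists
`x ∈ [-1,1]^n` with `‖∑ i, (x_i - x⁰_i) A_i‖_op ≤ C √(n log(2qm/n))` and at least `n/2`
coordinates of `x` in `{-1,1}`. -/
theorem stmt_4 :
    ∃ C : ℝ, 0 < C ∧
      ∀ (q m n : ℕ), q ∣ m → n ≤ q * m →
        ∀ A : Fin n → Matrix (Fin m) (Fin m) ℝ,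
          (∀ i, (A i).IsSymm) →
          (∀ i, IsBlockDiagonal q (A i)) →
          (∀ i, matrixOpNorm (A i) ≤ 1) →
          ∀ x0 : Fin n → ℝ, (∀ i, x0 i ∈ Set.Icc (-1 : ℝ) 1) →
            ∃ x : Fin n → ℝ,
              (∀ i, x i ∈ Set.Icc (-1 : ℝ) 1) ∧
              matrixOpNorm (∑ i, (x i - x0 i) • A i) ≤
                C * Real.sqrt ((n : ℝ) * Real.log (2 * (q : ℝ) * (m : ℝ) / (n : ℝ))) ∧
              (n : ℝ) / 2 ≤ ({i : Fin n | x i = 1 ∨ x i = -1}.ncard : ℝ) := by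
  refine ⟨100, by norm_num, ?_⟩
  intro q m n hqm hnqm A hA hb hnorm x0 hx0
  set L := Real.log (2 * (q : ℝ) * (m : ℝ) / (n : ℝ)) with hL
  -- facts for positive n
  have hLn : 0 < n → 1 ≤ 1.5 * L := by
    intro hn
    have hn0 : (0 : ℝ) < n := by exact_mod_cast hn
    have h1 : (2 : ℝ) ≤ 2 * (q : ℝ) * (m : ℝ) / (n : ℝ) := by
      rw [le_div_iff₀ hn0]
      have : (n : ℝ) ≤ q * m := by exact_mod_cast hnqm
      linarith
    have h2 := Real.log_le_log (by norm_num) h1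
    have h3 := Real.log_two_gt_d9
    rw [← hL] at h2
    linarith
  by_cases hn : n < 16
  · refine ⟨fun _ => 1, fun _ => by simp, ?_, ?_⟩
    · refine (opnorm_comb_le A hnorm _ fun i => ?_).trans ?_
      · have := hx0 i
        rw [abs_le]; constructor <;> linarith [this.1, this.2]
      · rcases Nat.eq_zero_or_pos n with rfl | hpos
        · simp
        · have h1 := hLn hpos
          have h2 : (n : ℝ) ≤ 16 := by exact_mod_cast hn.le
          have h3 : (0 : ℝ) < n := by exact_mod_cast hpos
          have h4 : (n : ℝ) / 50 ≤ Real.sqrt (n * L) := by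
            apply Real.le_sqrt_of_sq_le
            nlinarith
          linarith
    · have : {i : Fin n | (1 : ℝ) = 1 ∨ (1 : ℝ) = -1} = Set.univ := by ext; simp
      rw [this, Set.ncard_univ, Nat.card_eq_fintype_card, Fintype.card_fin]
      have : (0 : ℝ) ≤ n := by positivity
      linarith
  · have hn16 : 16 ≤ n := by omega
    have hpos : 0 < n := by omega
    have hn0 : (0 : ℝ) < n := by exact_mod_cast hpos
    have hL1 := hLn hpos
    have hq0 : 0 < q := by
      rcases Nat.eq_zero_or_pos q with rfl | h
      · omega
      · exact h
    have hm0 : 0 < m := by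
      rcases Nat.eq_zero_or_pos m with rfl | h
      · omega
      · exact h
    have : Nonempty (Fin m) := ⟨⟨0, hm0⟩⟩
    let blk : Fin m → Fin m := fun a => ⟨a / q, lt_of_le_of_lt (Nat.div_le_self _ _) a.2⟩
    have hfib : ∀ b, (Finset.univ.filter fun a => blk a = b).card ≤ q := by
      intro b
      have : (Finset.univ.filter fun a => blk a = b).card ≤ (Finset.range q).card := by
        refine Finset.card_le_card_of_injOn (fun a => (a : ℕ) % q) ?_ ?_
        · intro a _
          simpa using Nat.mod_lt _ hq0
        · intro a ha a' ha' haa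
          have h1 : blk a = b := by simpa using ha
          have h2 : blk a' = b := by simpa using ha'
          have h3 : (a : ℕ) / q = (a' : ℕ) / q := by
            have := h1.trans h2.symm
            simpa [blk] using this
          have h4 : (a : ℕ) % q = (a' : ℕ) % q := haa
          apply Fin.ext
          rw [← Nat.div_add_mod (a : ℕ) q, ← Nat.div_add_mod (a' : ℕ) q, h3, h4]
      simpa using this
    have hblk : ∀ k, IsBlk blk (A k) := by
      intro k a b hab
      refine hb k a b fun h => hab ?_
      simp [blk, h]
    have hqm0 : (0 : ℝ) < 2 * (q : ℝ) * (m : ℝ) / (n : ℝ) := by positivity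
    set s := ⌊L⌋₊ with hs
    have hs1 : L ≤ s + 1 := (Nat.lt_floor_add_one L).le
    have hs2 : (s : ℝ) ≤ L := Nat.floor_le (by linarith)
    have hs16 : (8 : ℝ) * q * Fintype.card (Fin m) ≤ n * 16 ^ (s + 1) := by
      rw [Fintype.card_fin]
      have h1 : 2 * (q : ℝ) * (m : ℝ) / (n : ℝ) ≤ Real.exp 1 ^ (s + 1) := by
        rw [← Real.exp_nat_mul, ← Real.log_le_iff_le_exp hqm0]
        push_cast
        rw [mul_one]; exact hs1
      have h2 : Real.exp 1 ^ (s + 1) ≤ 4 ^ (s + 1) :=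
        pow_le_pow_left₀ (Real.exp_pos _).le (by linarith [Real.exp_one_lt_d9]) _
      have h3 : (4 : ℝ) ≤ 4 ^ (s + 1) := by
        have : (1 : ℝ) ≤ 4 ^ s := one_le_pow₀ (by norm_num)
        rw [pow_succ]; linarith
      have h4 : (16 : ℝ) ^ (s + 1) = 4 ^ (s + 1) * 4 ^ (s + 1) := by
        rw [← mul_pow]; norm_num
      have h5 := h1.trans h2
      rw [div_le_iff₀ hn0] at h5
      rw [h4]
      have h6 : (0 : ℝ) ≤ 4 ^ (s + 1) * n := by positivity
      nlinarith [mul_le_mul_of_nonneg_right h3 h6]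
    have hMpos : 0 < Real.sqrt (544 * (s + 1) * n) := Real.sqrt_pos.2 (by positivity)
    obtain ⟨x, hx1, hx2, hx3⟩ := core blk q n hn16 hfib A hA hblk
      (fun k u => contraction_of_norm (A k) (hnorm k) u) s hs16
      (Real.sqrt (544 * (s + 1) * n)) hMpos (Real.sq_sqrt (by positivity)) x0 hx0
    refine ⟨x, hx1, ?_, hx3⟩
    refine (norm_le_of_quad _ ?_ _ (by positivity) hx2).trans ?_
    · simp only [Matrix.IsSymm, Matrix.transpose_sum, Matrix.transpose_smul, (hA _).eq]
    · have h1 : Real.sqrt (544 * (s + 1) * n) ≤ 50 * Real.sqrt (n * L) := by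
        rw [Real.sqrt_le_left (by positivity), mul_pow, Real.sq_sqrt (by nlinarith)]
        nlinarith
      linarith
end
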